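/- arXiv:math/0701571 — 5 statements merged into one kernel-verified Lean document; each statement's English description precedes it below -/
import Mathlib

section
/- Let B be a quaternionic hermitian 6×6 matrix partitioned into four 3×3 blocks B = [[B11, B12], [B̄12, B22]], where B11 and B22 are real symmetric 3×3 matrices and B12 is a symmetric (B12ᵀ = B12, entrywise transpose without conjugation) quaternionic 3×3 matrix (so B lies in the tensor product space Q(2)⊗S(3)). If both B and its entrywise quaternionic conjugate B̄ are positive semidefinite, then B is Q_+(2)⊗S_+(3)-separable, i.e. B = Σ_{l=1}^N A_l ⊗ S_l (Kronecker product) for some finite N, positive semidefinite quaternionic hermitian 2×2 matrices A_l and positive semidefinite real symmetric 3×3 matrices S_l. -/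
open Matrix Kronecker

/-- A quaternionic matrix is positive semidefinite if it is hermitian and
`Re (x* A x) ≥ 0` for every quaternionic vector `x`. -/
def QuatPSD {ι : Type*} [Fintype ι] (A : Matrix ι ι (Quaternion ℝ)) : Prop :=
  A.IsHermitian ∧ ∀ x : ι → Quaternion ℝ, 0 ≤ (star x ⬝ᵥ A.mulVec x).re

set_option linter.all false

namespace S7

/-- intermediate value for a quadratic form along a path -/
lemma qf_cont {n : ℕ} (Φ : Matrix (Fin n) (Fin n) ℝ) : Continuous fun x : Fin n → ℝ => x ⬝ᵥ Φ *ᵥ x := by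
  fun_prop

lemma ivt_path {n : ℕ} (Φ : Matrix (Fin n) (Fin n) ℝ) (p : ℝ → Fin n → ℝ) (hp : Continuous p)
    (h : (p 0 ⬝ᵥ Φ *ᵥ p 0) * (p 1 ⬝ᵥ Φ *ᵥ p 1) ≤ 0) :
    ∃ t ∈ Set.Icc (0:ℝ) 1, p t ⬝ᵥ Φ *ᵥ p t = 0 := by
  have hc : Continuous fun t => p t ⬝ᵥ Φ *ᵥ p t := (qf_cont Φ).comp hp
  have h01 : (0:ℝ) ≤ 1 := zero_le_one
  rcases mul_nonpos_iff.1 h with ⟨h0, h1⟩ | ⟨h0, h1⟩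
  · obtain ⟨t, ht, e⟩ := intermediate_value_Icc' h01 hc.continuousOn ⟨h1, h0⟩
    exact ⟨t, ht, e⟩
  · obtain ⟨t, ht, e⟩ := intermediate_value_Icc h01 hc.continuousOn ⟨h0, h1⟩
    exact ⟨t, ht, e⟩

lemma qf_comb {n : ℕ} (Φ : Matrix (Fin n) (Fin n) ℝ) (a b : Fin n → ℝ) (s t : ℝ) :
    (s • a + t • b) ⬝ᵥ Φ *ᵥ (s • a + t • b) =
      s ^ 2 * (a ⬝ᵥ Φ *ᵥ a) + s * t * (a ⬝ᵥ Φ *ᵥ b + b ⬝ᵥ Φ *ᵥ a) + t ^ 2 * (b ⬝ᵥ Φ *ᵥ b) := by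
  simp only [mulVec_add, mulVec_smul, add_dotProduct, dotProduct_add, smul_dotProduct,
    dotProduct_smul, smul_eq_mul]
  ring

lemma zero1 {n : ℕ} (hn : 0 < n) (Φ : Matrix (Fin n) (Fin n) ℝ) (htr : Φ.trace = 0) :
    ∃ x : Fin n → ℝ, x ≠ 0 ∧ x ⬝ᵥ Φ *ᵥ x = 0 := by
  by_contra hcon
  push Not at hcon
  have hd : ∀ i, (Pi.single i 1 : Fin n → ℝ) ⬝ᵥ Φ *ᵥ (Pi.single i 1) = Φ i i := by
    intro i; simp
  have key : ∀ i j, 0 < Φ i i * Φ j j := by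
    intro i j
    by_contra hneg
    push Not at hneg
    obtain ⟨t, ht, e⟩ := ivt_path Φ (fun t => (1 - t) • (Pi.single i 1 : Fin n → ℝ) + t • Pi.single j 1)
      (by fun_prop) (by simpa using hneg)
    refine hcon _ ?_ e
    intro h0
    by_cases hij : i = j
    · subst hij
      have := congrFun h0 i
      simp at this
    · have h1 := congrFun h0 i
      have h2 := congrFun h0 j
      simp [hij, Ne.symm hij, Pi.single_apply] at h1 h2
      linarith
  have hz : Φ ⟨0, hn⟩ ⟨0, hn⟩ * Φ.trace = 0 := by rw [htr, mul_zero]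
  rw [Matrix.trace, Finset.mul_sum] at hz
  have : 0 < ∑ i, Φ ⟨0, hn⟩ ⟨0, hn⟩ * Φ.diag i :=
    Finset.sum_pos (fun i _ => key _ i) ⟨⟨0, hn⟩, Finset.mem_univ _⟩
  linarith

/-- linear independence of three vectors, in the form we use -/
def Ind3 (a b c : Fin 3 → ℝ) : Prop := ∀ r s t : ℝ, r • a + s • b + t • c = 0 → r = 0 ∧ s = 0 ∧ t = 0

lemma Ind3.swap12 {a b c : Fin 3 → ℝ} (h : Ind3 a b c) : Ind3 b a c := by
  intro r s t e
  have := h s r t (by rw [← e]; module)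
  tauto

lemma Ind3.swap23 {a b c : Fin 3 → ℝ} (h : Ind3 a b c) : Ind3 a c b := by
  intro r s t e
  have := h r t s (by rw [← e]; module)
  tauto

/-- rotate so that the form vanishes at one of the vectors -/
lemma rot (Φ : Matrix (Fin 3) (Fin 3) ℝ) (a b c : Fin 3 → ℝ) (h : Ind3 a b c)
    (hs : (a ⬝ᵥ Φ *ᵥ a) * (b ⬝ᵥ Φ *ᵥ b) ≤ 0) :
    ∃ a' b', Ind3 a' b' c ∧ a' ⬝ᵥ Φ *ᵥ a' = 0 ∧
      ∀ Ψ : Matrix (Fin 3) (Fin 3) ℝ, a' ⬝ᵥ Ψ *ᵥ a' + b' ⬝ᵥ Ψ *ᵥ b' = a ⬝ᵥ Ψ *ᵥ a + b ⬝ᵥ Ψ *ᵥ b := by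
  obtain ⟨t, -, e⟩ := ivt_path Φ (fun t => Real.cos (t * (Real.pi / 2)) • a + Real.sin (t * (Real.pi / 2)) • b)
    (by fun_prop) (by simpa using hs)
  set C := Real.cos (t * (Real.pi / 2))
  set S := Real.sin (t * (Real.pi / 2))
  have hCS : C ^ 2 + S ^ 2 = 1 := Real.cos_sq_add_sin_sq _
  refine ⟨C • a + S • b, (-S) • a + C • b, ?_, e, ?_⟩
  · intro r s u e
    obtain ⟨h1, h2, h3⟩ := h (r * C - s * S) (r * S + s * C) u (by
      rw [← e]; module)
    refine ⟨?_, ?_, h3⟩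
    · linear_combination C * h1 + S * h2 - r * hCS
    · linear_combination C * h2 - S * h1 - s * hCS
  · intro Ψ
    rw [qf_comb, qf_comb]
    linear_combination (a ⬝ᵥ Ψ *ᵥ a + b ⬝ᵥ Ψ *ᵥ b) * hCS

lemma rot3 (Φ : Matrix (Fin 3) (Fin 3) ℝ) (htr : Φ.trace = 0) :
    ∃ a b c, Ind3 a b c ∧ a ⬝ᵥ Φ *ᵥ a = 0 ∧ b ⬝ᵥ Φ *ᵥ b = 0 ∧ c ⬝ᵥ Φ *ᵥ c = 0 ∧
      ∀ Ψ : Matrix (Fin 3) (Fin 3) ℝ, a ⬝ᵥ Ψ *ᵥ a + b ⬝ᵥ Ψ *ᵥ b + c ⬝ᵥ Ψ *ᵥ c = Ψ.trace := by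
  have step1 : ∃ a b c, Ind3 a b c ∧ a ⬝ᵥ Φ *ᵥ a = 0 ∧
      ∀ Ψ : Matrix (Fin 3) (Fin 3) ℝ, a ⬝ᵥ Ψ *ᵥ a + b ⬝ᵥ Ψ *ᵥ b + c ⬝ᵥ Ψ *ᵥ c = Ψ.trace := by
    have h0 : Ind3 (Pi.single 0 1) (Pi.single 1 1) (Pi.single 2 1) := by
      intro r s t e
      have h0 := congrFun e 0
      have h1 := congrFun e 1
      have h2 := congrFun e 2
      simp [Pi.single_apply] at h0 h1 h2
      exact ⟨h0, h1, h2⟩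
    have ht : ∀ Ψ : Matrix (Fin 3) (Fin 3) ℝ, (Pi.single 0 1 : Fin 3 → ℝ) ⬝ᵥ Ψ *ᵥ (Pi.single 0 1)
        + (Pi.single 1 1 : Fin 3 → ℝ) ⬝ᵥ Ψ *ᵥ (Pi.single 1 1)
        + (Pi.single 2 1 : Fin 3 → ℝ) ⬝ᵥ Ψ *ᵥ (Pi.single 2 1) = Ψ.trace := by
      intro Ψ
      simp [Matrix.trace_fin_three]
    generalize (Pi.single 0 1 : Fin 3 → ℝ) = a at *
    generalize (Pi.single 1 1 : Fin 3 → ℝ) = b at *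
    generalize (Pi.single 2 1 : Fin 3 → ℝ) = c at *
    by_cases hab : (a ⬝ᵥ Φ *ᵥ a) * (b ⬝ᵥ Φ *ᵥ b) ≤ 0
    · obtain ⟨a', b', hi, hz, hq⟩ := rot Φ a b c h0 hab
      exact ⟨a', b', c, hi, hz, fun Ψ => by rw [hq, ht]⟩
    · have hac : (a ⬝ᵥ Φ *ᵥ a) * (c ⬝ᵥ Φ *ᵥ c) ≤ 0 := by
        have := ht Φ
        rw [htr] at this
        push Not at hab
        have hc : c ⬝ᵥ Φ *ᵥ c = - (a ⬝ᵥ Φ *ᵥ a) - b ⬝ᵥ Φ *ᵥ b := by linarith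
        rw [hc]
        nlinarith [mul_self_nonneg (a ⬝ᵥ Φ *ᵥ a)]
      obtain ⟨a', b', hi, hz, hq⟩ := rot Φ a c b h0.swap23 hac
      exact ⟨a', b', b, hi, hz, fun Ψ => by rw [hq, ← ht]; ring⟩
  obtain ⟨a, b, c, hi, hz, hq⟩ := step1
  have hbc : (b ⬝ᵥ Φ *ᵥ b) * (c ⬝ᵥ Φ *ᵥ c) ≤ 0 := by
    have := hq Φ
    rw [htr, hz] at this
    have hc : c ⬝ᵥ Φ *ᵥ c = - (b ⬝ᵥ Φ *ᵥ b) := by linarith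
    rw [hc]
    nlinarith [mul_self_nonneg (b ⬝ᵥ Φ *ᵥ b)]
  obtain ⟨b', c', hi', hz', hq'⟩ := rot Φ b c a (hi.swap12.swap23) hbc
  refine ⟨a, b', c', hi'.swap23.swap12, hz, hz', ?_, fun Ψ => by rw [add_assoc, hq', ← hq]; ring⟩
  have h1 := hq' Φ
  have h2 := hq Φ
  rw [htr] at h2
  linarith

lemma seg_zero (Φ Ψ : Matrix (Fin 3) (Fin 3) ℝ) (a b c : Fin 3 → ℝ) (h : Ind3 a b c)
    (ha : a ⬝ᵥ Φ *ᵥ a = 0) (hb : b ⬝ᵥ Φ *ᵥ b = 0) (hab : a ⬝ᵥ Φ *ᵥ b + b ⬝ᵥ Φ *ᵥ a = 0)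
    (hs : (a ⬝ᵥ Ψ *ᵥ a) * (b ⬝ᵥ Ψ *ᵥ b) ≤ 0) :
    ∃ x : Fin 3 → ℝ, x ≠ 0 ∧ x ⬝ᵥ Φ *ᵥ x = 0 ∧ x ⬝ᵥ Ψ *ᵥ x = 0 := by
  obtain ⟨t, -, e⟩ := ivt_path Ψ (fun t => (1 - t) • a + t • b) (by fun_prop) (by simpa using hs)
  refine ⟨_, ?_, ?_, e⟩
  · intro h0
    have := h (1 - t) t 0 (by simpa using h0)
    linarith [this.1, this.2.1]
  · rw [qf_comb, ha, hb, hab]; ring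

lemma path_zero (Φ Ψ : Matrix (Fin 3) (Fin 3) ℝ) (a b c : Fin 3 → ℝ) (h : Ind3 a b c)
    (ha : a ⬝ᵥ Φ *ᵥ a = 0) (hb : b ⬝ᵥ Φ *ᵥ b = 0)
    (hs : (a ⬝ᵥ Ψ *ᵥ a) * (b ⬝ᵥ Ψ *ᵥ b) ≤ 0) :
    ∃ x : Fin 3 → ℝ, x ≠ 0 ∧ x ⬝ᵥ Φ *ᵥ x = 0 ∧ x ⬝ᵥ Ψ *ᵥ x = 0 := by
  set β : (Fin 3 → ℝ) → (Fin 3 → ℝ) → ℝ := fun x y => x ⬝ᵥ Φ *ᵥ y + y ⬝ᵥ Φ *ᵥ x with hβ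
  by_cases hab : β a b = 0
  · exact seg_zero Φ Ψ a b c h ha hb hab hs
  -- the vector orthogonal to a and b
  obtain ⟨e, he, hea, heb⟩ : ∃ e, Ind3 a b e ∧ β a e = 0 ∧ β b e = 0 := by
    refine ⟨c + (-(β b c / β a b)) • a + (-(β a c / β a b)) • b, ?_, ?_, ?_⟩
    · intro r s t e
      obtain ⟨h1, h2, h3⟩ := h (r + t * (-(β b c / β a b))) (s + t * (-(β a c / β a b))) t (by
        rw [← e]; module)
      subst h3
      exact ⟨by linarith, by linarith, rfl⟩
    · have : β a (c + (-(β b c / β a b)) • a + (-(β a c / β a b)) • b)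
          = β a c + (-(β b c / β a b)) * (2 * (a ⬝ᵥ Φ *ᵥ a)) + (-(β a c / β a b)) * β a b := by
        simp only [hβ, mulVec_add, mulVec_smul, add_dotProduct, dotProduct_add, smul_dotProduct,
          dotProduct_smul, smul_eq_mul]
        ring
      rw [this, ha]; field_simp; ring
    · have : β b (c + (-(β b c / β a b)) • a + (-(β a c / β a b)) • b)
          = β b c + (-(β b c / β a b)) * β a b + (-(β a c / β a b)) * (2 * (b ⬝ᵥ Φ *ᵥ b)) := by
        simp only [hβ, mulVec_add, mulVec_smul, add_dotProduct, dotProduct_add, smul_dotProduct,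
          dotProduct_smul, smul_eq_mul]
        ring
      rw [this, hb]; field_simp; ring
  by_cases hse : e ⬝ᵥ Φ *ᵥ e = 0
  · by_cases h1 : (a ⬝ᵥ Ψ *ᵥ a) * (e ⬝ᵥ Ψ *ᵥ e) ≤ 0
    · exact seg_zero Φ Ψ a e b he.swap23 ha hse hea h1
    · refine seg_zero Φ Ψ b e a he.swap12.swap23 hb hse heb ?_
      push Not at h1
      by_contra h2
      push Not at h2
      have hpos := mul_pos h1 h2
      nlinarith [mul_self_nonneg (e ⬝ᵥ Ψ *ᵥ e)]
  · -- choose the sign of b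
    obtain ⟨b', hi', hb', hb'e, hΨ, hsgn⟩ : ∃ b', Ind3 a b' e ∧ b' ⬝ᵥ Φ *ᵥ b' = 0 ∧ β b' e = 0 ∧
        b' ⬝ᵥ Ψ *ᵥ b' = b ⬝ᵥ Ψ *ᵥ b ∧ 0 ≤ - (β a b') / (e ⬝ᵥ Φ *ᵥ e) := by
      by_cases hsg : 0 ≤ - (β a b) / (e ⬝ᵥ Φ *ᵥ e)
      · exact ⟨b, he, hb, heb, rfl, hsg⟩
      · refine ⟨-b, ?_, ?_, ?_, ?_, ?_⟩
        · intro r s t e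
          have := he r (-s) t (by rw [← e]; simp)
          exact ⟨this.1, by linarith [this.2.1], this.2.2⟩
        · simpa [mulVec_neg] using hb
        · have : β (-b) e = - β b e := by simp [hβ, mulVec_neg]; ring
          rw [this, heb]; simp
        · simp [mulVec_neg]
        · have : β a (-b) = - β a b := by simp [hβ, mulVec_neg]; ring
          rw [this]
          push Not at hsg
          rw [neg_div] at hsg
          rw [neg_neg]; linarith
    rw [← hΨ] at hs
    set q := - (β a b') / (e ⬝ᵥ Φ *ᵥ e) with hq
    obtain ⟨t, ht, ez⟩ := ivt_path Ψ (fun t => ((1 - t) • a + t • b') + Real.sqrt (t * (1 - t) * q) • e)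
      (by fun_prop) (by simpa using hs)
    refine ⟨_, ?_, ?_, ez⟩
    · intro h0
      have := hi' _ _ _ h0
      linarith [this.1, this.2.1]
    · have hsq : Real.sqrt (t * (1 - t) * q) ^ 2 = t * (1 - t) * q :=
        Real.sq_sqrt (mul_nonneg (mul_nonneg ht.1 (by linarith [ht.2])) hsgn)
      have hqe : q * (e ⬝ᵥ Φ *ᵥ e) = - β a b' := by rw [hq]; field_simp
      have hx := qf_comb Φ ((1 - t) • a + t • b') e 1 (Real.sqrt (t * (1 - t) * q))
      rw [one_smul, qf_comb, ha, hb', hsq] at hx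
      rw [hx]
      have hmix : ((1 - t) • a + t • b') ⬝ᵥ Φ *ᵥ e + e ⬝ᵥ Φ *ᵥ ((1 - t) • a + t • b')
          = (1 - t) * β a e + t * β b' e := by
        simp only [hβ, mulVec_add, mulVec_smul, add_dotProduct, dotProduct_add, smul_dotProduct,
          dotProduct_smul, smul_eq_mul]
        ring
      rw [hmix, hea, hb'e]
      have : a ⬝ᵥ Φ *ᵥ b' + b' ⬝ᵥ Φ *ᵥ a = β a b' := rfl
      rw [this]
      linear_combination t * (1 - t) * hqe

lemma zero2 (Φ Ψ : Matrix (Fin 3) (Fin 3) ℝ) (h1 : Φ.trace = 0) (h2 : Ψ.trace = 0) :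
    ∃ x : Fin 3 → ℝ, x ≠ 0 ∧ x ⬝ᵥ Φ *ᵥ x = 0 ∧ x ⬝ᵥ Ψ *ᵥ x = 0 := by
  obtain ⟨a, b, c, hi, ha, hb, hc, hq⟩ := rot3 Φ h1
  by_cases hab : (a ⬝ᵥ Ψ *ᵥ a) * (b ⬝ᵥ Ψ *ᵥ b) ≤ 0
  · exact path_zero Φ Ψ a b c hi ha hb hab
  · refine path_zero Φ Ψ a c b hi.swap23 ha hc ?_
    have := hq Ψ
    rw [h2] at this
    push Not at hab
    have hcc : c ⬝ᵥ Ψ *ᵥ c = - (a ⬝ᵥ Ψ *ᵥ a) - b ⬝ᵥ Ψ *ᵥ b := by linarith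
    rw [hcc]
    nlinarith [mul_self_nonneg (a ⬝ᵥ Ψ *ᵥ a)]

end S7

set_option linter.all false

namespace S7

/-- the real quaternions -/
abbrev HQ := Quaternion ℝ

variable {ι : Type*} [Fintype ι]

lemma re_mul_comm (a b : HQ) : (a * b).re = (b * a).re := by
  simp only [Quaternion.re_mul]; ring

lemma re_star_mul_self (a : HQ) : (star a * a).re = Quaternion.normSq a := by
  rw [Quaternion.star_mul_self]; simp

lemma re_sum {κ : Type*} (s : Finset κ) (f : κ → HQ) : (∑ i ∈ s, f i).re = ∑ i ∈ s, (f i).re :=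
  map_sum (QuaternionAlgebra.reₗ (-1 : ℝ) 0 (-1)) f s

lemma coe_of_star {q : HQ} (h : star q = q) : q = (q.re : HQ) := by
  rw [Quaternion.star_eq_self] at h
  exact h

lemma star_dot_self_re (u : ι → HQ) : (star u ⬝ᵥ u).re = ∑ i, Quaternion.normSq (u i) := by
  simp only [dotProduct, re_sum, Pi.star_apply, re_star_mul_self]

lemma star_dot_self_zero {u : ι → HQ} (h : (star u ⬝ᵥ u).re = 0) : u = 0 := by
  rw [star_dot_self_re, Finset.sum_eq_zero_iff_of_nonneg (fun i _ => Quaternion.normSq_nonneg)] at h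
  funext i
  exact Quaternion.normSq_eq_zero.1 (h i (Finset.mem_univ i))

lemma star_dot (u v : ι → HQ) : star (star u ⬝ᵥ v) = star v ⬝ᵥ u := by
  simp only [dotProduct, star_sum, star_mul, Pi.star_apply, star_star]

lemma star_rsmul (r : ℝ) (u : ι → HQ) : star (r • u) = r • star u := by
  funext i
  simp [Quaternion.star_smul]

lemma herm_dot {M : Matrix ι ι HQ} (hM : M.IsHermitian) (u v : ι → HQ) :
    star (star u ⬝ᵥ M *ᵥ v) = star v ⬝ᵥ M *ᵥ u := by
  rw [star_dot, star_mulVec, hM.eq, dotProduct_mulVec]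

lemma psd_add {M : Matrix ι ι HQ} (hM : M.IsHermitian) (u v : ι → HQ) :
    (star (u + v) ⬝ᵥ M *ᵥ (u + v)).re =
      (star u ⬝ᵥ M *ᵥ u).re + 2 * (star v ⬝ᵥ M *ᵥ u).re + (star v ⬝ᵥ M *ᵥ v).re := by
  have h1 : (star u ⬝ᵥ M *ᵥ v).re = (star v ⬝ᵥ M *ᵥ u).re := by
    rw [← herm_dot hM, Quaternion.re_star]
  simp only [star_add, mulVec_add, add_dotProduct, dotProduct_add, Quaternion.re_add, h1]
  ring

lemma psd_zero {M : Matrix ι ι HQ} (hM : QuatPSD M) {u : ι → HQ}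
    (h : (star u ⬝ᵥ M *ᵥ u).re = 0) : M *ᵥ u = 0 := by
  set v := M *ᵥ u with hv
  set p := (star v ⬝ᵥ v).re with hp
  set q := (star v ⬝ᵥ M *ᵥ v).re with hq
  have key : ∀ t : ℝ, 0 ≤ 2 * t * p + t ^ 2 * q := by
    intro t
    have h1 := hM.2 (u + t • v)
    rw [psd_add hM.1, h] at h1
    have e1 : (star (t • v) ⬝ᵥ M *ᵥ u).re = t * p := by
      rw [star_rsmul, smul_dotProduct]; simp [hp, hv]
    have e2 : (star (t • v) ⬝ᵥ M *ᵥ (t • v)).re = t ^ 2 * q := by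
      rw [star_rsmul, smul_dotProduct, mulVec_smul, dotProduct_smul]; simp [hq]; ring
    rw [e1, e2] at h1
    linarith
  have hp0 : 0 ≤ p := by
    rw [hp, star_dot_self_re]; exact Finset.sum_nonneg fun i _ => Quaternion.normSq_nonneg
  have hq0 : 0 ≤ q := hM.2 v
  apply star_dot_self_zero
  by_contra hne
  have hpos : 0 < p := lt_of_le_of_ne hp0 (Ne.symm hne)
  have := key (-(p / (q + 1)))
  have hq1 : 0 < q + 1 := by linarith
  have e : 2 * (-(p / (q + 1))) * p + (-(p / (q + 1))) ^ 2 * q = - (p ^ 2 * (q + 2)) / (q + 1) ^ 2 := by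
    field_simp; ring
  rw [e] at this
  have : - (p ^ 2 * (q + 2)) / (q + 1) ^ 2 < 0 := by
    apply div_neg_of_neg_of_pos
    · have : 0 < p ^ 2 * (q + 2) := by positivity
      linarith
    · positivity
  linarith

/-- real-linear map of a quaternionic matrix -/
def rl (M : Matrix ι ι HQ) : (ι → HQ) →ₗ[ℝ] (ι → HQ) where
  toFun u := M *ᵥ u
  map_add' u v := mulVec_add M u v
  map_smul' r u := mulVec_smul M r u

lemma rl_apply (M : Matrix ι ι HQ) (u : ι → HQ) : rl M u = M *ᵥ u := rfl

/-- the real inner product -/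
noncomputable def ip : LinearMap.BilinForm ℝ (ι → HQ) :=
  LinearMap.mk₂ ℝ (fun u v => (star u ⬝ᵥ v).re)
    (fun u u' v => by simp [star_add, add_dotProduct])
    (fun c u v => by rw [star_rsmul, smul_dotProduct]; simp)
    (fun u v v' => by simp [dotProduct_add])
    (fun c u v => by rw [dotProduct_smul]; simp)

lemma ip_apply (u v : ι → HQ) : ip u v = (star u ⬝ᵥ v).re := rfl

lemma ip_symm (u v : ι → HQ) : ip u v = ip v u := by
  rw [ip_apply, ip_apply, ← star_dot, Quaternion.re_star]

lemma mem_range {M : Matrix ι ι HQ} (hM : M.IsHermitian) {z : ι → HQ}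
    (hk : ∀ u, M *ᵥ u = 0 → star z ⬝ᵥ u = 0) : ∃ t, M *ᵥ t = z := by
  have hrefl : (ip (ι := ι)).IsRefl := fun u v h => by rw [ip_symm]; exact h
  have hnd : (ip (ι := ι)).Nondegenerate := by
    refine (LinearMap.IsRefl.nondegenerate_iff_separatingLeft hrefl).2 ?_
    intro u hu
    exact star_dot_self_zero (hu u)
  have h := LinearMap.BilinForm.orthogonal_orthogonal hnd hrefl (LinearMap.range (rl M))
  have hz : z ∈ LinearMap.BilinForm.orthogonal (ip (ι := ι)) (LinearMap.BilinForm.orthogonal ip (LinearMap.range (rl M))) := by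
    rw [LinearMap.BilinForm.mem_orthogonal_iff]
    intro u hu
    rw [LinearMap.BilinForm.mem_orthogonal_iff] at hu
    have hMu : M *ᵥ u = 0 := by
      apply star_dot_self_zero
      have := hu (rl M (M *ᵥ u)) ⟨_, rfl⟩
      rw [ip_apply, rl_apply, star_mulVec, hM.eq, ← dotProduct_mulVec] at this
      exact this
    rw [ip_symm, ip_apply, hk u hMu]; rfl
  rw [h] at hz
  exact hz

lemma rank_one_mulVec (z u : ι → HQ) : vecMulVec z (star z) *ᵥ u = MulOpposite.op (star z ⬝ᵥ u) • z := by
  rw [vecMulVec_mulVec]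

lemma sub_rank_one_mulVec (M : Matrix ι ι HQ) (z u : ι → HQ) (ε : ℝ) :
    (M - ε • vecMulVec z (star z)) *ᵥ u = M *ᵥ u - ε • (MulOpposite.op (star z ⬝ᵥ u) • z) := by
  rw [sub_mulVec, smul_mulVec, rank_one_mulVec]

lemma peel {M : Matrix ι ι HQ} (hM : QuatPSD M) {z : ι → HQ} (hz : z ≠ 0)
    (hk : ∀ u, M *ᵥ u = 0 → star z ⬝ᵥ u = 0) :
    ∃ e0 : ℝ, 0 < e0 ∧ (∀ ε : ℝ, 0 ≤ ε → ε ≤ e0 → QuatPSD (M - ε • vecMulVec z (star z))) ∧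
      ∃ t, M *ᵥ t ≠ 0 ∧ (M - e0 • vecMulVec z (star z)) *ᵥ t = 0 := by
  obtain ⟨t, ht⟩ := mem_range hM.1 hk
  set s := (star t ⬝ᵥ M *ᵥ t).re with hs
  have hs' : star t ⬝ᵥ M *ᵥ t = (s : HQ) := coe_of_star (herm_dot hM.1 t t)
  have hs0 : 0 < s := by
    refine lt_of_le_of_ne (hM.2 t) fun h => hz ?_
    rw [← ht]; exact psd_zero hM h.symm
  refine ⟨s⁻¹, inv_pos.2 hs0, ?_, t, by rw [ht]; exact hz, ?_⟩
  · intro ε h0 hε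
    refine ⟨?_, ?_⟩
    · have h1 : (vecMulVec z (star z)).IsHermitian := by
        refine Matrix.ext fun i j => ?_
        simp [vecMulVec_apply, conjTranspose_apply]
      refine hM.1.sub ?_
      refine Matrix.ext fun i j => ?_
      have := congrFun (congrFun h1 i) j
      rw [conjTranspose_apply, Matrix.smul_apply, Quaternion.star_smul, Matrix.smul_apply, ← this, conjTranspose_apply]
    · intro u
      set c := star z ⬝ᵥ u with hc
      have hc2 : star u ⬝ᵥ z = star c := by rw [hc, star_dot]
      have e1 : (star u ⬝ᵥ (M - ε • vecMulVec z (star z)) *ᵥ u).re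
          = (star u ⬝ᵥ M *ᵥ u).re - ε * Quaternion.normSq c := by
        rw [sub_rank_one_mulVec, dotProduct_sub, dotProduct_smul, dotProduct_smul, hc2, ← hc]
        simp [Quaternion.star_mul_self]
      rw [e1]
      have h2 := hM.2 (u + MulOpposite.op (-(s⁻¹ • c)) • t)
      rw [psd_add hM.1] at h2
      have hz3 : star t ⬝ᵥ M *ᵥ u = c := by
        rw [← herm_dot hM.1, ht, hc2, star_star]
      have hst : star (MulOpposite.op (-(s⁻¹ • c)) • t) = (-(s⁻¹ • star c)) • star t := by
        funext i; simp
      rw [hst, mulVec_smul, smul_dotProduct, smul_dotProduct, dotProduct_smul, hz3, hs'] at h2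
      have e2 : (-(s⁻¹ • star c) • c).re = - s⁻¹ * Quaternion.normSq c := by
        rw [smul_eq_mul, neg_mul, smul_mul_assoc, Quaternion.star_mul_self]; simp
      have e3 : (-(s⁻¹ • star c) • MulOpposite.op (-(s⁻¹ • c)) • (s : HQ)).re = s⁻¹ * Quaternion.normSq c := by
        have : (-(s⁻¹ • star c) • MulOpposite.op (-(s⁻¹ • c)) • (s : HQ)) = (s⁻¹ * (s * s⁻¹)) • (star c * c) := by
          rw [op_smul_eq_mul, smul_eq_mul, Quaternion.coe_mul_eq_smul, smul_neg]
          simp only [neg_mul_neg, smul_mul_assoc, mul_smul_comm, smul_smul]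
          congr 1; ring
        rw [this, mul_inv_cancel₀ hs0.ne', Quaternion.star_mul_self]; simp
      rw [e2, e3] at h2
      have := mul_le_mul_of_nonneg_right hε (Quaternion.normSq_nonneg (a := c))
      linarith
  · have : star z ⬝ᵥ t = (s : HQ) := by rw [← star_dot, ← ht, hs']; simp
    rw [sub_rank_one_mulVec, this, ht]
    funext i
    simp only [Pi.sub_apply, Pi.smul_apply, op_smul_eq_mul, Quaternion.mul_coe_eq_smul,
      smul_smul, inv_mul_cancel₀ hs0.ne', one_smul, sub_self, Pi.zero_apply]

end S7

set_option linter.all false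

namespace S7

variable {n : ℕ}

/-- entrywise conjugate -/
def cj (C : Matrix (Fin n) (Fin n) HQ) : Matrix (Fin n) (Fin n) HQ := C.map star

/-- real matrix as quaternionic matrix -/
def rq (D : Matrix (Fin n) (Fin n) ℝ) : Matrix (Fin n) (Fin n) HQ := D.map fun r => (r : HQ)

/-- real vector dotted with a quaternionic vector -/
noncomputable def rd (x : Fin n → ℝ) (w : Fin n → HQ) : HQ := ∑ i, x i • w i

lemma cj_apply (C : Matrix (Fin n) (Fin n) HQ) (i j) : cj C i j = star (C i j) := rfl
lemma rq_apply (D : Matrix (Fin n) (Fin n) ℝ) (i j) : rq D i j = (D i j : HQ) := rfl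
lemma cj_cj (C : Matrix (Fin n) (Fin n) HQ) : cj (cj C) = C := by
  refine Matrix.ext fun i j => ?_
  simp [cj_apply]
lemma cj_symm {C : Matrix (Fin n) (Fin n) HQ} (h : C.IsSymm) : (cj C).IsSymm := by
  refine Matrix.ext fun i j => ?_
  rw [transpose_apply, cj_apply, cj_apply, h.apply]
lemma cj_herm {C : Matrix (Fin n) (Fin n) HQ} (h : C.IsSymm) : Cᴴ = cj C := by
  refine Matrix.ext fun i j => ?_
  rw [conjTranspose_apply, cj_apply, h.apply]

lemma rd_add (x : Fin n → ℝ) (u v : Fin n → HQ) : rd x (u + v) = rd x u + rd x v := by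
  simp [rd, Finset.sum_add_distrib]
lemma rd_sub (x : Fin n → ℝ) (u v : Fin n → HQ) : rd x (u - v) = rd x u - rd x v := by
  simp [rd, smul_sub]
lemma rd_smul (x : Fin n → ℝ) (r : ℝ) (u : Fin n → HQ) : rd x (r • u) = r • rd x u := by
  simp [rd, Finset.smul_sum, smul_comm r]
lemma rd_lmul (x : Fin n → ℝ) (h : HQ) (u : Fin n → HQ) : rd x (h • u) = h * rd x u := by
  simp [rd, Finset.mul_sum]
lemma rd_rmul (x : Fin n → ℝ) (h : HQ) (u : Fin n → HQ) : rd x (MulOpposite.op h • u) = rd x u * h := by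
  simp [rd, Finset.sum_mul]
lemma rd_zero (x : Fin n → ℝ) : rd x (0 : Fin n → HQ) = 0 := by
  simp [rd]

lemma rq_lmul (D : Matrix (Fin n) (Fin n) ℝ) (h : HQ) (u : Fin n → HQ) :
    rq D *ᵥ (h • u) = h • (rq D *ᵥ u) := by
  funext i
  simp only [mulVec, dotProduct, rq_apply, Pi.smul_apply, smul_eq_mul, Finset.mul_sum]
  refine Finset.sum_congr rfl fun j _ => ?_
  rw [← mul_assoc, ← mul_assoc, (Quaternion.coe_commutes (D i j) h)]

lemma adj {C : Matrix (Fin n) (Fin n) HQ} (hC : C.IsSymm) (u v : Fin n → HQ) :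
    star (C *ᵥ u) ⬝ᵥ v = star u ⬝ᵥ (cj C *ᵥ v) := by
  rw [star_mulVec, cj_herm hC, dotProduct_mulVec]

lemma rq_adj {D : Matrix (Fin n) (Fin n) ℝ} (hD : D.IsSymm) (u v : Fin n → HQ) :
    star (rq D *ᵥ u) ⬝ᵥ v = star u ⬝ᵥ (rq D *ᵥ v) := by
  have h : (rq D)ᴴ = rq D := by
    refine Matrix.ext fun i j => ?_
    rw [conjTranspose_apply, rq_apply, rq_apply, hD.apply]; simp
  rw [star_mulVec, h, dotProduct_mulVec]

/-- the space `U` -/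
def InU (C : Matrix (Fin n) (Fin n) HQ) (D : Matrix (Fin n) (Fin n) ℝ) (w : Fin n → HQ) : Prop :=
  cj C *ᵥ (C *ᵥ w) = rq D *ᵥ w

lemma InU.add {C : Matrix (Fin n) (Fin n) HQ} {D : Matrix (Fin n) (Fin n) ℝ} {u v}
    (hu : InU C D u) (hv : InU C D v) : InU C D (u + v) := by
  unfold InU at *
  simp only [mulVec_add, hu, hv]
lemma InU.sub {C : Matrix (Fin n) (Fin n) HQ} {D : Matrix (Fin n) (Fin n) ℝ} {u v}
    (hu : InU C D u) (hv : InU C D v) : InU C D (u - v) := by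
  unfold InU at *
  simp only [mulVec_sub, hu, hv]
lemma InU.rmul {C : Matrix (Fin n) (Fin n) HQ} {D : Matrix (Fin n) (Fin n) ℝ} {u}
    (hu : InU C D u) (q : HQ) : InU C D (MulOpposite.op q • u) := by
  unfold InU at *
  simp only [mulVec_smul, hu]
lemma InU.smul {C : Matrix (Fin n) (Fin n) HQ} {D : Matrix (Fin n) (Fin n) ℝ} {u}
    (hu : InU C D u) (q : ℝ) : InU C D (q • u) := by
  unfold InU at *
  simp only [mulVec_smul, hu]
lemma InU.zero {C : Matrix (Fin n) (Fin n) HQ} {D : Matrix (Fin n) (Fin n) ℝ} : InU C D 0 := by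
  simp [InU]

/-- hypotheses of the normalized problem -/
structure Core (C : Matrix (Fin n) (Fin n) HQ) (D : Matrix (Fin n) (Fin n) ℝ) : Prop where
  hC : C.IsSymm
  hD : D.IsSymm
  hp : QuatPSD (rq D - cj C * C)
  hm : QuatPSD (rq D - C * cj C)

lemma Core.swap {C : Matrix (Fin n) (Fin n) HQ} {D : Matrix (Fin n) (Fin n) ℝ} (h : Core C D) :
    Core (cj C) D := ⟨cj_symm h.hC, h.hD, by rw [cj_cj]; exact h.hm, by rw [cj_cj]; exact h.hp⟩

/-- conclusion of the normalized problem -/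
def Concl (C : Matrix (Fin n) (Fin n) HQ) (D : Matrix (Fin n) (Fin n) ℝ) : Prop :=
  ∃ (x : Fin n → ℝ) (a : ℝ) (g : HQ), x ≠ 0 ∧ (a ≠ 0 ∨ g ≠ 0) ∧
    (∀ w, InU C D w → g * rd x w = a • rd x (C *ᵥ w)) ∧
    (∀ w, InU (cj C) D w → star g * rd x w = a • rd x (cj C *ᵥ w))

lemma Concl.swap {C : Matrix (Fin n) (Fin n) HQ} {D : Matrix (Fin n) (Fin n) ℝ} (h : Concl (cj C) D) :
    Concl C D := by
  obtain ⟨x, a, g, hx, hag, h1, h2⟩ := h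
  refine ⟨x, a, star g, hx, ?_, ?_, ?_⟩
  · simpa using hag
  · rw [cj_cj] at h2; exact h2
  · rw [star_star]; exact h1

/-- the real symmetric matrix attached to `(a,d,h)` -/
noncomputable def Sm (C : Matrix (Fin n) (Fin n) HQ) (D : Matrix (Fin n) (Fin n) ℝ) (a d : ℝ) (h : HQ) :
    Matrix (Fin n) (Fin n) ℝ :=
  Matrix.of fun i j => a * D i j + (if i = j then d else 0) - 2 * (h * star (C i j)).re

lemma Sm_swap (C : Matrix (Fin n) (Fin n) HQ) (D : Matrix (Fin n) (Fin n) ℝ) (a d : ℝ) (h : HQ) :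
    Sm (cj C) D a d (star h) = Sm C D a d h := by
  refine Matrix.ext fun i j => ?_
  simp only [Sm, of_apply, cj_apply, star_star]
  congr 2
  simp only [Quaternion.re_mul, Quaternion.re_star, Quaternion.imI_star, Quaternion.imJ_star, Quaternion.imK_star]
  ring

lemma two_re (q : HQ) : ((2 * q.re : ℝ) : HQ) = q + star q := by
  ext <;> simp; ring

lemma Sm_one (C : Matrix (Fin n) (Fin n) HQ) (D : Matrix (Fin n) (Fin n) ℝ) (a d : ℝ) (h : HQ)
    (u : Fin n → HQ) : rq (Sm C D a d h) *ᵥ u =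
      a • (rq D *ᵥ u) + d • u - h • (cj C *ᵥ u) - C *ᵥ (star h • u) := by
  funext i
  simp only [mulVec, dotProduct, rq_apply, cj_apply, Pi.smul_apply, Pi.add_apply, Pi.sub_apply, smul_eq_mul, Finset.mul_sum, Finset.smul_sum]
  have hd : d • u i = ∑ j, (if i = j then d else 0) • u j := by
    simp
  rw [hd, ← Finset.sum_add_distrib, ← Finset.sum_sub_distrib, ← Finset.sum_sub_distrib]
  refine Finset.sum_congr rfl fun j _ => ?_
  have h1 : ((Sm C D a d h i j : ℝ) : HQ) = (a : HQ) * (D i j : HQ) + ((if i = j then d else 0 : ℝ) : HQ)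
      - (h * star (C i j) + C i j * star h) := by
    have := two_re (h * star (C i j))
    rw [star_mul, star_star] at this
    rw [← this]
    simp [Sm]
  rw [h1]
  simp only [← Quaternion.coe_mul_eq_smul]
  noncomm_ring

lemma Sm_two (C : Matrix (Fin n) (Fin n) HQ) (D : Matrix (Fin n) (Fin n) ℝ) (a d : ℝ) (h : HQ)
    (u : Fin n → HQ) : rq (Sm C D a d h) *ᵥ u =
      a • (rq D *ᵥ u) + d • u - star h • (C *ᵥ u) - cj C *ᵥ (h • u) := by
  have := Sm_one (cj C) D a d (star h) u
  rw [Sm_swap, cj_cj, star_star] at this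
  exact this

lemma rq_zero : rq (0 : Matrix (Fin n) (Fin n) ℝ) = 0 := by
  refine Matrix.ext fun i j => ?_
  simp [rq_apply]

/-- `F` vanishes on the range of `Sm` -/
lemma F_range {C : Matrix (Fin n) (Fin n) HQ} {D : Matrix (Fin n) (Fin n) ℝ} (hC : C.IsSymm) (hD : D.IsSymm)
    (a d : ℝ) (h : HQ) {w w' : Fin n → HQ} (hw : InU C D w) (hw' : InU (cj C) D w') :
    star w ⬝ᵥ (rq (Sm C D a d h) *ᵥ (cj C *ᵥ w')) = star (C *ᵥ w) ⬝ᵥ (rq (Sm C D a d h) *ᵥ w') := by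
  unfold InU at hw hw'
  rw [cj_cj] at hw'
  rw [Sm_two, Sm_one, hw']
  have e1 : star w ⬝ᵥ (rq D *ᵥ (cj C *ᵥ w')) = star (C *ᵥ w) ⬝ᵥ (rq D *ᵥ w') := by
    rw [← rq_adj hD, ← hw, ← hw', adj hC, ← cj_herm hC, star_mulVec, conjTranspose_conjTranspose, ← dotProduct_mulVec, adj hC, cj_herm hC]
  have e2 : star w ⬝ᵥ (cj C *ᵥ w') = star (C *ᵥ w) ⬝ᵥ w' := (adj hC _ _).symm
  have e3 : star w ⬝ᵥ (cj C *ᵥ (h • (cj C *ᵥ w'))) = star (C *ᵥ w) ⬝ᵥ (h • (cj C *ᵥ w')) := (adj hC _ _).symm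
  have e4 : star w ⬝ᵥ (star h • (rq D *ᵥ w')) = star (C *ᵥ w) ⬝ᵥ (C *ᵥ (star h • w')) := by
    have := adj (cj_symm hC) (C *ᵥ w) (star h • w')
    rw [cj_cj] at this
    rw [← this, hw, rq_adj hD, rq_lmul]
  simp only [dotProduct_sub, dotProduct_add, dotProduct_smul, e1, e2, e3, e4]
  abel

end S7

set_option linter.all false

namespace S7

variable {n : ℕ} {C : Matrix (Fin n) (Fin n) HQ} {D : Matrix (Fin n) (Fin n) ℝ}

/-- linear relation -/
def Rel (C : Matrix (Fin n) (Fin n) HQ) (D : Matrix (Fin n) (Fin n) ℝ) (a d : ℝ) (h : HQ) : Prop :=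
  Sm C D a d h = 0

lemma mv_rs (M : Matrix (Fin n) (Fin n) HQ) (r : ℝ) (u : Fin n → HQ) : M *ᵥ (r • u) = r • (M *ᵥ u) :=
  mulVec_smul M r u

lemma dot_rs (r : ℝ) (u v : Fin n → HQ) : u ⬝ᵥ (r • v) = r • (u ⬝ᵥ v) := dotProduct_smul r u v

/-- the map sigma -/
noncomputable def sg (C : Matrix (Fin n) (Fin n) HQ) (a : ℝ) (h : HQ) (w : Fin n → HQ) : Fin n → HQ :=
  h • w - a • (C *ᵥ w)

lemma Rel.swap {a d : ℝ} {h : HQ} (hr : Rel C D a d h) : Rel (cj C) D a d (star h) := by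
  unfold Rel at *
  rw [Sm_swap, hr]

lemma Rel.one {a d : ℝ} {h : HQ} (hr : Rel C D a d h) (u : Fin n → HQ) :
    a • (rq D *ᵥ u) + d • u = h • (cj C *ᵥ u) + C *ᵥ (star h • u) := by
  have := Sm_one C D a d h u
  rw [hr, rq_zero, zero_mulVec] at this
  rw [← sub_eq_zero, this]; abel

lemma Rel.two {a d : ℝ} {h : HQ} (hr : Rel C D a d h) (u : Fin n → HQ) :
    a • (rq D *ᵥ u) + d • u = star h • (C *ᵥ u) + cj C *ᵥ (h • u) := by
  have := hr.swap.one u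
  rwa [cj_cj, star_star] at this

lemma sg_add (a : ℝ) (h : HQ) (u v : Fin n → HQ) : sg C a h (u + v) = sg C a h u + sg C a h v := by
  simp only [sg, mulVec_add, smul_add]; abel

lemma sg_rmul (a : ℝ) (h : HQ) (u : Fin n → HQ) (q : HQ) :
    sg C a h (MulOpposite.op q • u) = MulOpposite.op q • sg C a h u := by
  simp only [sg, mulVec_smul, smul_sub, smul_comm (MulOpposite.op q)]

lemma sg_smul (a : ℝ) (h : HQ) (u : Fin n → HQ) (q : ℝ) :
    sg C a h (q • u) = q • sg C a h u := by
  simp only [sg, mulVec_smul, smul_sub, smul_comm q]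

lemma cj_sg {a d : ℝ} {h : HQ} (hr : Rel C D a d h) {w : Fin n → HQ} (hw : InU C D w) :
    cj C *ᵥ sg C a h w = d • w - star h • (C *ᵥ w) := by
  have := hr.two w
  rw [sg, mulVec_sub, mv_rs, hw]
  rw [← sub_eq_zero] at this ⊢
  rw [← neg_eq_zero, ← this]; abel

lemma sg_mem {a d : ℝ} {h : HQ} (hr : Rel C D a d h) {w : Fin n → HQ} (hw : InU C D w) :
    InU (cj C) D (sg C a h w) := by
  unfold InU
  rw [cj_cj, cj_sg hr hw]
  have := hr.one (C *ᵥ w)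
  have hw' : cj C *ᵥ (C *ᵥ w) = rq D *ᵥ w := hw
  rw [hw'] at this
  rw [sg, mulVec_sub, mulVec_sub, mv_rs, mv_rs, rq_lmul]
  rw [← sub_eq_zero] at this ⊢
  rw [← this]; abel

lemma smul_star_mul (h : HQ) : star h * h = ((Quaternion.normSq h : ℝ) : HQ) := Quaternion.star_mul_self h

lemma coe_smul' (r : ℝ) (w : Fin n → HQ) : (r : HQ) • w = r • w := by
  funext i
  simp [Quaternion.coe_mul_eq_smul]

lemma sg_sg {a d : ℝ} {h : HQ} (hr : Rel C D a d h) {w : Fin n → HQ} (hw : InU C D w) :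
    sg (cj C) a (star h) (sg C a h w) = (Quaternion.normSq h - a * d) • w := by
  rw [sg, cj_sg hr hw, sg, smul_sub, smul_sub, smul_smul, smul_star_mul, coe_smul', sub_smul, mul_smul,
    smul_comm (star h) a]
  abel

/-- a degenerate relation forces `G₊ = 0` -/
lemma delta_zero (hc : Core C D) (hn : 0 < n) {a d : ℝ} {h : HQ} (hr : Rel C D a d h)
    (h0 : Quaternion.normSq h - a * d = 0) (hne : ¬ (a = 0 ∧ d = 0 ∧ h = 0)) (u : Fin n → HQ) :
    InU C D u := by
  have ha : a ≠ 0 := by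
    rintro rfl
    have hh : h = 0 := by
      rw [zero_mul, sub_zero] at h0
      exact Quaternion.normSq_eq_zero.1 h0
    subst hh
    have := congrFun (congrFun hr ⟨0, hn⟩) ⟨0, hn⟩
    simp [Sm] at this
    have h00 : (0 : HQ).re = 0 := rfl
    rw [h00] at this
    exact hne ⟨rfl, by linarith, rfl⟩
  set y := a • (C *ᵥ u) - h • u with hy
  have e1 : star y ⬝ᵥ y = star u ⬝ᵥ (a ^ 2 • (cj C *ᵥ (C *ᵥ u)) - a ^ 2 • (rq D *ᵥ u)) := by
    have h1 : ∀ v, star y ⬝ᵥ v = star u ⬝ᵥ (a • (cj C *ᵥ v) - star h • v) := by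
      intro v
      have hs : star (h • u) ⬝ᵥ v = star u ⬝ᵥ (star h • v) := by
        simp only [dotProduct, Pi.star_apply, Pi.smul_apply, smul_eq_mul, star_mul, mul_assoc]
      rw [hy, star_sub, sub_dotProduct, star_rsmul, smul_dotProduct, adj hc.hC, hs, dotProduct_sub,
        dot_rs]
    rw [h1]
    congr 1
    rw [hy, mulVec_sub, mv_rs, smul_sub, smul_sub, smul_smul (star h), smul_star_mul, coe_smul']
    have h2 := hr.two u
    have h3 : cj C *ᵥ (h • u) = a • (rq D *ᵥ u) + d • u - star h • (C *ᵥ u) := by rw [h2]; abel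
    have h4 : Quaternion.normSq h = a * d := by linarith
    rw [h3, h4, smul_comm (star h) a]
    simp only [smul_sub, smul_add, smul_smul, pow_two]
    abel
  have e2 : (star u ⬝ᵥ ((rq D - cj C * C) *ᵥ u)).re = 0 := by
    have p1 := hc.hp.2 u
    have p2 : 0 ≤ (star y ⬝ᵥ y).re := by
      rw [star_dot_self_re]; exact Finset.sum_nonneg fun i _ => Quaternion.normSq_nonneg
    rw [e1, ← smul_sub, dot_rs, Quaternion.re_smul] at p2
    rw [sub_mulVec, ← mulVec_mulVec, dotProduct_sub, Quaternion.re_sub] at *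
    rw [smul_eq_mul] at p2
    have : 0 < a ^ 2 := by positivity
    have := nonneg_of_mul_nonneg_right p2 this
    linarith
  have := psd_zero hc.hp e2
  rw [sub_mulVec, ← mulVec_mulVec, sub_eq_zero] at this
  exact this.symm

/-- the form `F` -/
noncomputable def Fx (C : Matrix (Fin n) (Fin n) HQ) (x : Fin n → ℝ) (w w' : Fin n → HQ) : HQ :=
  star (rd x w) * rd x (cj C *ᵥ w') - star (rd x (C *ᵥ w)) * rd x w'

lemma Fx_add_left (x : Fin n → ℝ) (u v w' : Fin n → HQ) : Fx C x (u + v) w' = Fx C x u w' + Fx C x v w' := by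
  simp only [Fx, mulVec_add, rd_add, star_add]; noncomm_ring
lemma Fx_add_right (x : Fin n → ℝ) (u v w' : Fin n → HQ) : Fx C x w' (u + v) = Fx C x w' u + Fx C x w' v := by
  simp only [Fx, mulVec_add, rd_add, star_add]; noncomm_ring
lemma Fx_rmul_left (x : Fin n → ℝ) (u w' : Fin n → HQ) (q : HQ) :
    Fx C x (MulOpposite.op q • u) w' = star q * Fx C x u w' := by
  simp only [Fx, mulVec_smul, rd_rmul, star_mul]; noncomm_ring
lemma Fx_rmul_right (x : Fin n → ℝ) (u w' : Fin n → HQ) (q : HQ) :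
    Fx C x u (MulOpposite.op q • w') = Fx C x u w' * q := by
  simp only [Fx, mulVec_smul, rd_rmul, star_mul]; noncomm_ring
lemma Fx_smul_right (x : Fin n → ℝ) (u w' : Fin n → HQ) (q : ℝ) :
    Fx C x u (q • w') = q • Fx C x u w' := by
  simp only [Fx, mulVec_smul, rd_smul, smul_sub, mul_smul_comm]

lemma Fx_sub_right (x : Fin n → ℝ) (u v w' : Fin n → HQ) : Fx C x w' (u - v) = Fx C x w' u - Fx C x w' v := by
  simp only [Fx, mulVec_sub, rd_sub]; noncomm_ring

lemma Fx_swap (x : Fin n → ℝ) (w w' : Fin n → HQ) : Fx (cj C) x w' w = - star (Fx C x w w') := by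
  simp only [Fx, cj_cj, star_sub, star_mul, star_star]; noncomm_ring

lemma Fx_sg {a d : ℝ} {h : HQ} (hr : Rel C D a d h) (x : Fin n → ℝ) (w : Fin n → HQ) {v : Fin n → HQ}
    (hv : InU C D v) : Fx C x w (sg C a h v) =
      d • (star (rd x w) * rd x v) - star (rd x w) * star h * rd x (C *ᵥ v)
        - star (rd x (C *ᵥ w)) * h * rd x v + a • (star (rd x (C *ᵥ w)) * rd x (C *ᵥ v)) := by
  rw [Fx, cj_sg hr hv, sg]
  simp only [rd_sub, rd_smul, rd_lmul, mul_sub, mul_smul_comm]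
  noncomm_ring

lemma Fx_herm {a d : ℝ} {h : HQ} (hr : Rel C D a d h) (x : Fin n → ℝ) {w v : Fin n → HQ}
    (hw : InU C D w) (hv : InU C D v) :
    star (Fx C x w (sg C a h v)) = Fx C x v (sg C a h w) := by
  rw [Fx_sg hr x w hv, Fx_sg hr x v hw]
  simp only [star_add, star_sub, star_mul, star_star, Quaternion.star_smul]
  noncomm_ring

lemma Fx_self {a d : ℝ} {h : HQ} (hr : Rel C D a d h) (x : Fin n → ℝ) {w : Fin n → HQ}
    (hw : InU C D w) (h0 : (Fx C x w (sg C a h w)).re = 0) : Fx C x w (sg C a h w) = 0 := by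
  have := coe_of_star (Fx_herm hr x hw hw)
  rw [this, h0]; rfl

lemma rd_mul_rd (x : Fin n → ℝ) (u v : Fin n → HQ) :
    (star (rd x u) * rd x v).re = x ⬝ᵥ (Matrix.of fun i j => (star (u i) * v j).re) *ᵥ x := by
  have h1 : star (rd x u) = ∑ i, x i • star (u i) := by
    rw [rd, star_sum]; simp [Quaternion.star_smul]
  rw [h1, rd, Finset.sum_mul, re_sum]
  simp only [dotProduct, mulVec, of_apply, Finset.mul_sum, re_sum, smul_mul_smul_comm]
  refine Finset.sum_congr rfl fun i _ => Finset.sum_congr rfl fun j _ => ?_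
  rw [Quaternion.re_smul, smul_eq_mul]; ring

lemma Fx_trace (hC : C.IsSymm) (w w' : Fin n → HQ) : ∃ Φ : Matrix (Fin n) (Fin n) ℝ, Φ.trace = 0 ∧
    ∀ x, (Fx C x w w').re = x ⬝ᵥ Φ *ᵥ x := by
  refine ⟨(Matrix.of fun i j => (star (w i) * (cj C *ᵥ w') j).re) -
    (Matrix.of fun i j => (star ((C *ᵥ w) i) * w' j).re), ?_, ?_⟩
  · have := congrArg (fun q : HQ => q.re) (adj hC w w')
    simp only [dotProduct, re_sum, Pi.star_apply] at this
    rw [trace_sub]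
    simp only [trace, diag_apply, of_apply]
    rw [this, sub_self]
  · intro x
    rw [sub_mulVec, dotProduct_sub, ← rd_mul_rd, ← rd_mul_rd, ← Quaternion.re_sub]; rfl

/-- all of `F` vanishes, one value `x·w₀ ≠ 0` -/
lemma solve_i {x : Fin n → ℝ} (hx : x ≠ 0)
    (hF : ∀ w w', InU C D w → InU (cj C) D w' → Fx C x w w' = 0) {w0 : Fin n → HQ}
    (hw0 : InU C D w0) (h0 : rd x w0 ≠ 0)
    (hU : (∃ w', InU (cj C) D w' ∧ rd x w' ≠ 0) ∨
      (∃ a d h, Rel C D a d h ∧ Quaternion.normSq h - a * d ≠ 0)) : Concl C D := by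
  have hd : ∀ w', InU (cj C) D w' →
      star (rd x (C *ᵥ w0) * (rd x w0)⁻¹) * rd x w' = rd x (cj C *ᵥ w') := by
    intro w' hw'
    have := hF w0 w' hw0 hw'
    rw [Fx, sub_eq_zero] at this
    have hs : star (rd x w0) ≠ 0 := by simpa using h0
    rw [star_mul, star_inv₀, mul_assoc, ← this, inv_mul_cancel_left₀ hs]
  have hd1 : ∀ w', InU (cj C) D w' →
      star (rd x (C *ᵥ w0) * (rd x w0)⁻¹) * rd x w' = (1 : ℝ) • rd x (cj C *ᵥ w') := by
    intro w' hw'; rw [one_smul, hd w' hw']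
  refine ⟨x, 1, rd x (C *ᵥ w0) * (rd x w0)⁻¹, hx, Or.inl one_ne_zero, ?_, hd1⟩
  by_cases hex : ∃ w', InU (cj C) D w' ∧ rd x w' ≠ 0
  · obtain ⟨w', hw', hne⟩ := hex
    intro w hw
    have h1 := hF w w' hw hw'
    rw [Fx, sub_eq_zero, ← hd w' hw', ← mul_assoc, ← star_mul] at h1
    have h2 := mul_right_cancel₀ hne h1
    rw [one_smul]
    exact star_injective h2
  · obtain ⟨a, d, h, hr, hΔ⟩ := hU.resolve_left hex
    push Not at hex
    have hk : ∀ w, InU C D w → h * rd x w = a • rd x (C *ᵥ w) := by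
      intro w hw
      have := hex _ (sg_mem hr hw)
      rw [sg, rd_sub, rd_lmul, rd_smul, sub_eq_zero] at this
      exact this
    have ha : a ≠ 0 := by
      rintro rfl
      have := hk w0 hw0
      rw [zero_smul, mul_eq_zero] at this
      have := this.resolve_right h0
      subst this
      simp at hΔ
    have hk' : ∀ w, InU C D w → rd x (C *ᵥ w) = a⁻¹ • (h * rd x w) := by
      intro w hw
      rw [hk w hw, smul_smul, inv_mul_cancel₀ ha, one_smul]
    intro w hw
    rw [one_smul, hk' w hw, hk' w0 hw0, smul_mul_assoc, smul_mul_assoc, mul_inv_cancel_right₀ h0]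

lemma solve {x : Fin n → ℝ} (hx : x ≠ 0)
    (hF : ∀ w w', InU C D w → InU (cj C) D w' → Fx C x w w' = 0) {a d : ℝ} {h : HQ}
    (hr : Rel C D a d h) (hΔ : Quaternion.normSq h - a * d ≠ 0) : Concl C D := by
  by_cases h1 : ∃ w0, InU C D w0 ∧ rd x w0 ≠ 0
  · obtain ⟨w0, hw0, h0⟩ := h1
    exact solve_i hx hF hw0 h0 (Or.inr ⟨a, d, h, hr, hΔ⟩)
  by_cases h2 : ∃ w0, InU (cj C) D w0 ∧ rd x w0 ≠ 0
  · obtain ⟨w0, hw0, h0⟩ := h2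
    apply Concl.swap
    refine solve_i hx ?_ hw0 h0 (Or.inr ⟨a, d, star h, hr.swap, by simpa using hΔ⟩)
    intro w w' hw hw'
    rw [cj_cj] at hw'
    rw [Fx_swap, hF w' w hw' hw]; simp
  push Not at h1 h2
  refine ⟨x, 0, 1, hx, Or.inr one_ne_zero, ?_, ?_⟩
  · intro w hw; rw [h1 w hw]; simp
  · intro w hw; rw [h2 w hw]; simp

/-- every element of `U'` is in the image of sigma -/
lemma sg_surj {a d : ℝ} {h : HQ} (hr : Rel C D a d h) (hΔ : Quaternion.normSq h - a * d ≠ 0)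
    {w' : Fin n → HQ} (hw' : InU (cj C) D w') : ∃ w, InU C D w ∧ sg C a h w = w' := by
  have h1 := sg_mem hr.swap hw'
  have h2 := sg_sg hr.swap hw'
  rw [cj_cj] at h1 h2
  rw [star_star, Quaternion.normSq_star] at h2
  refine ⟨(Quaternion.normSq h - a * d)⁻¹ • sg (cj C) a (star h) w', h1.smul _, ?_⟩
  rw [sg_smul, h2, smul_smul, inv_mul_cancel₀ hΔ, one_smul]

lemma case_one (hc : Core C D) (hn : 0 < n) {a d : ℝ} {h : HQ} (hr : Rel C D a d h)
    (hΔ : Quaternion.normSq h - a * d ≠ 0) {w0 : Fin n → HQ} (hw0 : InU C D w0)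
    (hsp : ∀ w, InU C D w → ∃ q : HQ, w = MulOpposite.op q • w0) : Concl C D := by
  obtain ⟨Φ, htr, hΦ⟩ := Fx_trace hc.hC w0 (sg C a h w0)
  obtain ⟨x, hx, hz⟩ := zero1 hn Φ htr
  rw [← hΦ] at hz
  have hz' := Fx_self hr x hw0 hz
  refine solve hx ?_ hr hΔ
  intro w w' hw hw'
  obtain ⟨v, hv, rfl⟩ := sg_surj hr hΔ hw'
  obtain ⟨q, rfl⟩ := hsp w hw
  obtain ⟨p, rfl⟩ := hsp v hv
  rw [sg_rmul, Fx_rmul_left, Fx_rmul_right, hz']; simp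

end S7

set_option linter.all false

namespace S7

/-- right independence of two vectors -/
def Ind2 {n : ℕ} (w0 w1 : Fin n → HQ) : Prop :=
  ∀ p q : HQ, MulOpposite.op p • w0 + MulOpposite.op q • w1 = 0 → p = 0 ∧ q = 0

/-- `op` as a linear equivalence -/
def opE (n : ℕ) : (Fin n → HQ) ≃ₗ[HQᵐᵒᵖ] (Fin n → HQᵐᵒᵖ) where
  toFun u i := MulOpposite.op (u i)
  invFun u i := (u i).unop
  map_add' u v := by funext i; simp
  map_smul' c u := by funext i; simp
  left_inv u := by funext i; simp
  right_inv u := by funext i; simp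

lemma finrank_op (n : ℕ) : Module.finrank HQᵐᵒᵖ (Fin n → HQ) = n := by
  rw [(opE n).finrank_eq]; simp

instance (n : ℕ) : Module.Finite HQᵐᵒᵖ (Fin n → HQ) := Module.Finite.equiv (opE n).symm

lemma span2 {w0 w1 : Fin 2 → HQ} (h : Ind2 w0 w1) (u : Fin 2 → HQ) :
    ∃ p q : HQ, u = MulOpposite.op p • w0 + MulOpposite.op q • w1 := by
  have hli : LinearIndependent HQᵐᵒᵖ ![w0, w1] := by
    rw [LinearIndependent.pair_iff]
    intro s t e
    obtain ⟨h1, h2⟩ := h s.unop t.unop (by simpa using e)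
    exact ⟨MulOpposite.unop_injective h1, MulOpposite.unop_injective h2⟩
  have htop := hli.span_eq_top_of_card_eq_finrank (by rw [finrank_op]; simp)
  have hu : u ∈ Submodule.span HQᵐᵒᵖ (Set.range ![w0, w1]) := by rw [htop]; trivial
  rw [Submodule.mem_span_range_iff_exists_fun] at hu
  obtain ⟨c, hc⟩ := hu
  refine ⟨(c 0).unop, (c 1).unop, ?_⟩
  rw [← hc]
  simp [Fin.sum_univ_two]

lemma span3 {w0 w1 w2 : Fin 3 → HQ} (h : Ind2 w0 w1)
    (h2 : ∀ p q : HQ, w2 ≠ MulOpposite.op p • w0 + MulOpposite.op q • w1) (u : Fin 3 → HQ) :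
    ∃ p q r : HQ, u = MulOpposite.op p • w0 + MulOpposite.op q • w1 + MulOpposite.op r • w2 := by
  have hli : LinearIndependent HQᵐᵒᵖ ![w0, w1] := by
    rw [LinearIndependent.pair_iff]
    intro s t e
    obtain ⟨h1, h2⟩ := h s.unop t.unop (by simpa using e)
    exact ⟨MulOpposite.unop_injective h1, MulOpposite.unop_injective h2⟩
  have hli3 : LinearIndependent HQᵐᵒᵖ (Fin.cons w2 ![w0, w1] : Fin 3 → (Fin 3 → HQ)) := by
    rw [linearIndependent_finCons]
    refine ⟨hli, fun hm => ?_⟩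
    rw [Submodule.mem_span_range_iff_exists_fun] at hm
    obtain ⟨c, hc⟩ := hm
    apply h2 (c 0).unop (c 1).unop
    rw [← hc]
    simp [Fin.sum_univ_two]
  have htop := hli3.span_eq_top_of_card_eq_finrank (by rw [finrank_op]; simp)
  have hu : u ∈ Submodule.span HQᵐᵒᵖ (Set.range (Fin.cons w2 ![w0, w1] : Fin 3 → (Fin 3 → HQ))) := by
    rw [htop]; trivial
  rw [Submodule.mem_span_range_iff_exists_fun] at hu
  obtain ⟨c, hc⟩ := hu
  refine ⟨(c 1).unop, (c 2).unop, (c 0).unop, ?_⟩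
  rw [← hc]
  simp [Fin.sum_univ_three]
  abel

lemma dim3 {C : Matrix (Fin 3) (Fin 3) HQ} {D : Matrix (Fin 3) (Fin 3) ℝ} (hG : ∃ u, ¬ InU C D u)
    {w0 w1 : Fin 3 → HQ} (h0 : InU C D w0) (h1 : InU C D w1) (h : Ind2 w0 w1) {w : Fin 3 → HQ}
    (hw : InU C D w) : ∃ p q : HQ, w = MulOpposite.op p • w0 + MulOpposite.op q • w1 := by
  by_contra hcon
  push Not at hcon
  obtain ⟨u, hu⟩ := hG
  obtain ⟨p, q, r, rfl⟩ := span3 h hcon u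
  exact hu (((h0.rmul p).add (h1.rmul q)).add (hw.rmul r))

variable {n : ℕ} {C : Matrix (Fin n) (Fin n) HQ} {D : Matrix (Fin n) (Fin n) ℝ}

lemma Rel.comb {a d a' d' : ℝ} {h h' : HQ} (hr : Rel C D a d h) (hr' : Rel C D a' d' h') (r s : ℝ) :
    Rel C D (r * a + s * a') (r * d + s * d') (r • h + s • h') := by
  refine Matrix.ext fun i j => ?_
  have e1 := congrFun (congrFun hr i) j
  have e2 := congrFun (congrFun hr' i) j
  simp only [Sm, of_apply, Matrix.zero_apply] at e1 e2 ⊢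
  have e3 : ((r • h + s • h') * star (C i j)).re = r * (h * star (C i j)).re + s * (h' * star (C i j)).re := by
    rw [add_mul, Quaternion.re_add, smul_mul_assoc, smul_mul_assoc, Quaternion.re_smul, Quaternion.re_smul]
    simp
  rw [e3]
  by_cases hij : i = j
  · simp only [hij, if_true] at *
    linear_combination r * e1 + s * e2
  · simp only [hij, if_false] at *
    linear_combination r * e1 + s * e2

lemma sg_polar {a d a' d' : ℝ} {h h' : HQ} (hr : Rel C D a d h) (hr' : Rel C D a' d' h')
    {w : Fin n → HQ} (hw : InU (cj C) D w) :
    sg C a' h' (sg (cj C) a (star h) w) + sg C a h (sg (cj C) a' (star h') w) =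
      (2 * (h' * star h).re - a' * d - a * d') • w := by
  have e1 := cj_sg hr.swap hw
  have e2 := cj_sg hr'.swap hw
  rw [cj_cj, star_star] at e1 e2
  rw [sg, e1, sg.eq_1 C a h, e2, sg, sg]
  have hre : (2 * (h' * star h).re) • w = h' • star h • w + h • star h' • w := by
    rw [← coe_smul', two_re, star_mul, star_star, add_smul, mul_smul, mul_smul]
  rw [sub_smul, sub_smul, hre]
  simp only [smul_sub, mul_smul, smul_comm h' a, smul_comm h a']
  abel

lemma quat_center {c : HQ} (hc : ∀ q : HQ, c * q = q * c) : ∃ r : ℝ, c = (r : HQ) := by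
  obtain ⟨qi, a0, a1, a2, a3⟩ : ∃ q : HQ, q.re = 0 ∧ q.imI = 1 ∧ q.imJ = 0 ∧ q.imK = 0 :=
    ⟨⟨0, 1, 0, 0⟩, rfl, rfl, rfl, rfl⟩
  obtain ⟨qj, b0, b1, b2, b3⟩ : ∃ q : HQ, q.re = 0 ∧ q.imI = 0 ∧ q.imJ = 1 ∧ q.imK = 0 :=
    ⟨⟨0, 0, 1, 0⟩, rfl, rfl, rfl, rfl⟩
  have hi := hc qi
  have hj := hc qj
  rw [Quaternion.ext_iff] at hi hj
  obtain ⟨-, -, i1, i2⟩ := hi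
  obtain ⟨-, -, -, i3⟩ := hj
  rw [Quaternion.imJ_mul, Quaternion.imJ_mul] at i1
  rw [Quaternion.imK_mul, Quaternion.imK_mul] at i2 i3
  simp only [a0, a1, a2, a3, b0, b1, b2, b3, mul_zero, zero_mul, mul_one, one_mul] at i1 i2 i3
  refine ⟨c.re, ?_⟩
  ext
  · simp
  · simp; linarith
  · simp; linarith
  · simp; linarith

/-- a right-linear map such that each vector is an eigenvector is a real scalar -/
lemma real_scalar {e1 e2 : Fin n → HQ} (hi : Ind2 e1 e2) (τ : (Fin n → HQ) → (Fin n → HQ))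
    (hadd : ∀ u v, τ (u + v) = τ u + τ v) (hmul : ∀ u (q : HQ), τ (MulOpposite.op q • u) = MulOpposite.op q • τ u)
    (hev : ∀ p q : HQ, ∃ c : HQ, τ (MulOpposite.op p • e1 + MulOpposite.op q • e2) =
      MulOpposite.op c • (MulOpposite.op p • e1 + MulOpposite.op q • e2)) :
    ∃ r : ℝ, τ e1 = r • e1 := by
  obtain ⟨a, ha⟩ := hev 1 0
  obtain ⟨b, hb⟩ := hev 0 1
  simp only [MulOpposite.op_one, MulOpposite.op_zero, one_smul, zero_smul, add_zero, zero_add] at ha hb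
  have key : ∀ q : HQ, b * q = q * a := by
    intro q
    obtain ⟨c, hc⟩ := hev 1 q
    rw [MulOpposite.op_one, one_smul, hadd, hmul, ha, hb] at hc
    obtain ⟨h1, h2⟩ := hi (a - c) (b * q - q * c) (by
      rw [MulOpposite.op_sub, MulOpposite.op_sub, sub_smul, sub_smul, MulOpposite.op_mul, MulOpposite.op_mul,
        mul_smul, mul_smul]
      rw [smul_add, ← sub_eq_zero] at hc
      rw [← hc]; abel)
    rw [sub_eq_zero] at h1 h2
    rw [h2, h1]
  have hab : b = a := by have := key 1; simpa using this
  subst hab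
  obtain ⟨r, hr⟩ := quat_center key
  refine ⟨r, ?_⟩
  rw [ha, hr]
  funext i
  simp [Quaternion.mul_coe_eq_smul]

lemma case_tau {C : Matrix (Fin 3) (Fin 3) HQ} {D : Matrix (Fin 3) (Fin 3) ℝ} (hc : Core C D)
    (hG : ∃ u, ¬ InU C D u) {e1 e2 : Fin 3 → HQ} (he1 : InU C D e1) (he2 : InU C D e2) (hi : Ind2 e1 e2)
    {a d a' d' : ℝ} {h h' : HQ} (hr : Rel C D a d h) (hr' : Rel C D a' d' h')
    (hind : ∀ r s : ℝ, r * a + s * a' = 0 → r * d + s * d' = 0 → r • h + s • h' = 0 → r = 0 ∧ s = 0) :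
    Concl C D := by
  have hΔ : ∀ {b k : ℝ} {g : HQ}, Rel C D b k g → ¬ (b = 0 ∧ k = 0 ∧ g = 0) →
      Quaternion.normSq g - b * k ≠ 0 := by
    intro b k g hrel hne h0
    obtain ⟨u, hu⟩ := hG
    exact hu (delta_zero hc (by norm_num) hrel h0 hne u)
  have hΔ1 : Quaternion.normSq h - a * d ≠ 0 := by
    refine hΔ hr ?_
    rintro ⟨rfl, rfl, rfl⟩
    have := hind 1 0 (by simp) (by simp) (by simp)
    exact one_ne_zero this.1
  set Δ := Quaternion.normSq h - a * d with hΔdef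
  set τ : (Fin 3 → HQ) → (Fin 3 → HQ) := fun w => sg (cj C) a (star h) (sg C a' h' w) with hτ
  have hτmem : ∀ {w}, InU C D w → InU C D (τ w) := by
    intro w hw
    have := sg_mem hr.swap (sg_mem hr' hw)
    rwa [cj_cj] at this
  have hστ : ∀ {w}, InU C D w → sg C a h (τ w) = Δ • sg C a' h' w := by
    intro w hw
    have := sg_sg hr.swap (sg_mem hr' hw)
    rw [cj_cj, star_star, Quaternion.normSq_star] at this
    exact this
  obtain ⟨w0, hw0, hi0⟩ : ∃ w0, InU C D w0 ∧ Ind2 w0 (τ w0) := by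
    by_contra hcon
    push Not at hcon
    obtain ⟨r, hrr⟩ := real_scalar hi τ (fun u v => by simp only [hτ, sg_add])
      (fun u q => by simp only [hτ, sg_rmul]) (by
        intro p q
        set w := MulOpposite.op p • e1 + MulOpposite.op q • e2 with hw
        have hwU : InU C D w := (he1.rmul p).add (he2.rmul q)
        have := hcon w hwU
        unfold Ind2 at this
        push Not at this
        obtain ⟨s, t, hst, hne⟩ := this
        by_cases ht : t = 0
        · subst ht
          have hs : s ≠ 0 := fun hs => hne hs rfl
          rw [MulOpposite.op_zero, zero_smul, add_zero] at hst
          have hw0 : w = 0 := by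
            have h2 := congrArg (fun v => MulOpposite.op s⁻¹ • v) hst
            simp only [smul_zero, smul_smul, ← MulOpposite.op_mul, mul_inv_cancel₀ hs, MulOpposite.op_one, one_smul] at h2
            exact h2
          refine ⟨0, ?_⟩
          rw [hw0]
          simp [hτ, sg]
        · refine ⟨-(s * t⁻¹), ?_⟩
          have h2 := congrArg (fun v => MulOpposite.op t⁻¹ • v) hst
          simp only [smul_add, smul_zero, smul_smul, ← MulOpposite.op_mul, mul_inv_cancel₀ ht, MulOpposite.op_one, one_smul] at h2
          rw [MulOpposite.op_neg, neg_smul, eq_neg_iff_add_eq_zero, add_comm]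
          exact h2)
    have h3 := hστ he1
    rw [hrr, sg_smul] at h3
    have hr'' := hr.comb hr' (-r) Δ
    have hz : sg C (-r * a + Δ * a') ((-r) • h + Δ • h') e1 = 0 := by
      have : sg C (-r * a + Δ * a') ((-r) • h + Δ • h') e1 = Δ • sg C a' h' e1 - r • sg C a h e1 := by
        simp only [sg, add_smul, smul_sub, mul_smul, neg_smul, smul_assoc]
        abel
      rw [this, h3, sub_self]
    have h4 := sg_sg hr'' he1
    rw [hz] at h4
    have he1ne : e1 ≠ 0 := by
      rintro rfl
      have := hi 1 0 (by simp)
      exact one_ne_zero this.1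
    have h5 : Quaternion.normSq ((-r) • h + Δ • h') - (-r * a + Δ * a') * (-r * d + Δ * d') = 0 := by
      have : sg (cj C) (-r * a + Δ * a') (star ((-r) • h + Δ • h')) (0 : Fin 3 → HQ) = 0 := by simp [sg]
      rw [this] at h4
      exact (smul_eq_zero.1 h4.symm).resolve_right he1ne
    refine hΔ hr'' ?_ h5
    rintro ⟨z1, z2, z3⟩
    exact hΔ1 (hind _ _ z1 z2 z3).2
  obtain ⟨Φ, htr, hΦ⟩ := Fx_trace hc.hC w0 (sg C a h w0)
  obtain ⟨Ψ, htr', hΨ⟩ := Fx_trace hc.hC w0 (sg C a' h' w0)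
  obtain ⟨x, hx, hz1, hz2⟩ := zero2 Φ Ψ htr htr'
  rw [← hΦ] at hz1
  rw [← hΨ] at hz2
  have k00 := Fx_self hr x hw0 hz1
  have k00' := Fx_self hr' x hw0 hz2
  have k01 : Fx C x w0 (sg C a h (τ w0)) = 0 := by
    rw [hστ hw0, Fx_smul_right, k00', smul_zero]
  have k10 : Fx C x (τ w0) (sg C a h w0) = 0 := by
    rw [← Fx_herm hr x hw0 (hτmem hw0), k01, star_zero]
  have k11 : Fx C x (τ w0) (sg C a h (τ w0)) = 0 := by
    rw [hστ hw0, Fx_smul_right, ← Fx_herm hr' x hw0 (hτmem hw0)]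
    have hp := sg_polar hr hr' (sg_mem hr' hw0)
    have hq := sg_sg hr' hw0
    rw [hq, ← eq_sub_iff_add_eq] at hp
    have : Fx C x w0 (sg C a' h' (τ w0)) = 0 := by
      show Fx C x w0 (sg C a' h' (sg (cj C) a (star h) (sg C a' h' w0))) = 0
      rw [hp, Fx_sub_right, Fx_smul_right, k00', sg_smul, Fx_smul_right, k00]; simp
    rw [this]; simp
  refine solve hx ?_ hr hΔ1
  intro w w' hw hw'
  obtain ⟨v, hv, rfl⟩ := sg_surj hr hΔ1 hw'
  obtain ⟨p, q, rfl⟩ := dim3 hG hw0 (hτmem hw0) hi0 hw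
  obtain ⟨s, t, rfl⟩ := dim3 hG hw0 (hτmem hw0) hi0 hv
  simp only [sg_add, sg_rmul, Fx_add_left, Fx_add_right, Fx_rmul_left, Fx_rmul_right, k00, k01, k10, k11]
  simp

end S7

set_option linter.all false

namespace S7

lemma F_of_rank_one {n : ℕ} {C : Matrix (Fin n) (Fin n) HQ} {D : Matrix (Fin n) (Fin n) ℝ} (hC : C.IsSymm) (hD : D.IsSymm)
    {a d : ℝ} {h : HQ} {x : Fin n → ℝ} (hS : Sm C D a d h = vecMulVec x x) {w w' : Fin n → HQ}
    (hw : InU C D w) (hw' : InU (cj C) D w') : Fx C x w w' = 0 := by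
  have key : ∀ u v : Fin n → HQ, star u ⬝ᵥ (rq (vecMulVec x x) *ᵥ v) = star (rd x u) * rd x v := by
    intro u v
    have h1 : rq (vecMulVec x x) *ᵥ v = fun i => x i • rd x v := by
      funext i
      simp only [mulVec, dotProduct, rq_apply, vecMulVec_apply, rd, Finset.smul_sum, smul_smul,
        Quaternion.coe_mul_eq_smul]
    have h2 : star (rd x u) = ∑ i, x i • star (u i) := by rw [rd, star_sum]; simp [Quaternion.star_smul]
    rw [h1, h2, Finset.sum_mul]
    simp only [dotProduct, Pi.star_apply, mul_smul_comm, smul_mul_assoc]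
  have := F_range hC hD a d h hw hw'
  rw [hS, key, key, ← sub_eq_zero] at this
  exact this

/-- `Sm` as a linear map -/
noncomputable def SmL {n : ℕ} (C : Matrix (Fin n) (Fin n) HQ) (D : Matrix (Fin n) (Fin n) ℝ) :
    (ℝ × ℝ × HQ) →ₗ[ℝ] Matrix (Fin n) (Fin n) ℝ where
  toFun p := Sm C D p.1 p.2.1 p.2.2
  map_add' p q := by
    refine Matrix.ext fun i j => ?_
    simp only [Sm, of_apply, Matrix.add_apply, Prod.fst_add, Prod.snd_add, add_mul, Quaternion.re_add]
    split_ifs <;> ring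
  map_smul' r p := by
    refine Matrix.ext fun i j => ?_
    simp only [Sm, of_apply, Matrix.smul_apply, Prod.smul_fst, Prod.smul_snd, smul_mul_assoc, Quaternion.re_smul,
      RingHom.id_apply, smul_eq_mul]
    split_ifs <;> ring

lemma finrank_dom : Module.finrank ℝ (ℝ × ℝ × HQ) = 6 := by
  rw [Module.finrank_prod, Module.finrank_prod, Quaternion.finrank_eq_four, Module.finrank_self]

/-- coordinates of a symmetric matrix -/
def cor : Matrix (Fin 3) (Fin 3) ℝ →ₗ[ℝ] (Fin 6 → ℝ) where
  toFun S := ![S 0 0, S 1 1, S 2 2, S 0 1, S 0 2, S 1 2]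
  map_add' S T := by funext i; fin_cases i <;> simp
  map_smul' r S := by funext i; fin_cases i <;> simp

lemma cor_inj {S T : Matrix (Fin 3) (Fin 3) ℝ} (hS : S.IsSymm) (hT : T.IsSymm) (h : cor S = cor T) : S = T := by
  have h0 : S 0 0 = T 0 0 := congrFun h 0
  have h1 : S 1 1 = T 1 1 := congrFun h 1
  have h2 : S 2 2 = T 2 2 := congrFun h 2
  have h3 : S 0 1 = T 0 1 := congrFun h 3
  have h4 : S 0 2 = T 0 2 := congrFun h 4
  have h5 : S 1 2 = T 1 2 := congrFun h 5
  refine Matrix.ext fun i j => ?_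
  fin_cases i <;> fin_cases j <;> simp <;> first | assumption | skip
  · rw [← hS.apply, ← hT.apply]; exact h3
  · rw [← hS.apply, ← hT.apply]; exact h4
  · rw [← hS.apply, ← hT.apply]; exact h5

lemma Sm_symm {n : ℕ} {C : Matrix (Fin n) (Fin n) HQ} {D : Matrix (Fin n) (Fin n) ℝ} (hC : C.IsSymm) (hD : D.IsSymm)
    (a d : ℝ) (h : HQ) : (Sm C D a d h).IsSymm := by
  refine Matrix.ext fun i j => ?_
  simp only [transpose_apply, Sm, of_apply, hC.apply, hD.apply, eq_comm (a := i)]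

lemma vv_symm {n : ℕ} (x : Fin n → ℝ) : (vecMulVec x x).IsSymm := by
  refine Matrix.ext fun i j => ?_
  simp only [transpose_apply, vecMulVec_apply, mul_comm]

lemma ker_rel {C : Matrix (Fin 3) (Fin 3) HQ} {D : Matrix (Fin 3) (Fin 3) ℝ} (hC : C.IsSymm) (hD : D.IsSymm)
    {p : ℝ × ℝ × HQ} (hp : p ∈ LinearMap.ker (cor ∘ₗ SmL C D)) : Rel C D p.1 p.2.1 p.2.2 := by
  have hp' : cor (Sm C D p.1 p.2.1 p.2.2) = 0 := hp
  refine cor_inj (Sm_symm hC hD _ _ _) ?_ ?_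
  · exact Matrix.isSymm_zero
  · rw [hp', map_zero]

/-- no relations: every rank one is attained -/
lemma T_all {C : Matrix (Fin 3) (Fin 3) HQ} {D : Matrix (Fin 3) (Fin 3) ℝ} (hC : C.IsSymm) (hD : D.IsSymm)
    (hk : ∀ a d h, Rel C D a d h → a = 0 ∧ d = 0 ∧ h = 0) (x : Fin 3 → ℝ) :
    ∃ a d h, Sm C D a d h = vecMulVec x x := by
  have hker : LinearMap.ker (cor ∘ₗ SmL C D) = ⊥ := by
    rw [Submodule.eq_bot_iff]
    intro p hp
    obtain ⟨h1, h2, h3⟩ := hk _ _ _ (ker_rel hC hD hp)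
    exact Prod.ext h1 (Prod.ext h2 h3)
  have hsurj : Function.Surjective (cor ∘ₗ SmL C D) :=
    (LinearMap.injective_iff_surjective_of_finrank_eq_finrank (by rw [finrank_dom]; simp)).1
      (LinearMap.ker_eq_bot.1 hker)
  obtain ⟨p, hp⟩ := hsurj (cor (vecMulVec x x))
  exact ⟨p.1, p.2.1, p.2.2, cor_inj (Sm_symm hC hD _ _ _) (vv_symm x) hp⟩

/-- at most one relation: some rank one is attained -/
lemma T_one {C : Matrix (Fin 3) (Fin 3) HQ} {D : Matrix (Fin 3) (Fin 3) ℝ} (hC : C.IsSymm) (hD : D.IsSymm)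
    {a d : ℝ} {h : HQ}
    (hk : ∀ a' d' h', Rel C D a' d' h' → ∃ r : ℝ, a' = r * a ∧ d' = r * d ∧ h' = r • h) :
    ∃ x : Fin 3 → ℝ, x ≠ 0 ∧ ∃ a d h, Sm C D a d h = vecMulVec x x := by
  set L := cor ∘ₗ SmL C D with hL
  have hker : Module.finrank ℝ (LinearMap.ker L) ≤ 1 := by
    have hle : LinearMap.ker L ≤ Submodule.span ℝ {((a, d, h) : ℝ × ℝ × HQ)} := by
      intro p hp
      obtain ⟨r, h1, h2, h3⟩ := hk _ _ _ (ker_rel hC hD hp)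
      rw [Submodule.mem_span_singleton]
      exact ⟨r, Prod.ext h1.symm (Prod.ext h2.symm h3.symm)⟩
    exact (Submodule.finrank_mono hle).trans ((finrank_span_le_card _).trans (by simp))
  have hrn := LinearMap.finrank_range_add_finrank_ker L
  rw [finrank_dom] at hrn
  obtain ⟨φ, hφ⟩ : ∃ φ : (Fin 6 → ℝ) →ₗ[ℝ] ℝ, LinearMap.ker φ = LinearMap.range L := by
    by_cases htop : LinearMap.range L = ⊤
    · exact ⟨0, by rw [htop, LinearMap.ker_zero]⟩
    · obtain ⟨φ, hne, hle⟩ := Submodule.exists_le_ker_of_lt_top _ (lt_top_iff_ne_top.2 htop)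
      refine ⟨φ, (Submodule.eq_of_le_of_finrank_le hle ?_).symm⟩
      have h1 := LinearMap.finrank_range_add_finrank_ker φ
      have h2 : 0 < Module.finrank ℝ (LinearMap.range φ) := by
        rw [Module.finrank_pos_iff, Submodule.nontrivial_iff_ne_bot]
        rw [Ne, LinearMap.range_eq_bot]
        exact hne
      have h3 : Module.finrank ℝ (Fin 6 → ℝ) = 6 := by simp
      omega
  set c : Fin 6 → ℝ := fun i => φ (Pi.single i 1) with hc
  have hφc : ∀ y : Fin 6 → ℝ, φ y = ∑ i, y i * c i := by
    intro y
    have : y = ∑ i, y i • (Pi.single i 1 : Fin 6 → ℝ) := by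
      funext j; simp [Finset.sum_apply, Pi.single_apply]
    conv_lhs => rw [this]
    rw [map_sum]
    simp [hc]
  obtain ⟨x, hx, hz⟩ := zero1 (by norm_num) (!![c 0, c 3, c 4; 0, c 1, c 5; 0, 0, c 2]) (by
    have h1 : L (0, 1, 0) ∈ LinearMap.ker φ := by rw [hφ]; exact ⟨_, rfl⟩
    rw [LinearMap.mem_ker, hφc] at h1
    have e : L (0, 1, 0) = ![1, 1, 1, 0, 0, 0] := by
      show cor (Sm C D 0 1 0) = _
      have hz : (0 : HQ).re = 0 := rfl
      funext i
      fin_cases i <;> simp [cor, Sm, hz]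
    rw [e] at h1
    simp [Fin.sum_univ_succ] at h1
    simp [Matrix.trace_fin_three]
    linarith)
  have hm : cor (vecMulVec x x) ∈ LinearMap.range L := by
    rw [← hφ, LinearMap.mem_ker, hφc, ← hz]
    simp [Fin.sum_univ_succ, cor, vecMulVec_apply, dotProduct, mulVec]
    ring
  obtain ⟨p, hp⟩ := hm
  exact ⟨x, hx, p.1, p.2.1, p.2.2, cor_inj (Sm_symm hC hD _ _ _) (vv_symm x) hp⟩

end S7

set_option linter.all false

namespace S7

lemma joint_eig {n : ℕ} (hn : 0 < n) (X : Fin 4 → Matrix (Fin n) (Fin n) ℝ) (hs : ∀ i, (X i).IsSymm)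
    (hcomm : ∀ i j, X i * X j = X j * X i) :
    ∃ (x : Fin n → ℝ) (γ : Fin 4 → ℝ), x ≠ 0 ∧ ∀ i, X i *ᵥ x = γ i • x := by
  have h := LinearMap.IsSymmetric.iSup_iInf_eq_top_of_commute (𝕜 := ℝ) (E := EuclideanSpace ℝ (Fin n))
    (T := fun i => Matrix.toEuclideanLin (X i))
    (fun i => Matrix.isSymmetric_toEuclideanLin_iff.2 (by
      rw [Matrix.IsHermitian, conjTranspose_eq_transpose_of_trivial]; exact hs i))
    (fun i j _ => by
      show Matrix.toEuclideanLin (X i) ∘ₗ Matrix.toEuclideanLin (X j) = Matrix.toEuclideanLin (X j) ∘ₗ Matrix.toEuclideanLin (X i)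
      refine LinearMap.ext fun v => ?_
      simp only [LinearMap.comp_apply, Matrix.toLpLin_apply, Matrix.mulVec_mulVec, hcomm])
  have : ∃ γ : Fin 4 → ℝ, (⨅ i, Module.End.eigenspace (Matrix.toEuclideanLin (X i)) (γ i)) ≠ ⊥ := by
    by_contra hcon
    push Not at hcon
    simp only [hcon, iSup_bot] at h
    have h2 : (WithLp.toLp 2 (fun _ => (1:ℝ)) : EuclideanSpace ℝ (Fin n)) ∈ (⊥ : Submodule ℝ (EuclideanSpace ℝ (Fin n))) := by
      rw [h]; trivial
    rw [Submodule.mem_bot] at h2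
    have := congrArg (fun v : EuclideanSpace ℝ (Fin n) => v ⟨0, hn⟩) h2
    simp at this
  obtain ⟨γ, hγ⟩ := this
  obtain ⟨v, hv, hv0⟩ := Submodule.exists_mem_ne_zero_of_ne_bot hγ
  rw [Submodule.mem_iInf] at hv
  refine ⟨v.ofLp, γ, ?_, fun i => ?_⟩
  · intro h0; apply hv0; ext i; exact congrFun h0 i
  · have := hv i
    rw [Module.End.mem_eigenspace_iff, Matrix.toLpLin_apply] at this
    exact congrArg WithLp.ofLp this

lemma mulVec_all_zero {n : ℕ} {M : Matrix (Fin n) (Fin n) HQ} (h : ∀ i, M *ᵥ (Pi.single i 1) = 0) : M = 0 := by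
  refine Matrix.ext fun i j => ?_
  have := congrFun (h j) i
  simpa using this

lemma form_single {n : ℕ} (M : Matrix (Fin n) (Fin n) HQ) (i : Fin n) :
    star (Pi.single i (1:HQ) : Fin n → HQ) ⬝ᵥ M *ᵥ (Pi.single i 1) = M i i := by
  rw [← Pi.single_star, star_one, single_dotProduct]
  simp

lemma re_CC {n : ℕ} {C : Matrix (Fin n) (Fin n) HQ} (hC : C.IsSymm) (i j : Fin n) :
    ((cj C * C) i j).re = ((C * cj C) i j).re := by
  simp only [Matrix.mul_apply, re_sum, cj_apply]
  refine Finset.sum_congr rfl fun k _ => ?_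
  simp only [Quaternion.re_mul, Quaternion.re_star, Quaternion.imI_star, Quaternion.imJ_star, Quaternion.imK_star]
  ring

lemma all_swap {n : ℕ} {C : Matrix (Fin n) (Fin n) HQ} {D : Matrix (Fin n) (Fin n) ℝ} (hc : Core C D)
    (h : ∀ u, InU C D u) : cj C * C = rq D ∧ C * cj C = rq D := by
  have h1 : rq D - cj C * C = 0 := by
    apply mulVec_all_zero
    intro i
    have := h (Pi.single i 1)
    unfold InU at this
    rw [sub_mulVec, ← mulVec_mulVec, this, sub_self]
  have h2 : rq D - C * cj C = 0 := by
    apply mulVec_all_zero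
    intro i
    refine psd_zero hc.hm ?_
    rw [form_single]
    have := congrArg (fun M : Matrix (Fin n) (Fin n) HQ => (M i i).re) h1
    simp only [Matrix.sub_apply, Quaternion.re_sub, re_CC hc.hC, Matrix.zero_apply] at this
    exact this
  exact ⟨(sub_eq_zero.1 h1).symm, (sub_eq_zero.1 h2).symm⟩

lemma imI_sum {κ : Type*} (s : Finset κ) (f : κ → HQ) : (∑ i ∈ s, f i).imI = ∑ i ∈ s, (f i).imI :=
  map_sum (QuaternionAlgebra.imIₗ (-1 : ℝ) 0 (-1)) f s
lemma imJ_sum {κ : Type*} (s : Finset κ) (f : κ → HQ) : (∑ i ∈ s, f i).imJ = ∑ i ∈ s, (f i).imJ :=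
  map_sum (QuaternionAlgebra.imJₗ (-1 : ℝ) 0 (-1)) f s
lemma imK_sum {κ : Type*} (s : Finset κ) (f : κ → HQ) : (∑ i ∈ s, f i).imK = ∑ i ∈ s, (f i).imK :=
  map_sum (QuaternionAlgebra.imKₗ (-1 : ℝ) 0 (-1)) f s

lemma case_all {n : ℕ} (hn : 0 < n) {C : Matrix (Fin n) (Fin n) HQ} {D : Matrix (Fin n) (Fin n) ℝ} (hc : Core C D)
    (h : ∀ u, InU C D u) : Concl C D := by
  obtain ⟨h1, h2⟩ := all_swap hc h
  set X0 : Matrix (Fin n) (Fin n) ℝ := C.map fun q => q.re with hX0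
  set X1 : Matrix (Fin n) (Fin n) ℝ := C.map fun q => q.imI with hX1
  set X2 : Matrix (Fin n) (Fin n) ℝ := C.map fun q => q.imJ with hX2
  set X3 : Matrix (Fin n) (Fin n) ℝ := C.map fun q => q.imK with hX3
  have hI1 : ∀ i j, ((cj C * C) i j).imI = 0 := fun i j => by rw [h1]; rfl
  have hJ1 : ∀ i j, ((cj C * C) i j).imJ = 0 := fun i j => by rw [h1]; rfl
  have hK1 : ∀ i j, ((cj C * C) i j).imK = 0 := fun i j => by rw [h1]; rfl
  have hI2 : ∀ i j, ((C * cj C) i j).imI = 0 := fun i j => by rw [h2]; rfl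
  have hJ2 : ∀ i j, ((C * cj C) i j).imJ = 0 := fun i j => by rw [h2]; rfl
  have hK2 : ∀ i j, ((C * cj C) i j).imK = 0 := fun i j => by rw [h2]; rfl
  simp only [Matrix.mul_apply, imI_sum, imJ_sum, imK_sum, cj_apply, Quaternion.imI_mul, Quaternion.imJ_mul, Quaternion.imK_mul,
    Quaternion.re_star, Quaternion.imI_star, Quaternion.imJ_star, Quaternion.imK_star, Finset.sum_add_distrib,
    Finset.sum_sub_distrib, neg_mul, mul_neg, Finset.sum_neg_distrib] at hI1 hI2 hJ1 hJ2 hK1 hK2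
  have c01 : X0 * X1 = X1 * X0 := by
    refine Matrix.ext fun i j => ?_
    simp only [Matrix.mul_apply, hX0, hX1, Matrix.map_apply]
    linarith [hI1 i j, hI2 i j]
  have c02 : X0 * X2 = X2 * X0 := by
    refine Matrix.ext fun i j => ?_
    simp only [Matrix.mul_apply, hX0, hX2, Matrix.map_apply]
    linarith [hJ1 i j, hJ2 i j]
  have c03 : X0 * X3 = X3 * X0 := by
    refine Matrix.ext fun i j => ?_
    simp only [Matrix.mul_apply, hX0, hX3, Matrix.map_apply]
    linarith [hK1 i j, hK2 i j]
  have c12 : X1 * X2 = X2 * X1 := by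
    refine Matrix.ext fun i j => ?_
    simp only [Matrix.mul_apply, hX1, hX2, Matrix.map_apply]
    linarith [hK1 i j, hK2 i j]
  have c13 : X1 * X3 = X3 * X1 := by
    refine Matrix.ext fun i j => ?_
    simp only [Matrix.mul_apply, hX1, hX3, Matrix.map_apply]
    linarith [hJ1 i j, hJ2 i j]
  have c23 : X2 * X3 = X3 * X2 := by
    refine Matrix.ext fun i j => ?_
    simp only [Matrix.mul_apply, hX2, hX3, Matrix.map_apply]
    linarith [hI1 i j, hI2 i j]
  obtain ⟨x, γ, hx, he⟩ := joint_eig hn ![X0, X1, X2, X3] (by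
    intro i
    fin_cases i <;> refine Matrix.ext fun i j => ?_ <;>
      simp [hX0, hX1, hX2, hX3, hc.hC.apply]) (by
    intro i j
    fin_cases i <;> fin_cases j <;> simp [c01, c02, c03, c12, c13, c23])
  have e0 : ∀ j, ∑ i, (C j i).re * x i = γ 0 * x j := fun j => congrFun (he 0) j
  have e1 : ∀ j, ∑ i, (C j i).imI * x i = γ 1 * x j := fun j => congrFun (he 1) j
  have e2 : ∀ j, ∑ i, (C j i).imJ * x i = γ 2 * x j := fun j => congrFun (he 2) j
  have e3 : ∀ j, ∑ i, (C j i).imK * x i = γ 3 * x j := fun j => congrFun (he 3) j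
  obtain ⟨g, g0, g1, g2, g3⟩ : ∃ g : HQ, g.re = γ 0 ∧ g.imI = γ 1 ∧ g.imJ = γ 2 ∧ g.imK = γ 3 :=
    ⟨⟨γ 0, γ 1, γ 2, γ 3⟩, rfl, rfl, rfl, rfl⟩
  have hg : ∀ j, ∑ i, x i • C i j = x j • g := by
    intro j
    apply QuaternionAlgebra.ext
    · rw [re_sum, Quaternion.re_smul, g0, smul_eq_mul, mul_comm (x j), ← e0]
      refine Finset.sum_congr rfl fun i _ => ?_
      rw [Quaternion.re_smul, smul_eq_mul, mul_comm, hc.hC.apply]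
    · rw [imI_sum, Quaternion.imI_smul, g1, smul_eq_mul, mul_comm (x j), ← e1]
      refine Finset.sum_congr rfl fun i _ => ?_
      rw [Quaternion.imI_smul, smul_eq_mul, mul_comm, hc.hC.apply]
    · rw [imJ_sum, Quaternion.imJ_smul, g2, smul_eq_mul, mul_comm (x j), ← e2]
      refine Finset.sum_congr rfl fun i _ => ?_
      rw [Quaternion.imJ_smul, smul_eq_mul, mul_comm, hc.hC.apply]
    · rw [imK_sum, Quaternion.imK_smul, g3, smul_eq_mul, mul_comm (x j), ← e3]
      refine Finset.sum_congr rfl fun i _ => ?_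
      rw [Quaternion.imK_smul, smul_eq_mul, mul_comm, hc.hC.apply]
  have hg' : ∀ j, ∑ i, x i • cj C i j = x j • star g := by
    intro j
    have := congrArg star (hg j)
    rw [star_sum] at this
    simpa only [Quaternion.star_smul, cj_apply] using this
  have key : ∀ (M : Matrix (Fin n) (Fin n) HQ) (q : HQ), (∀ j, ∑ i, x i • M i j = x j • q) → ∀ w, q * rd x w = (1:ℝ) • rd x (M *ᵥ w) := by
    intro M q hq w
    simp only [one_smul, rd, mulVec, dotProduct, Finset.smul_sum, Finset.mul_sum]
    rw [Finset.sum_comm]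
    refine Finset.sum_congr rfl fun j _ => ?_
    simp only [← smul_mul_assoc]
    rw [← Finset.sum_mul, hq, mul_smul_comm, smul_mul_assoc]
  exact ⟨x, 1, g, hx, Or.inl one_ne_zero, fun w _ => key _ _ hg w, fun w _ => key _ _ hg' w⟩

lemma dich {n : ℕ} (C : Matrix (Fin n) (Fin n) HQ) (D : Matrix (Fin n) (Fin n) ℝ) :
    (∃ w0, InU C D w0 ∧ ∀ w, InU C D w → ∃ q : HQ, w = MulOpposite.op q • w0) ∨
    ∃ e1 e2, InU C D e1 ∧ InU C D e2 ∧ Ind2 e1 e2 := by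
  by_cases h0 : ∀ w, InU C D w → w = 0
  · left; exact ⟨0, InU.zero, fun w hw => ⟨0, by rw [h0 w hw, smul_zero]⟩⟩
  push Not at h0
  obtain ⟨w0, hw0, hne⟩ := h0
  by_cases h1 : ∀ w, InU C D w → ∃ q : HQ, w = MulOpposite.op q • w0
  · left; exact ⟨w0, hw0, h1⟩
  push Not at h1
  obtain ⟨w1, hw1, hn1⟩ := h1
  right
  refine ⟨w0, w1, hw0, hw1, ?_⟩
  intro p q hpq
  have hq : q = 0 := by
    by_contra hq
    apply hn1 (-(p * q⁻¹))
    funext i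
    have := congrFun hpq i
    simp only [Pi.add_apply, Pi.smul_apply, op_smul_eq_mul, Pi.zero_apply] at this ⊢
    have h3 : w1 i * q = -(w0 i * p) := by rw [eq_neg_iff_add_eq_zero, add_comm]; exact this
    calc w1 i = w1 i * q * q⁻¹ := by rw [mul_assoc, mul_inv_cancel₀ hq, mul_one]
      _ = _ := by rw [h3]; noncomm_ring
  refine ⟨?_, hq⟩
  obtain ⟨i, hi⟩ := Function.ne_iff.1 hne
  have := congrFun hpq i
  simp only [hq, Pi.add_apply, Pi.smul_apply, op_smul_eq_mul, Pi.zero_apply, mul_zero, add_zero] at this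
  exact (mul_eq_zero.1 this).resolve_left hi

end S7

set_option linter.all false

namespace S7

lemma InU_iff {n : ℕ} {C : Matrix (Fin n) (Fin n) HQ} {D : Matrix (Fin n) (Fin n) ℝ} (w : Fin n → HQ) :
    InU C D w ↔ (rq D - cj C * C) *ᵥ w = 0 := by
  unfold InU
  rw [sub_mulVec, ← mulVec_mulVec, sub_eq_zero, eq_comm]

lemma re_trace_comm {n : ℕ} (A B : Matrix (Fin n) (Fin n) HQ) :
    ∑ i, ((A * B) i i).re = ∑ i, ((B * A) i i).re := by
  simp only [Matrix.mul_apply, re_sum]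
  rw [Finset.sum_comm]
  refine Finset.sum_congr rfl fun i _ => Finset.sum_congr rfl fun j _ => re_mul_comm _ _

lemma norm_tr {n : ℕ} {P : Matrix (Fin n) (Fin n) HQ} (hP : P.IsHermitian) :
    ∑ i, ∑ j, Quaternion.normSq (P i j) = ∑ i, ((P * P) i i).re := by
  refine Finset.sum_congr rfl fun i _ => ?_
  rw [Matrix.mul_apply, re_sum]
  refine Finset.sum_congr rfl fun j _ => ?_
  rw [← re_star_mul_self, hP.apply j i, re_mul_comm]

lemma normSq_sub_coe (r : ℝ) (q : HQ) : Quaternion.normSq ((r : HQ) - q) = r ^ 2 - 2 * r * q.re + Quaternion.normSq q := by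
  rw [Quaternion.normSq_def', Quaternion.normSq_def']
  simp
  ring

lemma norm_eq {n : ℕ} {C : Matrix (Fin n) (Fin n) HQ} {D : Matrix (Fin n) (Fin n) ℝ} (hC : C.IsSymm) :
    ∑ i, ∑ j, Quaternion.normSq ((rq D - cj C * C) i j) = ∑ i, ∑ j, Quaternion.normSq ((rq D - C * cj C) i j) := by
  have h1 : (cj C * C).IsHermitian := by
    rw [← cj_herm hC]; exact isHermitian_conjTranspose_mul_self C
  have h2 : (C * cj C).IsHermitian := by
    rw [← cj_herm hC]; exact isHermitian_mul_conjTranspose_self C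
  have h3 : ∑ i, ∑ j, Quaternion.normSq ((cj C * C) i j) = ∑ i, ∑ j, Quaternion.normSq ((C * cj C) i j) := by
    rw [norm_tr h1, norm_tr h2, Matrix.mul_assoc, re_trace_comm, ← Matrix.mul_assoc, ← Matrix.mul_assoc]
  simp only [Matrix.sub_apply, rq_apply, normSq_sub_coe, Finset.sum_add_distrib, h3, re_CC hC]

lemma diag_re {n : ℕ} {M : Matrix (Fin n) (Fin n) HQ} (hM : M.IsHermitian) (i : Fin n) :
    M i i = ((M i i).re : HQ) := coe_of_star (hM.apply i i)

lemma minor_form {n : ℕ} {M : Matrix (Fin n) (Fin n) HQ} (hM : M.IsHermitian) (i j : Fin n) (α β : HQ) :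
    (star (Pi.single i α + Pi.single j β : Fin n → HQ) ⬝ᵥ M *ᵥ (Pi.single i α + Pi.single j β)).re =
      (M i i).re * Quaternion.normSq α + 2 * (star β * M j i * α).re + (M j j).re * Quaternion.normSq β := by
  have h1 : ∀ (k l : Fin n) (p q : HQ), star (Pi.single k p : Fin n → HQ) ⬝ᵥ M *ᵥ (Pi.single l q) = star p * M k l * q := by
    intro k l p q
    rw [← Pi.single_star, single_dotProduct, mulVec_single]
    simp [mul_assoc]
  have h2 : ∀ (k : Fin n) (p : HQ), (star p * M k k * p).re = (M k k).re * Quaternion.normSq p := by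
    intro k p
    rw [diag_re hM k, ← Quaternion.coe_commutes, mul_assoc, Quaternion.star_mul_self, ← Quaternion.coe_mul]
    simp
  rw [psd_add hM, h1, h1, h1, h2, h2]

lemma minor_vec {n : ℕ} {M : Matrix (Fin n) (Fin n) HQ} (hM : M.IsHermitian) (i j : Fin n) :
    (star (Pi.single i (-(M i j)) + Pi.single j ((M i i).re : HQ) : Fin n → HQ) ⬝ᵥ M *ᵥ (Pi.single i (-(M i j)) + Pi.single j ((M i i).re : HQ))).re =
      (M i i).re * ((M i i).re * (M j j).re - Quaternion.normSq (M i j)) := by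
  rw [minor_form hM]
  have : (star ((M i i).re : HQ) * M j i * -(M i j)).re = - ((M i i).re * Quaternion.normSq (M i j)) := by
    rw [← hM.apply j i, mul_neg, mul_assoc, Quaternion.star_mul_self, Quaternion.star_coe, ← Quaternion.coe_mul]
    simp
  rw [this]
  simp [Quaternion.normSq_coe]
  ring

lemma minor_le {n : ℕ} {M : Matrix (Fin n) (Fin n) HQ} (hM : QuatPSD M) (i j : Fin n) :
    Quaternion.normSq (M i j) ≤ (M i i).re * (M j j).re := by
  have h0 : 0 ≤ (M i i).re := by
    have := hM.2 (Pi.single i 1)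
    rwa [form_single] at this
  rcases h0.eq_or_lt with h | h
  · have h1 : M *ᵥ (Pi.single i 1) = 0 := psd_zero hM (by rw [form_single]; exact h.symm)
    have h2 : M j i = 0 := by simpa using congrFun h1 j
    rw [← h, ← hM.1.apply, h2]; simp
  · have h1 := hM.2 (Pi.single i (-(M i j)) + Pi.single j ((M i i).re : HQ))
    rw [minor_vec hM.1] at h1
    have := nonneg_of_mul_nonneg_right h1 h
    linarith

lemma minor_ker {n : ℕ} {M : Matrix (Fin n) (Fin n) HQ} (hM : QuatPSD M) {i j : Fin n} (hij : i ≠ j)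
    (h : Quaternion.normSq (M i j) = (M i i).re * (M j j).re) : ∃ w, w ≠ 0 ∧ M *ᵥ w = 0 := by
  by_cases h0 : (M i i).re = 0
  · refine ⟨Pi.single i 1, ?_, psd_zero hM (by rw [form_single]; exact h0)⟩
    intro e; simpa using congrFun e i
  · refine ⟨_, ?_, psd_zero hM (by rw [minor_vec hM.1 i j, h]; ring)⟩
    intro e
    have := congrFun e j
    rw [Pi.add_apply, Pi.single_eq_of_ne hij.symm, Pi.single_eq_same, zero_add] at this
    apply h0
    exact congrArg (fun q : HQ => q.re) this

lemma minor_eq {M : Matrix (Fin 3) (Fin 3) HQ} (hM : M.IsHermitian) {i j : Fin 3} {w : Fin 3 → HQ}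
    (hw : w ≠ 0) (hi : M i i * w i + M i j * w j = 0) (hj : M j i * w i + M j j * w j = 0)
    (hne : w i ≠ 0 ∨ w j ≠ 0) :
    Quaternion.normSq (M i j) = (M i i).re * (M j j).re := by
  have hs : M j i = star (M i j) := (hM.apply j i).symm
  rw [diag_re hM i] at hi
  rw [diag_re hM j] at hj
  rw [hs] at hj
  rcases hne with h | h
  · have e : (((M i i).re * (M j j).re - Quaternion.normSq (M i j) : ℝ) : HQ) * w i = 0 := by
      have h1 : (((M i i).re * (M j j).re - Quaternion.normSq (M i j) : ℝ) : HQ) * w i =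
        ((M j j).re : HQ) * (((M i i).re : HQ) * w i + M i j * w j) - M i j * (star (M i j) * w i + ((M j j).re : HQ) * w j) := by
        have h2 := Quaternion.self_mul_star (M i j)
        have h3 := Quaternion.coe_commutes (M j j).re (M i j)
        rw [Quaternion.coe_sub, Quaternion.coe_mul, ← h2, mul_add, mul_add, ← mul_assoc (M i j) _ (w j), ← h3]
        rw [Quaternion.coe_commutes (M i i).re ((M j j).re : HQ)]
        noncomm_ring
      rw [h1, hi, hj]; simp
    have := (mul_eq_zero.1 e).resolve_right h
    have : (M i i).re * (M j j).re - Quaternion.normSq (M i j) = 0 := congrArg (fun q : HQ => q.re) this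
    linarith
  · have e : (((M i i).re * (M j j).re - Quaternion.normSq (M i j) : ℝ) : HQ) * w j = 0 := by
      have h1 : (((M i i).re * (M j j).re - Quaternion.normSq (M i j) : ℝ) : HQ) * w j =
        ((M i i).re : HQ) * (star (M i j) * w i + ((M j j).re : HQ) * w j) - star (M i j) * (((M i i).re : HQ) * w i + M i j * w j) := by
        have h2 := Quaternion.star_mul_self (M i j)
        have h3 := Quaternion.coe_commutes (M i i).re (star (M i j))
        rw [Quaternion.coe_sub, Quaternion.coe_mul, ← h2, mul_add, mul_add, ← mul_assoc (star (M i j)) _ (w i), ← h3]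
        noncomm_ring
      rw [h1, hi, hj]; simp
    have := (mul_eq_zero.1 e).resolve_right h
    have : (M i i).re * (M j j).re - Quaternion.normSq (M i j) = 0 := congrArg (fun q : HQ => q.re) this
    linarith

lemma norm_lemma {C : Matrix (Fin 3) (Fin 3) HQ} {D : Matrix (Fin 3) (Fin 3) ℝ} (hc : Core C D)
    {e1 e2 : Fin 3 → HQ} (h1 : InU C D e1) (h2 : InU C D e2) (hi : Ind2 e1 e2) :
    ∃ w, w ≠ 0 ∧ InU (cj C) D w := by
  have hv : ∀ k, ∃ w, w ≠ 0 ∧ InU C D w ∧ w k = 0 := by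
    intro k
    by_cases h : e2 k = 0
    · refine ⟨e2, ?_, h2, h⟩
      rintro rfl
      have := (hi 0 1 (by simp)).2
      exact one_ne_zero this
    · refine ⟨MulOpposite.op 1 • e1 + MulOpposite.op (-((e2 k)⁻¹ * e1 k)) • e2, ?_, (h1.rmul _).add (h2.rmul _), ?_⟩
      · intro e
        exact one_ne_zero (hi _ _ e).1
      · simp only [Pi.add_apply, Pi.smul_apply, op_smul_eq_mul, mul_one, mul_neg]
        rw [← mul_assoc, mul_inv_cancel₀ h, one_mul, add_neg_cancel]
  have hdiag : ∀ i, ((rq D - C * cj C) i i).re = ((rq D - cj C * C) i i).re := by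
    intro i
    rw [Matrix.sub_apply, Matrix.sub_apply, Quaternion.re_sub, Quaternion.re_sub, re_CC hc.hC]
  have hn := norm_eq (D := D) hc.hC
  have hU : ∀ w, InU (cj C) D w ↔ (rq D - C * cj C) *ᵥ w = 0 := by
    intro w; rw [InU_iff, cj_cj]
  have hU' := fun w => InU_iff (C := C) (D := D) w
  have hp := hc.hp
  have hm := hc.hm
  simp only [hU, hU'] at hv ⊢
  generalize rq D - cj C * C = M at *
  generalize rq D - C * cj C = N at *
  have m01 : Quaternion.normSq (M 0 1) = (M 0 0).re * (M 1 1).re := by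
    obtain ⟨w, hw, hk, h0⟩ := hv 2
    have e0 := congrFun hk 0
    have e1 := congrFun hk 1
    simp [mulVec, dotProduct, Fin.sum_univ_three, h0] at e0 e1
    refine minor_eq hp.1 hw e0 e1 ?_
    by_contra hcon
    push Not at hcon
    apply hw; funext i; fin_cases i <;> simp [hcon, h0]
  have m02 : Quaternion.normSq (M 0 2) = (M 0 0).re * (M 2 2).re := by
    obtain ⟨w, hw, hk, h0⟩ := hv 1
    have e0 := congrFun hk 0
    have e1 := congrFun hk 2
    simp [mulVec, dotProduct, Fin.sum_univ_three, h0] at e0 e1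
    refine minor_eq hp.1 hw e0 e1 ?_
    by_contra hcon
    push Not at hcon
    apply hw; funext i; fin_cases i <;> simp [hcon, h0]
  have m12 : Quaternion.normSq (M 1 2) = (M 1 1).re * (M 2 2).re := by
    obtain ⟨w, hw, hk, h0⟩ := hv 0
    have e0 := congrFun hk 1
    have e1 := congrFun hk 2
    simp [mulVec, dotProduct, Fin.sum_univ_three, h0] at e0 e1
    refine minor_eq hp.1 hw e0 e1 ?_
    by_contra hcon
    push Not at hcon
    apply hw; funext i; fin_cases i <;> simp [hcon, h0]
  have sy : ∀ {P : Matrix (Fin 3) (Fin 3) HQ}, P.IsHermitian → ∀ i j, Quaternion.normSq (P i j) = Quaternion.normSq (P j i) := by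
    intro P hP i j
    rw [← hP.apply i j, Quaternion.normSq_star]
  have dg : ∀ {P : Matrix (Fin 3) (Fin 3) HQ}, P.IsHermitian → ∀ i, Quaternion.normSq (P i i) = (P i i).re ^ 2 := by
    intro P hP i
    conv_lhs => rw [diag_re hP i]
    rw [Quaternion.normSq_coe]
  simp only [Fin.sum_univ_three, dg hp.1, dg hm.1, sy hp.1 1 0, sy hp.1 2 0, sy hp.1 2 1, sy hm.1 1 0, sy hm.1 2 0, sy hm.1 2 1,
    hdiag] at hn
  have n01 := minor_le hm 0 1
  have n02 := minor_le hm 0 2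
  have n12 := minor_le hm 1 2
  refine minor_ker hm (i := 0) (j := 1) (by decide) ?_
  rw [hdiag, hdiag] at n01 n02 n12
  rw [hdiag, hdiag]
  linarith

end S7

set_option linter.all false

namespace S7

lemma rel_exists {n : ℕ} (hn : n ≤ 2) (C : Matrix (Fin n) (Fin n) HQ) (D : Matrix (Fin n) (Fin n) ℝ) :
    ∃ a d h, Rel C D a d h ∧ ¬ (a = 0 ∧ d = 0 ∧ h = 0) := by
  have hlt : Module.finrank ℝ (Matrix (Fin n) (Fin n) ℝ) < Module.finrank ℝ (ℝ × ℝ × HQ) := by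
    rw [finrank_dom, Module.finrank_matrix]
    simp
    nlinarith
  have hk := LinearMap.ker_ne_bot_of_finrank_lt (f := SmL C D) hlt
  obtain ⟨p, hp, hp0⟩ := Submodule.exists_mem_ne_zero_of_ne_bot hk
  refine ⟨p.1, p.2.1, p.2.2, hp, ?_⟩
  rintro ⟨h1, h2, h3⟩
  exact hp0 (Prod.ext h1 (Prod.ext h2 h3))

lemma small_dim {n : ℕ} (hn : n ≤ 2) {C : Matrix (Fin n) (Fin n) HQ} {D : Matrix (Fin n) (Fin n) ℝ}
    (hG : ∃ u, ¬ InU C D u) : ¬ ∃ e1 e2, InU C D e1 ∧ InU C D e2 ∧ Ind2 e1 e2 := by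
  rintro ⟨e1, e2, h1, h2, hi⟩
  obtain ⟨u, hu⟩ := hG
  interval_cases n
  · exact one_ne_zero (hi 1 0 (by funext i; exact i.elim0)).1
  · by_cases h : e2 0 = 0
    · have := (hi 0 1 (by funext i; fin_cases i; simp [h])).2
      exact one_ne_zero this
    · have := (hi 1 (-((e2 0)⁻¹ * e1 0)) (by
        funext i; fin_cases i
        simp only [Pi.add_apply, Pi.smul_apply, op_smul_eq_mul, mul_one, mul_neg]
        show e1 0 + -(e2 0 * ((e2 0)⁻¹ * e1 0)) = 0
        rw [← mul_assoc, mul_inv_cancel₀ h, one_mul, add_neg_cancel])).1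
      exact one_ne_zero this
  · obtain ⟨p, q, rfl⟩ := span2 hi u
    exact hu ((h1.rmul p).add (h2.rmul q))

lemma zero_side {n : ℕ} {C : Matrix (Fin n) (Fin n) HQ} {D : Matrix (Fin n) (Fin n) ℝ} (hn : 0 < n)
    (h0 : ∀ w, InU C D w → w = 0) {w0 : Fin n → HQ}
    (hsp : ∀ w, InU (cj C) D w → ∃ q : HQ, w = MulOpposite.op q • w0) : Concl C D := by
  obtain ⟨x, hx⟩ : ∃ x : Fin n → ℝ, x ≠ 0 := ⟨fun _ => 1, fun h => one_ne_zero (congrFun h ⟨0, hn⟩)⟩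
  by_cases hb : rd x w0 = 0
  · refine ⟨x, 0, 1, hx, Or.inr one_ne_zero, ?_, ?_⟩
    · intro w hw; rw [h0 w hw]; simp [rd_zero]
    · intro w hw
      obtain ⟨q, rfl⟩ := hsp w hw
      rw [rd_rmul, hb]; simp
  · refine ⟨x, 1, star (rd x (cj C *ᵥ w0) * (rd x w0)⁻¹), hx, Or.inl one_ne_zero, ?_, ?_⟩
    · intro w hw; rw [h0 w hw]; simp [rd_zero]
    · intro w hw
      obtain ⟨q, rfl⟩ := hsp w hw
      rw [mulVec_smul, rd_rmul, rd_rmul, star_star, one_smul, ← mul_assoc, mul_assoc _ _ (rd x w0), inv_mul_cancel₀ hb, mul_one]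

lemma pick_x {n : ℕ} {w w' : Fin n → HQ} (hw : w ≠ 0) (hw' : w' ≠ 0) : ∃ x : Fin n → ℝ, rd x w ≠ 0 ∧ rd x w' ≠ 0 := by
  obtain ⟨i, hi⟩ := Function.ne_iff.1 hw
  obtain ⟨j, hj⟩ := Function.ne_iff.1 hw'
  rw [Pi.zero_apply] at hi hj
  have hs : ∀ (k : Fin n) (v : Fin n → HQ), rd (Pi.single k 1) v = v k := by
    intro k v; simp [rd, Pi.single_apply]
  have ha : ∀ (x y : Fin n → ℝ) (v : Fin n → HQ), rd (x + y) v = rd x v + rd y v := by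
    intro x y v; simp [rd, add_smul, Finset.sum_add_distrib]
  by_cases h1 : w j = 0
  · by_cases h2 : w' i = 0
    · refine ⟨Pi.single i 1 + Pi.single j 1, ?_, ?_⟩
      · rw [ha, hs, hs, h1, add_zero]; exact hi
      · rw [ha, hs, hs, h2, zero_add]; exact hj
    · exact ⟨Pi.single i 1, by rw [hs]; exact hi, by rw [hs]; exact h2⟩
  · exact ⟨Pi.single j 1, by rw [hs]; exact h1, by rw [hs]; exact hj⟩

lemma no_rel {C : Matrix (Fin 3) (Fin 3) HQ} {D : Matrix (Fin 3) (Fin 3) ℝ} (hc : Core C D)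
    (hk : ∀ a d h, Rel C D a d h → a = 0 ∧ d = 0 ∧ h = 0) : Concl C D := by
  by_cases h1 : ∀ w, InU C D w → w = 0
  · rcases dich (cj C) D with ⟨w0, -, hsp⟩ | ⟨e1, e2, he1, he2, hi⟩
    · exact zero_side (by norm_num) h1 hsp
    · obtain ⟨w, hw, hU⟩ := norm_lemma hc.swap he1 he2 hi
      rw [cj_cj] at hU
      exact absurd (h1 w hU) hw
  by_cases h2 : ∀ w, InU (cj C) D w → w = 0
  · apply Concl.swap
    rcases dich C D with ⟨w0, -, hsp⟩ | ⟨e1, e2, he1, he2, hi⟩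
    · exact zero_side (by norm_num) h2 (by rw [cj_cj]; exact hsp)
    · obtain ⟨w, hw, hU⟩ := norm_lemma hc he1 he2 hi
      exact absurd (h2 w hU) hw
  push Not at h1 h2
  obtain ⟨w, hw, hw0⟩ := h1
  obtain ⟨w', hw', hw0'⟩ := h2
  obtain ⟨x, hx1, hx2⟩ := pick_x hw0 hw0'
  have hx : x ≠ 0 := by rintro rfl; simp [rd] at hx1
  obtain ⟨a, d, h, hS⟩ := T_all hc.hC hc.hD hk x
  exact solve_i hx (fun u u' hu hu' => F_of_rank_one hc.hC hc.hD hS hu hu') hw hx1 (Or.inl ⟨w', hw', hx2⟩)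

theorem normalized {n : ℕ} (hn : 0 < n) (hn3 : n ≤ 3) {C : Matrix (Fin n) (Fin n) HQ} {D : Matrix (Fin n) (Fin n) ℝ}
    (hc : Core C D) : Concl C D := by
  by_cases hall : ∀ u, InU C D u
  · exact case_all hn hc hall
  have hG : ∃ u, ¬ InU C D u := by push Not at hall; exact hall
  have hΔ : ∀ {a d h}, Rel C D a d h → ¬ (a = 0 ∧ d = 0 ∧ h = 0) → Quaternion.normSq h - a * d ≠ 0 := by
    intro a d h hr hne h0
    exact hall (delta_zero hc hn hr h0 hne)
  by_cases hn2 : n ≤ 2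
  · obtain ⟨a, d, h, hr, hne⟩ := rel_exists hn2 C D
    rcases dich C D with ⟨w0, hw0, hsp⟩ | hcon
    · exact case_one hc hn hr (hΔ hr hne) hw0 hsp
    · exact absurd hcon (small_dim hn2 hG)
  obtain rfl : n = 3 := by omega
  by_cases hk : ∀ a d h, Rel C D a d h → a = 0 ∧ d = 0 ∧ h = 0
  · exact no_rel hc hk
  push Not at hk
  obtain ⟨a, d, h, hr, hne⟩ := hk
  have hne' : ¬ (a = 0 ∧ d = 0 ∧ h = 0) := fun ⟨p, q, r⟩ => hne p q r
  rcases dich C D with ⟨w0, hw0, hsp⟩ | ⟨e1, e2, he1, he2, hi⟩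
  · exact case_one hc hn hr (hΔ hr hne') hw0 hsp
  by_cases h1 : ∀ a' d' h', Rel C D a' d' h' → ∃ r : ℝ, a' = r * a ∧ d' = r * d ∧ h' = r • h
  · obtain ⟨x, hx, b, k, g, hS⟩ := T_one hc.hC hc.hD h1
    exact solve hx (fun u u' hu hu' => F_of_rank_one hc.hC hc.hD hS hu hu') hr (hΔ hr hne')
  push Not at h1
  obtain ⟨a', d', h', hr', hn'⟩ := h1
  refine case_tau hc hG he1 he2 hi hr hr' ?_
  intro r s q1 q2 q3
  have hs : s = 0 := by
    by_contra hs
    refine hn' (-(r / s)) ?_ ?_ ?_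
    · field_simp; linarith
    · field_simp; linarith
    · have : s • h' = -(r • h) := by rw [eq_neg_iff_add_eq_zero, add_comm]; exact q3
      calc h' = s⁻¹ • s • h' := by rw [smul_smul, inv_mul_cancel₀ hs, one_smul]
        _ = _ := by rw [this, smul_neg, smul_smul, neg_smul]; congr 2; field_simp
  subst hs
  refine ⟨?_, rfl⟩
  by_contra hr0
  simp [hr0] at q1 q2 q3
  exact hne' ⟨q1, q2, q3⟩

end S7

set_option linter.all false

namespace S7

/-- real rectangular matrix acting on quaternionic vectors -/
noncomputable def ra {m n : ℕ} (P : Matrix (Fin m) (Fin n) ℝ) (u : Fin n → HQ) : Fin m → HQ :=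
  fun i => ∑ j, P i j • u j

lemma ra_add {m n : ℕ} (P : Matrix (Fin m) (Fin n) ℝ) (u v : Fin n → HQ) : ra P (u + v) = ra P u + ra P v := by
  funext i; simp [ra, Finset.sum_add_distrib]
lemma ra_zero {m n : ℕ} (P : Matrix (Fin m) (Fin n) ℝ) : ra P 0 = 0 := by
  funext i; simp [ra]
lemma ra_one {n : ℕ} (u : Fin n → HQ) : ra 1 u = u := by
  funext i; simp [ra, Matrix.one_apply]
lemma ra_mul {m n k : ℕ} (P : Matrix (Fin m) (Fin n) ℝ) (Q : Matrix (Fin n) (Fin k) ℝ) (u : Fin k → HQ) :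
    ra (P * Q) u = ra P (ra Q u) := by
  funext i
  simp only [ra, Matrix.mul_apply, Finset.sum_smul, Finset.smul_sum, smul_smul]
  rw [Finset.sum_comm]
lemma ra_rd {m n : ℕ} (P : Matrix (Fin m) (Fin n) ℝ) (x : Fin m → ℝ) (u : Fin n → HQ) :
    rd (Pᵀ *ᵥ x) u = rd x (ra P u) := by
  simp only [rd, ra, mulVec, dotProduct, transpose_apply, Finset.sum_smul, Finset.smul_sum, smul_smul]
  rw [Finset.sum_comm]
  simp only [mul_comm]
lemma ra_star {m n : ℕ} (P : Matrix (Fin m) (Fin n) ℝ) (u : Fin n → HQ) (v : Fin m → HQ) :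
    star (ra P u) ⬝ᵥ v = star u ⬝ᵥ ra Pᵀ v := by
  simp only [ra, dotProduct, Pi.star_apply, star_sum, Quaternion.star_smul, transpose_apply, Finset.sum_mul, Finset.mul_sum,
    smul_mul_assoc, mul_smul_comm]
  rw [Finset.sum_comm]

/-- real congruence -/
noncomputable def cg {m n : ℕ} (P : Matrix (Fin m) (Fin n) ℝ) (C : Matrix (Fin m) (Fin m) HQ) : Matrix (Fin n) (Fin n) HQ :=
  Matrix.of fun i j => ∑ k, ∑ l, (P k i * P l j) • C k l

lemma cg_mulVec {m n : ℕ} (P : Matrix (Fin m) (Fin n) ℝ) (C : Matrix (Fin m) (Fin m) HQ) (u : Fin n → HQ) :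
    cg P C *ᵥ u = ra Pᵀ (C *ᵥ (ra P u)) := by
  funext i
  simp only [ra, cg, mulVec, dotProduct, of_apply, transpose_apply, Finset.sum_mul, Finset.mul_sum, Finset.smul_sum,
    smul_mul_assoc, mul_smul_comm, smul_smul]
  rw [Finset.sum_comm]
  refine Finset.sum_congr rfl fun k _ => ?_
  rw [Finset.sum_comm]

lemma cj_cg {m n : ℕ} (P : Matrix (Fin m) (Fin n) ℝ) (C : Matrix (Fin m) (Fin m) HQ) : cj (cg P C) = cg P (cj C) := by
  refine Matrix.ext fun i j => ?_
  simp only [cj_apply, cg, of_apply, star_sum, Quaternion.star_smul]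

lemma cg_symm {m n : ℕ} (P : Matrix (Fin m) (Fin n) ℝ) {C : Matrix (Fin m) (Fin m) HQ} (h : C.IsSymm) : (cg P C).IsSymm := by
  refine Matrix.ext fun i j => ?_
  rw [transpose_apply]
  simp only [cg, of_apply]
  rw [Finset.sum_comm]
  refine Finset.sum_congr rfl fun k _ => Finset.sum_congr rfl fun l _ => ?_
  rw [h.apply, mul_comm]

lemma coe_sum' {κ : Type*} (s : Finset κ) (f : κ → ℝ) : ((∑ i ∈ s, f i : ℝ) : HQ) = ∑ i ∈ s, (f i : HQ) :=
  map_sum (algebraMap ℝ HQ) f s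

lemma rq_cg {m n : ℕ} (P : Matrix (Fin m) (Fin n) ℝ) (A : Matrix (Fin m) (Fin m) ℝ) : rq (Pᵀ * A * P) = cg P (rq A) := by
  refine Matrix.ext fun i j => ?_
  simp only [cg, of_apply, rq_apply, Matrix.mul_apply, transpose_apply, Finset.sum_mul]
  rw [Finset.sum_comm, coe_sum']
  refine Finset.sum_congr rfl fun k _ => ?_
  rw [coe_sum']
  refine Finset.sum_congr rfl fun l _ => ?_
  rw [← Quaternion.coe_smul, smul_eq_mul]
  congr 1; ring

/-- the quadratic form -/
noncomputable def fm {n : ℕ} (A : Matrix (Fin n) (Fin n) ℝ) (C : Matrix (Fin n) (Fin n) HQ) (D : Matrix (Fin n) (Fin n) ℝ)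
    (u v : Fin n → HQ) : ℝ :=
  (star u ⬝ᵥ (rq A *ᵥ u + C *ᵥ v) + star v ⬝ᵥ (cj C *ᵥ u + rq D *ᵥ v)).re

def InK {n : ℕ} (A : Matrix (Fin n) (Fin n) ℝ) (C : Matrix (Fin n) (Fin n) HQ) (D : Matrix (Fin n) (Fin n) ℝ)
    (u v : Fin n → HQ) : Prop :=
  rq A *ᵥ u + C *ᵥ v = 0 ∧ cj C *ᵥ u + rq D *ᵥ v = 0

def Bm {n : ℕ} (A : Matrix (Fin n) (Fin n) ℝ) (C : Matrix (Fin n) (Fin n) HQ) (D : Matrix (Fin n) (Fin n) ℝ) :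
    Matrix (Fin n ⊕ Fin n) (Fin n ⊕ Fin n) HQ := fromBlocks (rq A) C (cj C) (rq D)

structure PPT {n : ℕ} (A : Matrix (Fin n) (Fin n) ℝ) (C : Matrix (Fin n) (Fin n) HQ) (D : Matrix (Fin n) (Fin n) ℝ) : Prop where
  hA : A.IsSymm
  hC : C.IsSymm
  hD : D.IsSymm
  hp : ∀ u v, 0 ≤ fm A C D u v
  hm : ∀ u v, 0 ≤ fm A (cj C) D u v

lemma PPT.swap {n : ℕ} {A : Matrix (Fin n) (Fin n) ℝ} {C : Matrix (Fin n) (Fin n) HQ} {D : Matrix (Fin n) (Fin n) ℝ}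
    (h : PPT A C D) : PPT A (cj C) D := ⟨h.hA, cj_symm h.hC, h.hD, h.hm, by rw [cj_cj]; exact h.hp⟩

lemma Bm_mulVec {n : ℕ} (A : Matrix (Fin n) (Fin n) ℝ) (C : Matrix (Fin n) (Fin n) HQ) (D : Matrix (Fin n) (Fin n) ℝ)
    (z : Fin n ⊕ Fin n → HQ) : Bm A C D *ᵥ z =
      Sum.elim (rq A *ᵥ (z ∘ Sum.inl) + C *ᵥ (z ∘ Sum.inr)) (cj C *ᵥ (z ∘ Sum.inl) + rq D *ᵥ (z ∘ Sum.inr)) := by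
  rw [Bm, fromBlocks_mulVec]

lemma Bm_ker {n : ℕ} (A : Matrix (Fin n) (Fin n) ℝ) (C : Matrix (Fin n) (Fin n) HQ) (D : Matrix (Fin n) (Fin n) ℝ)
    (z : Fin n ⊕ Fin n → HQ) : Bm A C D *ᵥ z = 0 ↔ InK A C D (z ∘ Sum.inl) (z ∘ Sum.inr) := by
  rw [Bm_mulVec, InK]
  constructor
  · intro h
    exact ⟨funext fun i => congrFun h (Sum.inl i), funext fun i => congrFun h (Sum.inr i)⟩
  · rintro ⟨h1, h2⟩
    rw [h1, h2]
    funext i; cases i <;> rfl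

lemma Bm_form {n : ℕ} (A : Matrix (Fin n) (Fin n) ℝ) (C : Matrix (Fin n) (Fin n) HQ) (D : Matrix (Fin n) (Fin n) ℝ)
    (z : Fin n ⊕ Fin n → HQ) : (star z ⬝ᵥ Bm A C D *ᵥ z).re = fm A C D (z ∘ Sum.inl) (z ∘ Sum.inr) := by
  rw [Bm_mulVec, fm]
  congr 1
  simp only [dotProduct, Fintype.sum_sum_type, Sum.elim_inl, Sum.elim_inr, Pi.star_apply, Function.comp]
  rfl

lemma Bm_psd {n : ℕ} {A : Matrix (Fin n) (Fin n) ℝ} {C : Matrix (Fin n) (Fin n) HQ} {D : Matrix (Fin n) (Fin n) ℝ}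
    (hA : A.IsSymm) (hC : C.IsSymm) (hD : D.IsSymm) (h : ∀ u v, 0 ≤ fm A C D u v) : QuatPSD (Bm A C D) := by
  have hr : ∀ {E : Matrix (Fin n) (Fin n) ℝ}, E.IsSymm → (rq E)ᴴ = rq E := by
    intro E hE
    refine Matrix.ext fun i j => ?_
    rw [conjTranspose_apply, rq_apply, rq_apply, hE.apply]; simp
  refine ⟨?_, fun z => by rw [Bm_form]; exact h _ _⟩
  rw [Matrix.IsHermitian, Bm, fromBlocks_conjTranspose, hr hA, hr hD, cj_herm (cj_symm hC), cj_cj, cj_herm hC]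

lemma PPT.psd {n : ℕ} {A : Matrix (Fin n) (Fin n) ℝ} {C : Matrix (Fin n) (Fin n) HQ} {D : Matrix (Fin n) (Fin n) ℝ}
    (h : PPT A C D) : QuatPSD (Bm A C D) := Bm_psd h.hA h.hC h.hD h.hp

lemma PPT.ker {n : ℕ} {A : Matrix (Fin n) (Fin n) ℝ} {C : Matrix (Fin n) (Fin n) HQ} {D : Matrix (Fin n) (Fin n) ℝ}
    (h : PPT A C D) {u v : Fin n → HQ} (h0 : fm A C D u v = 0) : InK A C D u v := by
  have := psd_zero h.psd (u := Sum.elim u v) (by rw [Bm_form]; exact h0)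
  rw [Bm_ker] at this
  exact this

def StepC {n : ℕ} (A : Matrix (Fin n) (Fin n) ℝ) (C : Matrix (Fin n) (Fin n) HQ) (D : Matrix (Fin n) (Fin n) ℝ) : Prop :=
  ∃ (x : Fin n → ℝ) (a : ℝ) (g : HQ), x ≠ 0 ∧ (a ≠ 0 ∨ g ≠ 0) ∧
    (∀ u v, InK A C D u v → a • rd x u + g * rd x v = 0) ∧
    (∀ u v, InK A (cj C) D u v → a • rd x u + star g * rd x v = 0)

lemma fm_cg {m n : ℕ} (Q : Matrix (Fin n) (Fin m) ℝ) (A : Matrix (Fin n) (Fin n) ℝ) (C : Matrix (Fin n) (Fin n) HQ)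
    (D : Matrix (Fin n) (Fin n) ℝ) (u v : Fin m → HQ) :
    fm (Qᵀ * A * Q) (cg Q C) (Qᵀ * D * Q) u v = fm A C D (ra Q u) (ra Q v) := by
  unfold fm
  rw [cj_cg, rq_cg, rq_cg, cg_mulVec, cg_mulVec, cg_mulVec, cg_mulVec, ← ra_add, ← ra_add, ra_star, ra_star]

lemma PPT.cg {m n : ℕ} (Q : Matrix (Fin n) (Fin m) ℝ) {A : Matrix (Fin n) (Fin n) ℝ} {C : Matrix (Fin n) (Fin n) HQ}
    {D : Matrix (Fin n) (Fin n) ℝ} (h : PPT A C D) : PPT (Qᵀ * A * Q) (cg Q C) (Qᵀ * D * Q) := by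
  refine ⟨?_, cg_symm Q h.hC, ?_, fun u v => ?_, fun u v => ?_⟩
  · rw [Matrix.IsSymm, transpose_mul, transpose_mul, transpose_transpose, h.hA.eq, Matrix.mul_assoc]
  · rw [Matrix.IsSymm, transpose_mul, transpose_mul, transpose_transpose, h.hD.eq, Matrix.mul_assoc]
  · rw [fm_cg]; exact h.hp _ _
  · rw [cj_cg, fm_cg]; exact h.hm _ _

lemma InK_cg {m n : ℕ} (P : Matrix (Fin m) (Fin n) ℝ) (Q : Matrix (Fin n) (Fin m) ℝ) (hPQ : P * Q = 1)
    {A : Matrix (Fin n) (Fin n) ℝ} {C : Matrix (Fin n) (Fin n) HQ}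
    {D : Matrix (Fin n) (Fin n) ℝ} (hA : (Q * P)ᵀ * A * (Q * P) = A) (hC : cg (Q * P) C = C)
    (hD : (Q * P)ᵀ * D * (Q * P) = D) {u v : Fin n → HQ} (h : InK A C D u v) :
    InK (Qᵀ * A * Q) (cg Q C) (Qᵀ * D * Q) (ra P u) (ra P v) := by
  have hT : ∀ w, ra Pᵀ w = 0 → w = 0 := by
    intro w hw
    have : ra (Qᵀ * Pᵀ) w = 0 := by rw [ra_mul, hw, ra_zero]
    rwa [← transpose_mul, hPQ, transpose_one, ra_one] at this
  have e : ∀ (M : Matrix (Fin n) (Fin n) HQ) (w : Fin n → HQ), cg (Q * P) M *ᵥ w = ra Pᵀ (cg Q M *ᵥ (ra P w)) := by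
    intro M w
    rw [cg_mulVec, cg_mulVec, transpose_mul, ra_mul, ra_mul]
  obtain ⟨h1, h2⟩ := h
  have hC' : cg (Q * P) (cj C) = cj C := by rw [← cj_cg, hC]
  rw [← hA, ← hC, rq_cg, e, e, ← ra_add] at h1
  rw [← hD, ← hC', rq_cg, e, e, ← ra_add] at h2
  refine ⟨?_, ?_⟩
  · rw [rq_cg]; exact hT _ h1
  · rw [rq_cg, cj_cg]; exact hT _ h2

lemma StepC.of_cg {m n : ℕ} (P : Matrix (Fin m) (Fin n) ℝ) (Q : Matrix (Fin n) (Fin m) ℝ) (hPQ : P * Q = 1)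
    {A : Matrix (Fin n) (Fin n) ℝ} {C : Matrix (Fin n) (Fin n) HQ}
    {D : Matrix (Fin n) (Fin n) ℝ} (hA : (Q * P)ᵀ * A * (Q * P) = A) (hC : cg (Q * P) C = C)
    (hD : (Q * P)ᵀ * D * (Q * P) = D) (h : StepC (Qᵀ * A * Q) (S7.cg Q C) (Qᵀ * D * Q)) : StepC A C D := by
  obtain ⟨x, a, g, hx, hag, h1, h2⟩ := h
  refine ⟨Pᵀ *ᵥ x, a, g, ?_, hag, fun u v h => ?_, fun u v h => ?_⟩
  · intro h0
    apply hx
    have : Qᵀ *ᵥ (Pᵀ *ᵥ x) = 0 := by rw [h0, mulVec_zero]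
    rwa [mulVec_mulVec, ← transpose_mul, hPQ, transpose_one, one_mulVec] at this
  · rw [ra_rd, ra_rd]; exact h1 _ _ (InK_cg P Q hPQ hA hC hD h)
  · rw [ra_rd, ra_rd]; refine h2 _ _ ?_
    rw [cj_cg]
    exact InK_cg P Q hPQ hA (by rw [← cj_cg, hC]) hD h

lemma step_one {n : ℕ} (hn : 0 < n) (hn3 : n ≤ 3) {C : Matrix (Fin n) (Fin n) HQ}
    {D : Matrix (Fin n) (Fin n) ℝ} (h : PPT 1 C D) : StepC 1 C D := by
  have h1 : rq (1 : Matrix (Fin n) (Fin n) ℝ) = 1 := by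
    refine Matrix.ext fun i j => ?_
    rw [rq_apply, Matrix.one_apply, Matrix.one_apply]
    split_ifs <;> simp
  have hr : (rq D)ᴴ = rq D := by
    refine Matrix.ext fun i j => ?_
    rw [conjTranspose_apply, rq_apply, rq_apply, h.hD.apply]; simp
  have key : ∀ {M : Matrix (Fin n) (Fin n) HQ}, M.IsSymm → (∀ u v, 0 ≤ fm 1 M D u v) → QuatPSD (rq D - cj M * M) := by
    intro M hM hf
    refine ⟨?_, fun w => ?_⟩
    · rw [← cj_herm hM]
      exact Matrix.IsHermitian.sub hr (isHermitian_conjTranspose_mul_self M)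
    · have := hf (-(M *ᵥ w)) w
      rw [fm, h1, one_mulVec, neg_add_cancel, dotProduct_zero, zero_add, mulVec_neg] at this
      rw [sub_mulVec, ← mulVec_mulVec, sub_eq_neg_add]
      exact this
  have hc : Core C D := ⟨h.hC, h.hD, key h.hC h.hp, by
    have := key (cj_symm h.hC) h.hm
    rwa [cj_cj] at this⟩
  have hk : ∀ {M : Matrix (Fin n) (Fin n) HQ} {u v}, InK 1 M D u v → u = -(M *ᵥ v) ∧ InU M D v := by
    intro M u v hI
    obtain ⟨e1, e2⟩ := hI
    rw [h1, one_mulVec] at e1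
    have e3 : u = -(M *ᵥ v) := eq_neg_of_add_eq_zero_left e1
    refine ⟨e3, ?_⟩
    rw [e3, mulVec_neg] at e2
    exact (neg_add_eq_zero.1 e2)
  obtain ⟨x, a, g, hx, hag, q1, q2⟩ := normalized hn hn3 hc
  have hneg : ∀ w : Fin n → HQ, rd x (-w) = - rd x w := by intro w; simp [rd]
  refine ⟨x, a, g, hx, hag, fun u v hI => ?_, fun u v hI => ?_⟩
  · obtain ⟨rfl, hU⟩ := hk hI
    rw [q1 v hU, hneg, smul_neg, neg_add_cancel]
  · obtain ⟨rfl, hU⟩ := hk hI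
    rw [q2 v hU, hneg, smul_neg, neg_add_cancel]

end S7

set_option linter.all false

namespace S7

lemma cg_one {n : ℕ} (C : Matrix (Fin n) (Fin n) HQ) : cg 1 C = C := by
  refine Matrix.ext fun i j => ?_
  simp [cg, Matrix.one_apply]

open scoped ComplexOrder MatrixOrder in
lemma psd_fac {n : ℕ} {A : Matrix (Fin n) (Fin n) ℝ} (hA : A.PosSemidef) : ∃ B : Matrix (Fin n) (Fin n) ℝ, A = Bᵀ * B := by
  obtain ⟨B, rfl⟩ := CStarAlgebra.nonneg_iff_eq_star_mul_self.mp hA.nonneg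
  exact ⟨B, by rw [star_eq_conjTranspose, conjTranspose_eq_transpose_of_trivial]⟩

/-- real vector as quaternionic vector -/
noncomputable def qv {n : ℕ} (x : Fin n → ℝ) : Fin n → HQ := fun i => (x i : HQ)

lemma rq_qv {n : ℕ} (A : Matrix (Fin n) (Fin n) ℝ) (x : Fin n → ℝ) : rq A *ᵥ qv x = qv (A *ᵥ x) := by
  funext i
  simp only [qv, mulVec, dotProduct, rq_apply, coe_sum', Quaternion.coe_mul]

lemma star_qv {n : ℕ} (x : Fin n → ℝ) (u : Fin n → HQ) : star (qv x) ⬝ᵥ u = rd x u := by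
  simp only [qv, dotProduct, rd, Pi.star_apply, Quaternion.star_coe, Quaternion.coe_mul_eq_smul]

lemma rd_qv {n : ℕ} (x y : Fin n → ℝ) : rd x (qv y) = ((x ⬝ᵥ y : ℝ) : HQ) := by
  simp only [qv, dotProduct, rd, coe_sum', ← Quaternion.coe_mul_eq_smul, Quaternion.coe_mul]

lemma qv_zero {n : ℕ} : qv (0 : Fin n → ℝ) = 0 := by
  funext i; simp [qv]

lemma fm_qv {n : ℕ} (A : Matrix (Fin n) (Fin n) ℝ) (C : Matrix (Fin n) (Fin n) HQ) (D : Matrix (Fin n) (Fin n) ℝ)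
    (x : Fin n → ℝ) : fm A C D (qv x) 0 = x ⬝ᵥ A *ᵥ x := by
  rw [fm, star_zero, zero_dotProduct, mulVec_zero, add_zero, add_zero, rq_qv, star_qv, rd_qv]
  rfl

lemma PPT.posA {n : ℕ} {A : Matrix (Fin n) (Fin n) ℝ} {C : Matrix (Fin n) (Fin n) HQ} {D : Matrix (Fin n) (Fin n) ℝ}
    (h : PPT A C D) : A.PosSemidef := by
  refine Matrix.PosSemidef.of_dotProduct_mulVec_nonneg ?_ fun x => ?_
  · rw [Matrix.IsHermitian, conjTranspose_eq_transpose_of_trivial]; exact h.hA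
  · rw [star_trivial, ← fm_qv A C D]; exact h.hp _ _

lemma PPT.Cz {n : ℕ} {A : Matrix (Fin n) (Fin n) ℝ} {C : Matrix (Fin n) (Fin n) HQ} {D : Matrix (Fin n) (Fin n) ℝ}
    (h : PPT A C D) {z : Fin n → ℝ} (hz : A *ᵥ z = 0) : cj C *ᵥ qv z = 0 := by
  have := h.ker (u := qv z) (v := 0) (by rw [fm_qv, hz, dotProduct_zero])
  have := this.2
  rwa [mulVec_zero, add_zero] at this

/-- projection data -/
noncomputable def Pm {m : ℕ} (k : Fin (m+1)) (z : Fin (m+1) → ℝ) : Matrix (Fin m) (Fin (m+1)) ℝ :=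
  Matrix.of fun j i => (if i = k.succAbove j then 1 else 0) - (if i = k then z (k.succAbove j) / z k else 0)
noncomputable def Qm {m : ℕ} (k : Fin (m+1)) : Matrix (Fin (m+1)) (Fin m) ℝ :=
  Matrix.of fun i j => if i = k.succAbove j then 1 else 0

lemma PQ {m : ℕ} (k : Fin (m+1)) (z : Fin (m+1) → ℝ) : Pm k z * Qm k = 1 := by
  refine Matrix.ext fun i j => ?_
  rw [Matrix.mul_apply, Fin.sum_univ_succAbove _ k]
  simp [Pm, Qm, Matrix.one_apply, Fin.succAbove_ne, Fin.ne_succAbove, eq_comm]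

lemma QP {m : ℕ} (k : Fin (m+1)) (z : Fin (m+1) → ℝ) (hk : z k ≠ 0) (i j : Fin (m+1)) :
    (Qm k * Pm k z) i j = (if i = j then 1 else 0) - z i * (if j = k then (z k)⁻¹ else 0) := by
  rw [Matrix.mul_apply]
  rcases Fin.eq_self_or_eq_succAbove k i with rfl | ⟨l, rfl⟩
  · have : ∀ x, (Qm i) i x = 0 := by intro x; simp [Qm, Fin.ne_succAbove]
    simp only [this, zero_mul, Finset.sum_const_zero, eq_comm (a := i)]
    split_ifs
    · rw [mul_inv_cancel₀ hk, sub_self]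
    · simp
  · have : ∀ x, (Qm k) (k.succAbove l) x = if l = x then 1 else 0 := by intro x; simp [Qm]
    simp only [this, ite_mul, one_mul, zero_mul, Finset.sum_ite_eq, Finset.mem_univ, if_true]
    simp only [Pm, of_apply, eq_comm (a := k.succAbove l)]
    congr 1
    split_ifs <;> simp [div_eq_mul_inv]

lemma E_real {m : ℕ} (k : Fin (m+1)) (z : Fin (m+1) → ℝ) (hk : z k ≠ 0) {A : Matrix (Fin (m+1)) (Fin (m+1)) ℝ} (hA : A.IsSymm)
    (hz : A *ᵥ z = 0) : (Qm k * Pm k z)ᵀ * A * (Qm k * Pm k z) = A := by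
  have h1 : A * (Qm k * Pm k z) = A := by
    refine Matrix.ext fun i j => ?_
    rw [Matrix.mul_apply]
    simp only [QP k z hk, mul_sub, ← mul_assoc, Finset.sum_sub_distrib]
    rw [← Finset.sum_mul]
    have : ∑ l, A i l * z l = 0 := congrFun hz i
    rw [this]
    simp
  have h2 : (Qm k * Pm k z)ᵀ * A = A := by
    have := congrArg transpose h1
    rwa [transpose_mul, hA.eq] at this
  rw [h2, h1]

lemma E_quat {m : ℕ} (k : Fin (m+1)) (z : Fin (m+1) → ℝ) (hk : z k ≠ 0) {C : Matrix (Fin (m+1)) (Fin (m+1)) HQ} (hC : C.IsSymm)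
    (hz : C *ᵥ qv z = 0) : cg (Qm k * Pm k z) C = C := by
  have hz' : ∀ i, ∑ l, z l • C i l = 0 := by
    intro i
    have : ∑ l, C i l * (z l : HQ) = 0 := congrFun hz i
    simpa only [Quaternion.mul_coe_eq_smul] using this
  have h1 : ∀ i j, ∑ l, (Qm k * Pm k z) l j • C i l = C i j := by
    intro i j
    simp only [QP k z hk, sub_smul, Finset.sum_sub_distrib]
    have : ∑ l, (z l * (if j = k then (z k)⁻¹ else 0)) • C i l = 0 := by
      simp only [mul_comm (z _), mul_smul]
      rw [← Finset.smul_sum, hz', smul_zero]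
    rw [this]
    simp
  refine Matrix.ext fun i j => ?_
  simp only [cg, of_apply, mul_smul]
  simp only [← Finset.smul_sum, h1]
  rw [← hC.apply i j, ← h1 j i]
  refine Finset.sum_congr rfl fun l _ => ?_
  rw [hC.apply]

theorem step : ∀ (n : ℕ), n ≤ 3 → ∀ {A : Matrix (Fin n) (Fin n) ℝ} {C : Matrix (Fin n) (Fin n) HQ} {D : Matrix (Fin n) (Fin n) ℝ},
    PPT A C D → (A ≠ 0 ∨ D ≠ 0) → StepC A C D := by
  intro n
  induction n with
  | zero =>
    intro _ A C D _ hne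
    exact absurd (by constructor <;> exact Subsingleton.elim _ _ : A = 0 ∧ D = 0) (by tauto)
  | succ m ih =>
    intro hm3 A C D h hne
    by_cases hdet : A.det = 0
    · obtain ⟨z, hz0, hz⟩ := Matrix.exists_mulVec_eq_zero_iff.2 hdet
      have c1 : cj C *ᵥ qv z = 0 := h.Cz hz
      have c2 : C *ᵥ qv z = 0 := by have := h.swap.Cz hz; rwa [cj_cj] at this
      by_cases hDz : D *ᵥ z = 0
      · obtain ⟨k, hk⟩ := Function.ne_iff.1 hz0
        rw [Pi.zero_apply] at hk
        have eA := E_real k z hk h.hA hz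
        have eD := E_real k z hk h.hD hDz
        have eC := E_quat k z hk h.hC c2
        refine StepC.of_cg (Pm k z) (Qm k) (PQ k z) eA eC eD (ih (by omega) (h.cg (Qm k)) ?_)
        by_contra hcon
        push Not at hcon
        obtain ⟨q1, q2⟩ := hcon
        have : ∀ {X : Matrix (Fin (m+1)) (Fin (m+1)) ℝ}, (Qm k * Pm k z)ᵀ * X * (Qm k * Pm k z) = X →
            (Qm k)ᵀ * X * Qm k = 0 → X = 0 := by
          intro X e e0
          rw [← e, transpose_mul]
          calc (Pm k z)ᵀ * (Qm k)ᵀ * X * (Qm k * Pm k z) = (Pm k z)ᵀ * ((Qm k)ᵀ * X * Qm k) * Pm k z := by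
                simp only [Matrix.mul_assoc]
            _ = 0 := by rw [e0, Matrix.mul_zero, Matrix.zero_mul]
        rcases hne with hne | hne
        · exact hne (this eA q1)
        · exact hne (this eD q2)
      · have key : ∀ {M : Matrix (Fin (m+1)) (Fin (m+1)) HQ}, M.IsSymm → M *ᵥ qv z = 0 → ∀ u v, InK A M D u v → rd (D *ᵥ z) v = 0 := by
          intro M hM hMz u v hI
          rw [← star_qv, ← rq_qv, rq_adj h.hD]
          have e := eq_neg_of_add_eq_zero_right hI.2
          rw [e, dotProduct_neg, ← adj hM, hMz, star_zero, zero_dotProduct, neg_zero]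
        refine ⟨D *ᵥ z, 0, 1, hDz, Or.inr one_ne_zero, fun u v hI => ?_, fun u v hI => ?_⟩
        · rw [key h.hC c2 u v hI]; simp
        · rw [key (cj_symm h.hC) c1 u v hI]; simp
    · obtain ⟨B, hB⟩ := psd_fac h.posA
      have hBd : IsUnit B.det := by
        rw [isUnit_iff_ne_zero]
        intro h0
        apply hdet
        rw [hB, det_mul, h0, mul_zero]
      have e1 : B * B⁻¹ = 1 := Matrix.mul_nonsing_inv _ hBd
      have e2 : B⁻¹ * B = 1 := Matrix.nonsing_inv_mul _ hBd
      have h1 := h.cg B⁻¹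
      have e3 : (B⁻¹)ᵀ * A * B⁻¹ = 1 := by
        calc (B⁻¹)ᵀ * A * B⁻¹ = (B * B⁻¹)ᵀ * (B * B⁻¹) := by rw [hB, transpose_mul]; simp only [Matrix.mul_assoc]
          _ = 1 := by rw [e1]; simp
      refine StepC.of_cg B B⁻¹ e1 (by rw [e2]; simp) (by rw [e2, cg_one]) (by rw [e2]; simp) ?_
      rw [e3] at h1 ⊢
      exact step_one (by omega) hm3 h1

end S7

set_option linter.all false

namespace S7

variable {n : ℕ}

/-- the rank one vector -/
noncomputable def zz (a : ℝ) (g : HQ) (x : Fin n → ℝ) : Fin n ⊕ Fin n → HQ :=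
  Sum.elim (fun i => ((a * x i : ℝ) : HQ)) (fun i => x i • star g)

/-- off-diagonal rank one block -/
noncomputable def og (r : ℝ) (g : HQ) (x : Fin n → ℝ) : Matrix (Fin n) (Fin n) HQ :=
  Matrix.of fun i j => (r * (x i * x j)) • g

inductive Sep : Matrix (Fin n) (Fin n) ℝ → Matrix (Fin n) (Fin n) HQ → Matrix (Fin n) (Fin n) ℝ → Prop
  | zero : Sep 0 0 0
  | add {A : Matrix (Fin n) (Fin n) ℝ} {C : Matrix (Fin n) (Fin n) HQ} {D : Matrix (Fin n) (Fin n) ℝ}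
      (ε a : ℝ) (g : HQ) (x : Fin n → ℝ) : 0 ≤ ε →
      Sep (A - (ε * a ^ 2) • vecMulVec x x) (C - og (ε * a) g x) (D - (ε * Quaternion.normSq g) • vecMulVec x x) →
      Sep A C D

lemma cj_og (C : Matrix (Fin n) (Fin n) HQ) (r : ℝ) (g : HQ) (x : Fin n → ℝ) :
    cj (C - og r g x) = cj C - og r (star g) x := by
  refine Matrix.ext fun i j => ?_
  simp [cj_apply, og, Quaternion.star_smul]

lemma Bm_sub (A : Matrix (Fin n) (Fin n) ℝ) (C : Matrix (Fin n) (Fin n) HQ) (D : Matrix (Fin n) (Fin n) ℝ)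
    (ε a : ℝ) (g : HQ) (x : Fin n → ℝ) :
    Bm (A - (ε * a ^ 2) • vecMulVec x x) (C - og (ε * a) g x) (D - (ε * Quaternion.normSq g) • vecMulVec x x) =
      Bm A C D - ε • vecMulVec (zz a g x) (star (zz a g x)) := by
  refine Matrix.ext fun i j => ?_
  rw [Matrix.sub_apply, Matrix.smul_apply, vecMulVec_apply, Pi.star_apply]
  unfold Bm
  rw [cj_og]
  rcases i with i | i <;> rcases j with j | j
  · simp only [fromBlocks_apply₁₁, rq_apply, zz, Sum.elim_inl, Quaternion.star_coe, Matrix.sub_apply, Matrix.smul_apply,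
      vecMulVec_apply, ← Quaternion.coe_mul, ← Quaternion.coe_smul, ← Quaternion.coe_sub, smul_eq_mul]
    congr 1; ring
  · simp only [fromBlocks_apply₁₂, zz, Sum.elim_inl, Sum.elim_inr, Matrix.sub_apply, og, of_apply, Quaternion.star_smul,
      star_star, Quaternion.coe_mul_eq_smul, smul_smul]
    congr 2; ring
  · simp only [fromBlocks_apply₂₁, zz, Sum.elim_inl, Sum.elim_inr, Matrix.sub_apply, og, of_apply, Quaternion.star_coe,
      Quaternion.mul_coe_eq_smul, smul_smul]
    congr 2; ring
  · simp only [fromBlocks_apply₂₂, rq_apply, zz, Sum.elim_inr, Matrix.sub_apply, Matrix.smul_apply,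
      vecMulVec_apply, Quaternion.star_smul, star_star, smul_mul_assoc, mul_smul_comm, Quaternion.star_mul_self,
      ← Quaternion.coe_smul, ← Quaternion.coe_sub, smul_eq_mul]
    congr 1; ring

lemma zz_dot (a : ℝ) (g : HQ) (x : Fin n → ℝ) (z : Fin n ⊕ Fin n → HQ) :
    star (zz a g x) ⬝ᵥ z = a • rd x (z ∘ Sum.inl) + g * rd x (z ∘ Sum.inr) := by
  simp only [dotProduct, Fintype.sum_sum_type, zz, Pi.star_apply, Sum.elim_inl, Sum.elim_inr, rd, Function.comp, Quaternion.star_coe,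
    Quaternion.star_smul, star_star, Finset.smul_sum, Finset.mul_sum, Quaternion.coe_mul_eq_smul, smul_smul, smul_mul_assoc, mul_smul_comm]

lemma zz_ne {a : ℝ} {g : HQ} {x : Fin n → ℝ} (hx : x ≠ 0) (h : a ≠ 0 ∨ g ≠ 0) : zz a g x ≠ 0 := by
  intro h0
  obtain ⟨i, hi⟩ := Function.ne_iff.1 hx
  rw [Pi.zero_apply] at hi
  rcases h with h | h
  · have : ((a * x i : ℝ) : HQ) = 0 := congrFun h0 (Sum.inl i)
    have : a * x i = 0 := congrArg (fun q : HQ => q.re) this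
    exact (mul_ne_zero h hi) this
  · have : x i • star g = 0 := congrFun h0 (Sum.inr i)
    rw [smul_eq_zero] at this
    rcases this with h' | h'
    · exact hi h'
    · exact h (by simpa using h')

lemma ker_mono {M : Matrix (Fin n ⊕ Fin n) (Fin n ⊕ Fin n) HQ} {z : Fin n ⊕ Fin n → HQ}
    (hk : ∀ u, M *ᵥ u = 0 → star z ⬝ᵥ u = 0) (ε : ℝ) :
    LinearMap.ker (rl M) ≤ LinearMap.ker (rl (M - ε • vecMulVec z (star z))) := by
  intro u hu
  rw [LinearMap.mem_ker, rl_apply] at hu ⊢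
  rw [sub_rank_one_mulVec, hu, hk u hu]
  simp

lemma ker_strict {M : Matrix (Fin n ⊕ Fin n) (Fin n ⊕ Fin n) HQ} {z : Fin n ⊕ Fin n → HQ}
    (hk : ∀ u, M *ᵥ u = 0 → star z ⬝ᵥ u = 0) {ε : ℝ} (ht : ∃ t, M *ᵥ t ≠ 0 ∧ (M - ε • vecMulVec z (star z)) *ᵥ t = 0) :
    Module.finrank ℝ (LinearMap.ker (rl M)) < Module.finrank ℝ (LinearMap.ker (rl (M - ε • vecMulVec z (star z)))) := by
  apply Submodule.finrank_lt_finrank_of_lt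
  refine lt_of_le_of_ne (ker_mono hk ε) ?_
  obtain ⟨t, h1, h2⟩ := ht
  intro e
  have : t ∈ LinearMap.ker (rl M) := by rw [e]; exact h2
  exact h1 this

noncomputable def kk (A : Matrix (Fin n) (Fin n) ℝ) (C : Matrix (Fin n) (Fin n) HQ) (D : Matrix (Fin n) (Fin n) ℝ) : ℕ :=
  Module.finrank ℝ (LinearMap.ker (rl (Bm A C D))) + Module.finrank ℝ (LinearMap.ker (rl (Bm A (cj C) D)))

lemma kk_le (A : Matrix (Fin n) (Fin n) ℝ) (C : Matrix (Fin n) (Fin n) HQ) (D : Matrix (Fin n) (Fin n) ℝ) :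
    kk A C D ≤ 2 * Module.finrank ℝ (Fin n ⊕ Fin n → HQ) := by
  have h1 := Submodule.finrank_le (LinearMap.ker (rl (Bm A C D)))
  have h2 := Submodule.finrank_le (LinearMap.ker (rl (Bm A (cj C) D)))
  unfold kk; omega

lemma peel_step (hn : n ≤ 3) {A : Matrix (Fin n) (Fin n) ℝ} {C : Matrix (Fin n) (Fin n) HQ} {D : Matrix (Fin n) (Fin n) ℝ}
    (h : PPT A C D) (hne : A ≠ 0 ∨ D ≠ 0) : ∃ (ε a : ℝ) (g : HQ) (x : Fin n → ℝ), 0 ≤ ε ∧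
      PPT (A - (ε * a ^ 2) • vecMulVec x x) (C - og (ε * a) g x) (D - (ε * Quaternion.normSq g) • vecMulVec x x) ∧
      kk A C D < kk (A - (ε * a ^ 2) • vecMulVec x x) (C - og (ε * a) g x) (D - (ε * Quaternion.normSq g) • vecMulVec x x) := by
  obtain ⟨x, a, g, hx, hag, h1, h2⟩ := step n hn h hne
  have k1 : ∀ u, Bm A C D *ᵥ u = 0 → star (zz a g x) ⬝ᵥ u = 0 := by
    intro u hu
    rw [zz_dot]; exact h1 _ _ ((Bm_ker _ _ _ _).1 hu)
  have k2 : ∀ u, Bm A (cj C) D *ᵥ u = 0 → star (zz a (star g) x) ⬝ᵥ u = 0 := by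
    intro u hu
    rw [zz_dot]; exact h2 _ _ ((Bm_ker _ _ _ _).1 hu)
  obtain ⟨e1, he1, p1, t1⟩ := peel h.psd (zz_ne hx hag) k1
  obtain ⟨e2, he2, p2, t2⟩ := peel h.swap.psd (zz_ne hx (g := star g) (by simpa using hag)) k2
  have hmin : 0 < min e1 e2 := lt_min he1 he2
  have s1 := fun ε => Bm_sub A C D ε a g x
  have s2 := fun ε => Bm_sub A (cj C) D ε a (star g) x
  simp only [Quaternion.normSq_star, ← cj_og] at s2
  refine ⟨min e1 e2, a, g, x, hmin.le, ?_, ?_⟩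
  · have q1 := p1 _ hmin.le (min_le_left _ _)
    have q2 := p2 _ hmin.le (min_le_right _ _)
    rw [← s1] at q1
    rw [← s2] at q2
    refine ⟨?_, ?_, ?_, fun u v => ?_, fun u v => ?_⟩
    · exact h.hA.sub ((vv_symm x).smul _)
    · refine h.hC.sub ?_
      refine Matrix.ext fun i j => ?_
      simp only [og, transpose_apply, of_apply, mul_comm (x i)]
    · exact h.hD.sub ((vv_symm x).smul _)
    · have := q1.2 (Sum.elim u v)
      rw [Bm_form] at this; exact this
    · have := q2.2 (Sum.elim u v)
      rw [Bm_form] at this; exact this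
  · unfold kk
    rw [s1, s2]
    have m1 := Submodule.finrank_mono (ker_mono k1 (min e1 e2))
    have m2 := Submodule.finrank_mono (ker_mono k2 (min e1 e2))
    rcases min_choice e1 e2 with e | e
    · have := ker_strict k1 t1
      rw [e] at m1 m2 ⊢; omega
    · have := ker_strict k2 t2
      rw [e] at m1 m2 ⊢; omega

lemma PPT.sep (hn : n ≤ 3) : ∀ (N : ℕ) {A : Matrix (Fin n) (Fin n) ℝ} {C : Matrix (Fin n) (Fin n) HQ} {D : Matrix (Fin n) (Fin n) ℝ},
    PPT A C D → 2 * Module.finrank ℝ (Fin n ⊕ Fin n → HQ) - kk A C D ≤ N → Sep A C D := by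
  intro N
  induction N with
  | zero =>
    intro A C D h hN
    by_cases hne : A ≠ 0 ∨ D ≠ 0
    · obtain ⟨ε, a, g, x, h0, hp, hk⟩ := peel_step hn h hne
      have := kk_le (A - (ε * a ^ 2) • vecMulVec x x) (C - og (ε * a) g x) (D - (ε * Quaternion.normSq g) • vecMulVec x x)
      omega
    · push Not at hne
      obtain ⟨rfl, rfl⟩ := hne
      have : C = 0 := by
        refine mulVec_all_zero fun i => ?_
        have := (h.swap.ker (u := Pi.single i 1) (v := 0) (by simp [fm, rq_zero]; rfl)).2
        rwa [cj_cj, mulVec_zero, add_zero] at this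
      rw [this]; exact Sep.zero
  | succ N ih =>
    intro A C D h hN
    by_cases hne : A ≠ 0 ∨ D ≠ 0
    · obtain ⟨ε, a, g, x, h0, hp, hk⟩ := peel_step hn h hne
      exact Sep.add ε a g x h0 (ih hp (by omega))
    · push Not at hne
      obtain ⟨rfl, rfl⟩ := hne
      have : C = 0 := by
        refine mulVec_all_zero fun i => ?_
        have := (h.swap.ker (u := Pi.single i 1) (v := 0) (by simp [fm, rq_zero]; rfl)).2
        rwa [cj_cj, mulVec_zero, add_zero] at this
      rw [this]; exact Sep.zero

end S7

set_option linter.all false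

namespace S7

lemma form_prod (B : Matrix (Fin 2 × Fin 3) (Fin 2 × Fin 3) HQ) (A D : Matrix (Fin 3) (Fin 3) ℝ) (C : Matrix (Fin 3) (Fin 3) HQ)
    (h00 : ∀ i j, B (0, i) (0, j) = rq A i j) (h01 : ∀ i j, B (0, i) (1, j) = C i j)
    (h10 : ∀ i j, B (1, i) (0, j) = cj C i j) (h11 : ∀ i j, B (1, i) (1, j) = rq D i j)
    (h : ∀ x : Fin 2 × Fin 3 → HQ, 0 ≤ (star x ⬝ᵥ B *ᵥ x).re) (u v : Fin 3 → HQ) : 0 ≤ fm A C D u v := by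
  have h1 := h (fun p => ![u, v] p.1 p.2)
  have h2 := Bm_form A C D (Sum.elim u v)
  rw [Sum.elim_comp_inl, Sum.elim_comp_inr] at h2
  rw [← h2]
  convert h1 using 2
  simp only [dotProduct, mulVec, Fintype.sum_prod_type, Fintype.sum_sum_type, Fin.sum_univ_two, Pi.star_apply,
    h00, h01, h10, h11, Sum.elim_inl, Sum.elim_inr, Bm, fromBlocks_apply₁₁, fromBlocks_apply₁₂, fromBlocks_apply₂₁,
    fromBlocks_apply₂₂, Matrix.cons_val_zero, Matrix.cons_val_one]

/-- the rank one quaternionic factor -/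
noncomputable def qa (ε a : ℝ) (g : HQ) : Matrix (Fin 2) (Fin 2) HQ :=
  !![((ε * a ^ 2 : ℝ) : HQ), (ε * a) • g; (ε * a) • star g, ((ε * Quaternion.normSq g : ℝ) : HQ)]

lemma qa_psd (ε a : ℝ) (g : HQ) (hε : 0 ≤ ε) : QuatPSD (qa ε a g) := by
  constructor
  · refine Matrix.ext fun i j => ?_
    fin_cases i <;> fin_cases j <;> simp [-Quaternion.coe_mul, -Quaternion.coe_pow, -Quaternion.coe_add, qa, Matrix.conjTranspose_apply, Quaternion.star_smul]
  · intro x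
    have : (star x ⬝ᵥ qa ε a g *ᵥ x).re = ε * Quaternion.normSq (a • x 0 + g * x 1) := by
      simp [-Quaternion.coe_mul, -Quaternion.coe_pow, -Quaternion.coe_add, dotProduct, mulVec, Fin.sum_univ_two, qa, Quaternion.normSq_def', Quaternion.re_mul, Quaternion.imI_mul,
        Quaternion.imJ_mul, Quaternion.imK_mul]
      ring
    rw [this]
    exact mul_nonneg hε Quaternion.normSq_nonneg

lemma Sep.decomp {A : Matrix (Fin 3) (Fin 3) ℝ} {C : Matrix (Fin 3) (Fin 3) HQ} {D : Matrix (Fin 3) (Fin 3) ℝ}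
    (h : Sep A C D) : ∃ (N : ℕ) (P : Fin N → Matrix (Fin 2) (Fin 2) HQ) (S : Fin N → Matrix (Fin 3) (Fin 3) ℝ),
      (∀ l, QuatPSD (P l)) ∧ (∀ l, (S l).PosSemidef) ∧ ∀ i j,
      (rq A i j = ∑ l, P l 0 0 * (S l i j : HQ)) ∧ (C i j = ∑ l, P l 0 1 * (S l i j : HQ)) ∧
      (cj C i j = ∑ l, P l 1 0 * (S l i j : HQ)) ∧ (rq D i j = ∑ l, P l 1 1 * (S l i j : HQ)) := by
  induction h with
  | zero => exact ⟨0, fun _ => 0, fun _ => 0, fun l => l.elim0, fun l => l.elim0, fun i j => by simp [rq_apply, cj_apply]⟩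
  | @add A C D ε a g x hε _ ih =>
    obtain ⟨N, P, S, hP, hS, hE⟩ := ih
    refine ⟨N + 1, Fin.cons (qa ε a g) P, Fin.cons (vecMulVec x x) S, ?_, ?_, fun i j => ?_⟩
    · intro l; refine Fin.cases ?_ (fun l => ?_) l
      · exact qa_psd ε a g hε
      · exact hP l
    · intro l; refine Fin.cases ?_ (fun l => ?_) l
      · have := posSemidef_vecMulVec_self_star x
        rw [star_trivial] at this
        exact this
      · exact hS l
    · obtain ⟨e1, e2, e3, e4⟩ := hE i j
      simp only [Fin.sum_univ_succ, Fin.cons_zero, Fin.cons_succ, ← e1, ← e2, ← e3, ← e4, cj_og]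
      simp only [rq_apply, Matrix.sub_apply, Matrix.smul_apply, vecMulVec_apply, og, of_apply, qa, Matrix.cons_val', Matrix.cons_val_zero,
        Matrix.cons_val_one, Matrix.cons_val_fin_one, Quaternion.mul_coe_eq_smul, smul_eq_mul]
      refine ⟨?_, ?_, ?_, ?_⟩
      · rw [← Quaternion.coe_smul, ← Quaternion.coe_add]; congr 1; simp only [smul_eq_mul]; ring
      · rw [smul_smul, mul_comm (x i * x j)]; abel
      · rw [smul_smul, mul_comm (x i * x j)]; abel
      · rw [← Quaternion.coe_smul, ← Quaternion.coe_add]; congr 1; simp only [smul_eq_mul]; ring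

end S7

/-- A quaternionic hermitian `6 × 6` matrix in `Q(2) ⊗ S(3)`
(blocks `[[B11, B12], [conj B12, B22]]` with `B11, B22` real symmetric and `B12`
symmetric) which is PPT (both it and its entrywise quaternionic conjugate are PSD)
is `Q₊(2) ⊗ S₊(3)`-separable. -/
theorem stmt_7
    (B : Matrix (Fin 2 × Fin 3) (Fin 2 × Fin 3) (Quaternion ℝ))
    (B11 B22 : Matrix (Fin 3) (Fin 3) ℝ)
    (B12 : Matrix (Fin 3) (Fin 3) (Quaternion ℝ))
    (h11 : B11.IsSymm) (h22 : B22.IsSymm) (h12 : B12.IsSymm)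
    (hblock : ∀ (a b : Fin 2) (i j : Fin 3),
      B (a, i) (b, j) =
        ![![B11.map (algebraMap ℝ (Quaternion ℝ)), B12],
          ![B12.map (star : Quaternion ℝ → Quaternion ℝ),
            B22.map (algebraMap ℝ (Quaternion ℝ))]] a b i j)
    (hpsd : QuatPSD B)
    (hpsdc : QuatPSD (B.map (star : Quaternion ℝ → Quaternion ℝ))) :
    ∃ (N : ℕ) (A : Fin N → Matrix (Fin 2) (Fin 2) (Quaternion ℝ))
      (S : Fin N → Matrix (Fin 3) (Fin 3) ℝ),
      (∀ l, QuatPSD (A l)) ∧ (∀ l, (S l).PosSemidef) ∧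
      B = ∑ l, A l ⊗ₖ (S l).map (algebraMap ℝ (Quaternion ℝ)) := by
  have hp : S7.PPT B11 B12 B22 := by
    refine ⟨h11, h12, h22, ?_, ?_⟩
    · refine S7.form_prod B B11 B22 B12 (fun i j => ?_) (fun i j => ?_) (fun i j => ?_) (fun i j => ?_) hpsd.2
      all_goals rw [hblock]; rfl
    · refine S7.form_prod (B.map star) B11 B22 (S7.cj B12) (fun i j => ?_) (fun i j => ?_) (fun i j => ?_) (fun i j => ?_) hpsdc.2
      · rw [Matrix.map_apply, hblock]; exact Quaternion.star_coe _
      · rw [Matrix.map_apply, hblock]; rfl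
      · rw [Matrix.map_apply, hblock]; rfl
      · rw [Matrix.map_apply, hblock]; exact Quaternion.star_coe _
  obtain ⟨N, P, S, hP, hS, hE⟩ := (S7.PPT.sep (by norm_num) _ hp le_rfl).decomp
  refine ⟨N, P, S, hP, hS, ?_⟩
  refine Matrix.ext fun p q => ?_
  obtain ⟨a, i⟩ := p
  obtain ⟨b, j⟩ := q
  obtain ⟨e1, e2, e3, e4⟩ := hE i j
  rw [hblock, Matrix.sum_apply]
  fin_cases a <;> fin_cases b
  · exact e1
  · exact e2
  · exact e3
  · exact e4
end

section
/- There exists a complex hermitian 8×8 matrix B, partitioned into four 4×4 blocks B = [[B11, B12], [B̄12, B22]] with B11, B22 real symmetric 4×4 matrices and B12 a symmetric (B12ᵀ = B12) complex 4×4 matrix, such that B is positive semidefinite but B is NOT H_+(2)⊗S_+(4)-separable, i.e. B cannot be written as a finite sum Σ_{l=1}^N A_l ⊗ S_l (Kronecker product) with positive semidefinite complex hermitian 2×2 matrices A_l and positive semidefinite real symmetric 4×4 matrices S_l. -/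
open Matrix Kronecker
open scoped ComplexOrder

/-- The generating factor `V`. -/
def V8 : Matrix (Fin 2 × Fin 4) (Fin 5) ℂ := fun p k =>
  (![!![1, 0, 0, 0, 0; 0, 1, 0, 0, 0; 0, 0, 1, 0, 0; 0, 0, 0, 1, 0],
     !![-1 - Complex.I, 2 * Complex.I, Complex.I, 0, 1;
        2 * Complex.I, 1 + Complex.I, -1 + 2 * Complex.I, -2 * Complex.I, 3 * Complex.I;
        Complex.I, -1 + 2 * Complex.I, 1 + Complex.I, 2 * Complex.I, 0;
        0, -2 * Complex.I, 2 * Complex.I, 2 - Complex.I, 0]] :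
      Fin 2 → Matrix (Fin 4) (Fin 5) ℂ) p.1 p.2 k

/-- Kernel vectors. -/
def K8 : Fin 3 → Fin 2 × Fin 4 → ℂ := fun k p =>
  (![![![3 + 5 * Complex.I, -7 + Complex.I, -2 + 2 * Complex.I, -2 * Complex.I],
       ![3 * Complex.I, 1, 0, 0]],
     ![![Complex.I, 1 + 2 * Complex.I, -1 + Complex.I, 2 * Complex.I], ![0, 0, 1, 0]],
     ![![0, -2 * Complex.I, 2 * Complex.I, -2 - Complex.I], ![0, 0, 0, 1]]] :
      Fin 3 → Fin 2 → Fin 4 → ℂ) k p.1 p.2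

theorem core_real (p q a b c d : ℝ)
    (h1r : 3 * a - 7 * b - 2 * c + (-3 * q * a + p * b) = 0)
    (h1i : 5 * a + b + 2 * c - 2 * d + (3 * p * a + q * b) = 0)
    (h2r : b - c + p * c = 0)
    (h2i : a + 2 * b + c + 2 * d + q * c = 0)
    (h3r : -2 * d + p * d = 0)
    (h3i : -2 * b + 2 * c - d + q * d = 0) : a = 0 ∧ b = 0 ∧ c = 0 ∧ d = 0 := by
  have h : d = 0 ∨ p = 2 := by
    rcases mul_eq_zero.1 (show d * (p - 2) = 0 by linarith) with h | h
    · exact Or.inl h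
    · exact Or.inr (by linarith)
  rcases h with rfl | rfl
  · have hb : b = c := by linarith
    subst hb
    rcases mul_eq_zero.1 (show p * b = 0 by linarith) with rfl | rfl
    · have ha : a = 0 := by linarith
      subst ha
      have : b = 0 := by linarith
      simp [this]
    · have ha : a = 0 := by linarith
      simp [ha]
  · have hb : b = -c := by linarith
    subst hb
    have ha : a = 0 := by linarith
    subst ha
    have hc : c = 0 := by linarith
    subst hc
    have hd : d = 0 := by linarith
    simp [hd]

theorem core_complex (x y : ℂ) (s : Fin 4 → ℝ)
    (h : ∀ k, x * (∑ j, K8 k (0, j) * (s j : ℂ)) + y * (∑ j, K8 k (1, j) * (s j : ℂ)) = 0) :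
    (x = 0 ∧ y = 0) ∨ s = 0 := by
  have h1 := h 0
  have h2 := h 1
  have h3 := h 2
  simp [K8, Fin.sum_univ_four] at h1 h2 h3
  by_cases hx : x = 0
  · subst hx
    by_cases hy : y = 0
    · exact Or.inl ⟨rfl, hy⟩
    right
    simp [hy] at h1 h2 h3
    have hr := congrArg Complex.re h1
    have hi := congrArg Complex.im h1
    simp at hr hi
    funext j
    fin_cases j <;> simp [hr, hi, h2, h3]
  · right
    obtain ⟨z, rfl⟩ : ∃ z, y = x * z := ⟨y / x, by field_simp⟩
    simp only [mul_assoc, ← mul_add, mul_eq_zero, hx, false_or] at h1 h2 h3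
    have e1r := congrArg Complex.re h1
    have e1i := congrArg Complex.im h1
    have e2r := congrArg Complex.re h2
    have e2i := congrArg Complex.im h2
    have e3r := congrArg Complex.re h3
    have e3i := congrArg Complex.im h3
    simp at e1r e1i e2r e2i e3r e3i
    obtain ⟨ha, hb, hc, hd⟩ := core_real z.re z.im (s 0) (s 1) (s 2) (s 3) (by linarith)
      (by linarith) (by linarith) (by linarith) (by linarith) (by linarith)
    funext j
    fin_cases j <;> simp [ha, hb, hc, hd]

theorem V8_ker (k : Fin 3) : V8ᴴ *ᵥ K8 k = 0 := by
  funext j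
  fin_cases k <;> fin_cases j <;>
    simp [V8, K8, Matrix.mulVec, dotProduct, Fintype.sum_prod_type, Fin.sum_univ_four,
      Complex.ext_iff] <;> norm_num

open scoped MatrixOrder in
theorem sq_factor (S : Matrix (Fin 4) (Fin 4) ℝ) (h : S.PosSemidef) :
    ∃ b : Matrix (Fin 4) (Fin 4) ℝ, S = bᴴ * b := by
  obtain ⟨b, hb⟩ := CStarAlgebra.nonneg_iff_eq_star_mul_self.mp h.nonneg
  exact ⟨b, hb⟩

theorem map_psd (S : Matrix (Fin 4) (Fin 4) ℝ) (h : S.PosSemidef) :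
    (S.map Complex.ofReal).PosSemidef := by
  obtain ⟨b, rfl⟩ := sq_factor S h
  have : (bᴴ * b).map Complex.ofReal = (b.map Complex.ofReal)ᴴ * b.map Complex.ofReal := by
    ext i j
    simp [Matrix.mul_apply]
  rw [this]
  exact posSemidef_conjTranspose_mul_self _

theorem stmt_8 :
    ∃ (B : Matrix (Fin 2 × Fin 4) (Fin 2 × Fin 4) ℂ)
      (B11 B22 : Matrix (Fin 4) (Fin 4) ℝ) (B12 : Matrix (Fin 4) (Fin 4) ℂ),
      B11.IsSymm ∧ B22.IsSymm ∧ B12.IsSymm ∧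
      (∀ (a b : Fin 2) (i j : Fin 4),
        B (a, i) (b, j) =
          ![![B11.map Complex.ofReal, B12],
            ![B12.map (starRingEnd ℂ), B22.map Complex.ofReal]] a b i j) ∧
      B.PosSemidef ∧
      ¬ ∃ (N : ℕ) (A : Fin N → Matrix (Fin 2) (Fin 2) ℂ)
          (S : Fin N → Matrix (Fin 4) (Fin 4) ℝ),
          (∀ l, (A l).PosSemidef) ∧ (∀ l, (S l).PosSemidef) ∧
          B = ∑ l, A l ⊗ₖ (S l).map Complex.ofReal := by
  refine ⟨V8 * V8ᴴ, 1, !![8, 2, 4, -2; 2, 24, 0, 4; 4, 0, 12, -4; -2, 4, -4, 13],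
    !![-1 + Complex.I, -2 * Complex.I, -Complex.I, 0;
        -2 * Complex.I, 1 - Complex.I, -1 - 2 * Complex.I, 2 * Complex.I;
        -Complex.I, -1 - 2 * Complex.I, 1 - Complex.I, -2 * Complex.I;
        0, 2 * Complex.I, -2 * Complex.I, 2 + Complex.I],
    Matrix.isSymm_one, ?_, ?_, ?_, posSemidef_self_mul_conjTranspose V8, ?_⟩
  · ext i j
    fin_cases i <;> fin_cases j <;> rfl
  · ext i j
    fin_cases i <;> fin_cases j <;> rfl
  · intro a b i j
    fin_cases a <;> fin_cases b <;> fin_cases i <;> fin_cases j <;>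
    simp [V8, Matrix.mul_apply, Fin.sum_univ_five, Complex.ext_iff] <;> norm_num
  · rintro ⟨N, A, S, hA, hS, hB⟩
    have hP : ∀ l, (A l ⊗ₖ (S l).map Complex.ofReal).PosSemidef := fun l =>
      (hA l).kronecker (map_psd _ (hS l))
    have hz : ∀ l k, (A l ⊗ₖ (S l).map Complex.ofReal) *ᵥ K8 k = 0 := by
      intro l k
      rw [← (hP l).dotProduct_mulVec_zero_iff]
      have h0 : star (K8 k) ⬝ᵥ ((∑ l, A l ⊗ₖ (S l).map Complex.ofReal) *ᵥ K8 k) = 0 := by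
        rw [← hB, ← Matrix.mulVec_mulVec, V8_ker]
        simp
      rw [Matrix.sum_mulVec, dotProduct_sum] at h0
      exact (Finset.sum_eq_zero_iff_of_nonneg
        (fun l _ => (hP l).dotProduct_mulVec_nonneg (K8 k))).1 h0 l (Finset.mem_univ l)
    have h0 : ∀ l, A l ⊗ₖ (S l).map Complex.ofReal = 0 := by
      intro l
      ext ⟨a, i⟩ ⟨b, j⟩
      have := core_complex (A l a 0) (A l a 1) (S l i) (fun k => by
        have := congrFun (hz l k) (a, i)
        simp only [Matrix.mulVec, dotProduct, Fintype.sum_prod_type, Fin.sum_univ_two,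
          kroneckerMap_apply, Matrix.map_apply, Pi.zero_apply] at this
        rw [← this, Finset.mul_sum, Finset.mul_sum]
        congr 1 <;> exact Finset.sum_congr rfl fun j _ => by ring)
      rcases this with ⟨h, h'⟩ | h
      · fin_cases b <;> simp [h, h']
      · simp [h]
    have := congrFun (congrFun hB (0, 0)) (0, 0)
    simp [h0] at this
    simp [V8, Matrix.mul_apply, Fin.sum_univ_five] at this
end

section
/- Let n be a positive integer and let B be a quaternionic hermitian 2n×2n matrix partitioned into four n×n blocks B = [[B11, B12], [B12, B22]], where B11, B12, B22 are quaternionic hermitian n×n matrices (so B lies in the tensor product space S(2)⊗Q(n)). If B is positive semidefinite, then B is S_+(2)⊗Q_+(n)-separable, i.e. B = Σ_{l=1}^N a_l ⊗ C_l (Kronecker product of a real matrix with a quaternionic matrix) for some finite N, positive semidefinite real symmetric 2×2 matrices a_l and positive semidefinite quaternionic hermitian n×n matrices C_l. -/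
open Matrix Kronecker

abbrev QV (ι : Type*) [Fintype ι] := PiLp 2 (fun _ : ι => Quaternion ℝ)

noncomputable def qT {ι : Type*} [Fintype ι] (A : Matrix ι ι (Quaternion ℝ)) :
    QV ι →ₗ[ℝ] QV ι where
  toFun x := WithLp.toLp 2 (A *ᵥ (WithLp.ofLp x))
  map_add' x y := by simp [Matrix.mulVec_add]
  map_smul' c x := by simp [Matrix.mulVec_smul]

theorem q_inner {ι : Type*} [Fintype ι] (x y : ι → Quaternion ℝ) :
    inner ℝ (WithLp.toLp 2 x : QV ι) (WithLp.toLp 2 y) = (star x ⬝ᵥ y).re := by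
  rw [PiLp.inner_apply]
  have : (star x ⬝ᵥ y).re = ∑ i, (star (x i) * y i).re := by
    simp only [dotProduct, Pi.star_apply]
    exact map_sum (QuaternionAlgebra.reₗ (R := ℝ) (-1) 0 (-1)) _ _
  rw [this]
  refine Finset.sum_congr rfl fun i _ => ?_
  simp [Quaternion.inner_def]
  try ring

theorem q_herm {ι : Type*} [Fintype ι] {A : Matrix ι ι (Quaternion ℝ)} (hA : A.IsHermitian)
    (x y : ι → Quaternion ℝ) : star (A *ᵥ x) ⬝ᵥ y = star x ⬝ᵥ A *ᵥ y := by
  rw [Matrix.star_mulVec, hA.eq, Matrix.dotProduct_mulVec]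

theorem qT_symm {ι : Type*} [Fintype ι] {A : Matrix ι ι (Quaternion ℝ)} (hA : A.IsHermitian) :
    (qT A).IsSymmetric := by
  intro x y
  have := q_herm hA x.ofLp y.ofLp
  change inner ℝ (WithLp.toLp 2 (A *ᵥ x.ofLp) : QV ι) (WithLp.toLp 2 y.ofLp)
    = inner ℝ (WithLp.toLp 2 x.ofLp : QV ι) (WithLp.toLp 2 (A *ᵥ y.ofLp))
  rw [q_inner, q_inner, this]

section abs
variable {E : Type*} [NormedAddCommGroup E] [InnerProductSpace ℝ E]

theorem psd_ker (M : E →ₗ[ℝ] E) (hM : M.IsSymmetric) (hp : ∀ x, 0 ≤ inner ℝ x (M x))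
    (x : E) (hx : inner ℝ x (M x) = 0) : M x = 0 := by
  have key : ∀ t : ℝ, 0 ≤ inner ℝ (M x) (M (M x)) * (t * t) + 2 * inner ℝ (M x) (M x) * t + 0 := by
    intro t
    have h := hp (x + t • M x)
    have h2 : inner ℝ x (M (M x)) = inner ℝ (M x) (M x) := (hM x (M x)).symm
    simp only [map_add, map_smul, inner_add_left, inner_add_right, inner_smul_left,
      inner_smul_right, hx, h2] at h
    simp at h ⊢
    linarith
  have := discrim_le_zero key
  unfold discrim at this
  have h0 : inner ℝ (M x) (M x) = 0 := by nlinarith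
  exact inner_self_eq_zero.mp h0

theorem gen_eig [FiniteDimensional ℝ E] (P Q : E →ₗ[ℝ] E) (hP : P.IsSymmetric)
    (hQ : Q.IsSymmetric) (hp : ∀ x, 0 ≤ inner ℝ x (P x)) (hk : ∀ x, P x = 0 → Q x = 0)
    (h0 : P ≠ 0) : ∃ (l : ℝ) (x : E), Q x = l • P x ∧ P x ≠ 0 := by
  set W := (LinearMap.ker P)ᗮ with hW
  have hne : ∀ w ∈ W, P w = 0 → w = 0 := by
    intro w hw h
    have := (Submodule.mem_orthogonal _ _).1 hw w (by simpa using h)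
    exact inner_self_eq_zero.mp this
  have hpos : ∀ w ∈ W, w ≠ 0 → 0 < inner ℝ w (P w) := by
    intro w hw h
    refine lt_of_le_of_ne (hp w) fun h' => h (hne w hw (psd_ker P hP hp w h'.symm))
  have hdec : ∀ y : E, ∃ w ∈ W, P y = P w ∧ Q y = Q w ∧ ∃ k, P k = 0 ∧ y = k + w := by
    intro y
    obtain ⟨k, hk', w, hw, e⟩ := Submodule.exists_add_mem_mem_orthogonal (K := LinearMap.ker P) y
    have hk' : P k = 0 := hk'
    refine ⟨w, hw, ?_, ?_, k, hk', e⟩ <;> simp [e, hk', hk k hk']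
  have hnt : ∃ w ∈ W, w ≠ 0 := by
    by_contra! hc
    apply h0
    ext y
    obtain ⟨w, hw, h, -⟩ := hdec y
    simp [h, hc w hw]
  obtain ⟨w0, hw0, hw0'⟩ := hnt
  let f : W → ℝ := fun w => inner ℝ (w : E) (Q w) / inner ℝ (w : E) (P w)
  have cP : Continuous P := P.continuous_of_finiteDimensional
  have cQ : Continuous Q := Q.continuous_of_finiteDimensional
  have hf : ContinuousOn f (Metric.sphere (0 : W) 1) := by
    apply ContinuousOn.div
    · fun_prop
    · fun_prop
    · intro w hw
      refine (hpos w w.2 ?_).ne'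
      rintro h
      have : w = 0 := by ext; exact h
      simp [this] at hw
  have : Nontrivial W := ⟨⟨⟨w0, hw0⟩, 0, fun h => hw0' (congrArg Subtype.val h)⟩⟩
  obtain ⟨x, hx, hmax⟩ := (isCompact_sphere (0 : W) 1).exists_isMaxOn
    (NormedSpace.sphere_nonempty.2 zero_le_one) hf
  have hx0 : (x : E) ≠ 0 := by
    intro h
    have : x = 0 := by ext; exact h
    simp [this] at hx
  have hxp := hpos x x.2 hx0
  refine ⟨f x, x, ?_, fun h => hx0 (hne x x.2 h)⟩
  have hWle : ∀ w ∈ W, inner ℝ w (Q w) ≤ f x * inner ℝ w (P w) := by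
    intro w hw
    by_cases h : w = 0
    · simp [h]
    have hn : ‖w‖ ≠ 0 := norm_ne_zero_iff.2 h
    have hm := hmax (a := ‖w‖⁻¹ • (⟨w, hw⟩ : W)) (by simp [norm_smul, hn])
    have e : f (‖w‖⁻¹ • (⟨w, hw⟩ : W)) = inner ℝ w (Q w) / inner ℝ w (P w) := by
      have := (hpos w hw h).ne'
      simp only [f, Submodule.coe_smul, map_smul, inner_smul_left, inner_smul_right]
      simp
      field_simp
    simp only [Set.mem_ofPred_eq, e] at hm
    rwa [div_le_iff₀ (hpos w hw h)] at hm
  have hM : (f x • P - Q).IsSymmetric := by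
    intro a b
    simp [inner_sub_left, inner_sub_right, inner_smul_left, inner_smul_right, hP a b, hQ a b]
  have := psd_ker (f x • P - Q) hM (by
    intro y
    obtain ⟨w, hw, h1, h2, k, hk0, e⟩ := hdec y
    have a1 : inner ℝ k (P w) = 0 := by rw [← hP k w, hk0]; simp
    have a2 : inner ℝ k (Q w) = 0 := by rw [← hQ k w, hk k hk0]; simp
    have := hWle w hw
    simp only [LinearMap.sub_apply, LinearMap.smul_apply, h1, h2]
    rw [e]
    simp only [inner_sub_right, inner_smul_right, inner_add_left, a1, a2]
    linarith) x (by
    simp only [LinearMap.sub_apply, LinearMap.smul_apply, inner_sub_right, inner_smul_right]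
    simp only [f]
    field_simp
    simp)
  simp only [LinearMap.sub_apply, LinearMap.smul_apply] at this
  exact (sub_eq_zero.1 this).symm

end abs

theorem qT_nonneg {ι : Type*} [Fintype ι] {A : Matrix ι ι (Quaternion ℝ)} (hA : QuatPSD A)
    (x : QV ι) : 0 ≤ inner ℝ x (qT A x) := by
  have := hA.2 x.ofLp
  rwa [← q_inner] at this

theorem q_psd_ker {ι : Type*} [Fintype ι] {A : Matrix ι ι (Quaternion ℝ)} (hA : QuatPSD A)
    (x : ι → Quaternion ℝ) (hx : (star x ⬝ᵥ A *ᵥ x).re = 0) : A *ᵥ x = 0 := by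
  rw [← q_inner] at hx
  have := psd_ker (qT A) (qT_symm hA.1) (qT_nonneg hA) (WithLp.toLp 2 x) hx
  exact congrArg WithLp.ofLp this

theorem q_mulVec_right {ι : Type*} [Fintype ι] (A : Matrix ι ι (Quaternion ℝ))
    (x : ι → Quaternion ℝ) (c : Quaternion ℝ) :
    A *ᵥ (fun i => x i * c) = fun i => (A *ᵥ x) i * c := by
  ext1 i
  simp [Matrix.mulVec, dotProduct, Finset.sum_mul, mul_assoc]

theorem q_dot_right {ι : Type*} [Fintype ι] 
    (x y : ι → Quaternion ℝ) (c : Quaternion ℝ) :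
    x ⬝ᵥ (fun i => y i * c) = (x ⬝ᵥ y) * c := by
  simp [dotProduct, Finset.sum_mul, mul_assoc]

theorem q_dot_left {ι : Type*} [Fintype ι] 
    (x y : ι → Quaternion ℝ) (c : Quaternion ℝ) :
    star (fun i => x i * c) ⬝ᵥ y = star c * (star x ⬝ᵥ y) := by
  simp [dotProduct, Finset.mul_sum, mul_assoc]

theorem q_star_dot {ι : Type*} [Fintype ι] (x y : ι → Quaternion ℝ) :
    star (star x ⬝ᵥ y) = star y ⬝ᵥ x := by
  simp [dotProduct]

theorem q_vmv {ι : Type*} [Fintype ι] (u x : ι → Quaternion ℝ) :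
    Matrix.vecMulVec u (star u) *ᵥ x = fun i => u i * (star u ⬝ᵥ x) := by
  ext1 i
  simp [Matrix.mulVec, dotProduct, Matrix.vecMulVec_apply, Finset.mul_sum, mul_assoc]

theorem q_real {ι : Type*} [Fintype ι] {A : Matrix ι ι (Quaternion ℝ)} (hA : A.IsHermitian)
    (x : ι → Quaternion ℝ) : star x ⬝ᵥ A *ᵥ x = (((star x ⬝ᵥ A *ᵥ x).re : ℝ) : Quaternion ℝ) := by
  have : star (star x ⬝ᵥ A *ᵥ x) = star x ⬝ᵥ A *ᵥ x := by
    rw [q_star_dot, q_herm hA]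
  exact Quaternion.star_eq_self.1 this

theorem vmv_herm {ι : Type*} [Fintype ι] (u : ι → Quaternion ℝ) (r : ℝ) :
    (r • Matrix.vecMulVec u (star u)).IsHermitian := by
  ext1 i j
  simp [Matrix.vecMulVec_apply, Matrix.conjTranspose_apply]

theorem q_re_smul {ι : Type*} [Fintype ι] (u x : ι → Quaternion ℝ) (r : ℝ) :
    (star x ⬝ᵥ (r • Matrix.vecMulVec u (star u)) *ᵥ x).re
      = r * Quaternion.normSq (star u ⬝ᵥ x) := by
  rw [Matrix.smul_mulVec, dotProduct_smul, q_vmv, q_dot_right, ← q_star_dot u x,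
    Quaternion.star_mul_self]
  simp

theorem vmv_psd {ι : Type*} [Fintype ι] (u : ι → Quaternion ℝ) (r : ℝ) (hr : 0 ≤ r) :
    QuatPSD (r • Matrix.vecMulVec u (star u)) := by
  refine ⟨vmv_herm u r, fun x => ?_⟩
  rw [q_re_smul]
  exact mul_nonneg hr Quaternion.normSq_nonneg

theorem q_sub_psd {ι : Type*} [Fintype ι] {A : Matrix ι ι (Quaternion ℝ)} (hA : QuatPSD A)
    (z : ι → Quaternion ℝ) (p : ℝ) (hp : p = (star z ⬝ᵥ A *ᵥ z).re) (h0 : p ≠ 0) :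
    QuatPSD (A - p⁻¹ • Matrix.vecMulVec (A *ᵥ z) (star (A *ᵥ z))) := by
  refine ⟨hA.1.sub (vmv_herm _ _), fun w => ?_⟩
  set d := star (A *ᵥ z) ⬝ᵥ w with hd
  have hd' : d = star z ⬝ᵥ A *ᵥ w := q_herm hA.1 z w
  have hz : star z ⬝ᵥ A *ᵥ z = (p : Quaternion ℝ) := by rw [hp]; exact q_real hA.1 z
  set c : Quaternion ℝ := p⁻¹ • d with hc
  have h := hA.2 (w - fun i => z i * c)
  have hsd : star w ⬝ᵥ A *ᵥ z = star d := by
    rw [hd, q_star_dot]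
  rw [Matrix.mulVec_sub, star_sub, sub_dotProduct, dotProduct_sub, dotProduct_sub, q_mulVec_right,
    q_dot_left, q_dot_left, q_dot_right, q_dot_right, ← hd', hz, hsd] at h
  rw [Matrix.sub_mulVec, dotProduct_sub, Quaternion.re_sub, q_re_smul, ← hd]
  have e1 : star d * c = ((p⁻¹ * Quaternion.normSq d : ℝ) : Quaternion ℝ) := by
    rw [hc, mul_smul_comm, Quaternion.star_mul_self, ← Quaternion.coe_mul_eq_smul, ← Quaternion.coe_mul]
  have e2 : star c * d = ((p⁻¹ * Quaternion.normSq d : ℝ) : Quaternion ℝ) := by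
    rw [hc, Quaternion.star_smul, smul_mul_assoc, Quaternion.star_mul_self, ← Quaternion.coe_mul_eq_smul, ← Quaternion.coe_mul]
  have e3 : star c * ((p : Quaternion ℝ) * c) = ((p⁻¹ * Quaternion.normSq d : ℝ) : Quaternion ℝ) := by
    have : (p : Quaternion ℝ) * c = d := by
      rw [hc, Quaternion.coe_mul_eq_smul, smul_smul, mul_inv_cancel₀ h0, one_smul]
    rw [this, e2]
  rw [e1, e2, e3] at h
  simpa only [Quaternion.re_sub, Quaternion.re_coe, sub_self, sub_zero] using h

def blk {n : ℕ} (P Q R : Matrix (Fin n) (Fin n) (Quaternion ℝ)) :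
    Matrix (Fin 2 × Fin n) (Fin 2 × Fin n) (Quaternion ℝ) :=
  fun a b => ![![P, Q], ![Q, R]] a.1 b.1 a.2 b.2

def QSep {n : ℕ} (B : Matrix (Fin 2 × Fin n) (Fin 2 × Fin n) (Quaternion ℝ)) : Prop :=
  ∃ (N : ℕ) (a : Fin N → Matrix (Fin 2) (Fin 2) ℝ)
      (C : Fin N → Matrix (Fin n) (Fin n) (Quaternion ℝ)),
      (∀ l, (a l).PosSemidef) ∧ (∀ l, QuatPSD (C l)) ∧
      B = ∑ l, (a l).map (algebraMap ℝ (Quaternion ℝ)) ⊗ₖ C l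

theorem QSep_zero {n : ℕ} : QSep (0 : Matrix (Fin 2 × Fin n) (Fin 2 × Fin n) (Quaternion ℝ)) :=
  ⟨0, Fin.elim0, Fin.elim0, fun l => l.elim0, fun l => l.elim0, by simp⟩

theorem QSep_add {n : ℕ} {B : Matrix (Fin 2 × Fin n) (Fin 2 × Fin n) (Quaternion ℝ)}
    (hB : QSep B) (a : Matrix (Fin 2) (Fin 2) ℝ) (C : Matrix (Fin n) (Fin n) (Quaternion ℝ))
    (ha : a.PosSemidef) (hC : QuatPSD C) :
    QSep (a.map (algebraMap ℝ (Quaternion ℝ)) ⊗ₖ C + B) := by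
  obtain ⟨N, a', C', h1, h2, rfl⟩ := hB
  refine ⟨N + 1, Fin.cons a a', Fin.cons C C', ?_, ?_, ?_⟩
  · intro l; refine Fin.cases ?_ (fun i => ?_) l
    · simpa using ha
    · simpa using h1 i
  · intro l; refine Fin.cases ?_ (fun i => ?_) l
    · simpa using hC
    · simpa using h2 i
  · simp [Fin.sum_univ_succ]

theorem a_psd (s t : ℝ) : (!![s * s, s * t; s * t, t * t] : Matrix (Fin 2) (Fin 2) ℝ).PosSemidef := by
  have := Matrix.posSemidef_vecMulVec_self_star (R := ℝ) ![s, t]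
  convert this using 1
  ext i j
  fin_cases i <;> fin_cases j <;> simp [Matrix.vecMulVec_apply, mul_comm]

def vl {n : ℕ} (x y : Fin n → Quaternion ℝ) : Fin 2 × Fin n → Quaternion ℝ :=
  fun a => ![x, y] a.1 a.2

theorem blk_vl {n : ℕ} (P Q R : Matrix (Fin n) (Fin n) (Quaternion ℝ)) (x y : Fin n → Quaternion ℝ) :
    blk P Q R *ᵥ vl x y = vl (P *ᵥ x + Q *ᵥ y) (Q *ᵥ x + R *ᵥ y) := by
  ext1 ⟨a, i⟩
  fin_cases a <;> simp [blk, vl, Matrix.mulVec, dotProduct, Fintype.sum_prod_type]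

theorem dot_vl {n : ℕ} (x y x' y' : Fin n → Quaternion ℝ) :
    star (vl x y) ⬝ᵥ vl x' y' = star x ⬝ᵥ x' + star y ⬝ᵥ y' := by
  simp [vl, dotProduct, Fintype.sum_prod_type]

theorem blk_main {n : ℕ} (k : ℕ) : ∀ (P Q R : Matrix (Fin n) (Fin n) (Quaternion ℝ)),
    P.IsHermitian → Q.IsHermitian → R.IsHermitian → QuatPSD (blk P Q R) →
    Module.finrank ℝ (QV (Fin n)) ≤ Module.finrank ℝ (LinearMap.ker (qT P)) + k →
    QSep (blk P Q R) := by
  induction k with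
  | zero => ?_
  | succ k ih => ?_
  all_goals
    intro P Q R hP hQ hR hB hk
    have hPp : QuatPSD P := ⟨hP, fun x => by
      have := hB.2 (vl x 0)
      rw [blk_vl, dot_vl] at this
      simpa using this⟩
    have hker : ∀ x, P *ᵥ x = 0 → Q *ᵥ x = 0 := by
      intro x hx
      have := q_psd_ker hB (vl x 0) (by rw [blk_vl, dot_vl]; simp [hx]; rfl)
      rw [blk_vl] at this
      ext1 i
      have := congrFun this (1, i)
      simpa [vl] using this
    have hcase : qT P = 0 → QSep (blk P Q R) := by
      intro h
      have hPx : ∀ x, P *ᵥ x = 0 := fun x =>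
        congrArg WithLp.ofLp (LinearMap.congr_fun h (WithLp.toLp 2 x))
      have hP0 : P = 0 := Matrix.ext_of_mulVec_single (fun i => by rw [hPx]; simp; rfl)
      have hQ0 : Q = 0 := Matrix.ext_of_mulVec_single (fun i => by rw [hker _ (hPx _)]; simp; rfl)
      have hRp : QuatPSD R := ⟨hR, fun x => by
        have := hB.2 (vl 0 x)
        rw [blk_vl, dot_vl] at this
        simpa using this⟩
      have := QSep_add QSep_zero _ R (a_psd 0 1) hRp
      convert this using 1
      ext1 ⟨a, i⟩ ⟨b, j⟩
      fin_cases a <;> fin_cases b <;> simp [blk, hP0, hQ0, Matrix.kroneckerMap_apply]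
  · apply hcase
    rw [← LinearMap.ker_eq_top]
    exact Submodule.eq_top_of_finrank_eq (le_antisymm (Submodule.finrank_le _) (by simpa using hk))
  · by_cases h0 : qT P = 0
    · exact hcase h0
    obtain ⟨l, x', hx1, hx2⟩ := gen_eig (qT P) (qT Q) (qT_symm hP) (qT_symm hQ) (qT_nonneg hPp)
      (fun x hx => congrArg (WithLp.toLp 2) (hker x.ofLp (congrArg WithLp.ofLp hx))) h0
    set x := x'.ofLp with hx
    set v := P *ᵥ x with hv
    have hQx : Q *ᵥ x = l • v := congrArg WithLp.ofLp hx1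
    have hv0 : v ≠ 0 := fun h => hx2 (congrArg (WithLp.toLp 2) h)
    set p := (star x ⬝ᵥ P *ᵥ x).re with hp
    have hp0 : p ≠ 0 := fun h => hv0 (q_psd_ker hPp x h)
    have hppos : 0 ≤ p := hPp.2 x
    set C := p⁻¹ • Matrix.vecMulVec v (star v) with hC
    have hBz : blk P Q R *ᵥ vl x 0 = vl v (l • v) := by
      rw [blk_vl]; simp [hQx, hv]
    have hps := q_sub_psd hB (vl x 0) p (by rw [hBz, dot_vl]; simp [hp, hv]) hp0
    have hCh : C.IsHermitian := vmv_herm _ _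
    have hsm : ∀ r : ℝ, (r • C).IsHermitian := fun r => by
      rw [hC, smul_smul]; exact vmv_herm _ _
    have hE : blk P Q R - p⁻¹ • Matrix.vecMulVec (blk P Q R *ᵥ vl x 0)
        (star (blk P Q R *ᵥ vl x 0)) = blk (P - C) (Q - l • C) (R - (l * l) • C) := by
      rw [hBz]
      ext1 ⟨a, i⟩ ⟨b, j⟩
      fin_cases a <;> fin_cases b <;>
        simp [blk, vl, hC, Matrix.vecMulVec_apply, smul_smul, mul_comm]
    rw [hE] at hps
    have hS := ih (P - C) (Q - l • C) (R - (l * l) • C) (hP.sub hCh) (hQ.sub (hsm _))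
      (hR.sub (hsm _)) hps (by
        have hlt : LinearMap.ker (qT P) < LinearMap.ker (qT (P - C)) := by
          have hPC : ∀ y, (P - C) *ᵥ y = P *ᵥ y - p⁻¹ • fun i => v i * (star x ⬝ᵥ P *ᵥ y) := by
            intro y
            rw [Matrix.sub_mulVec, hC, Matrix.smul_mulVec, q_vmv, hv, q_herm hP]
          rw [SetLike.lt_iff_le_and_exists]
          refine ⟨fun y hy => ?_, x', ?_, fun h => hx2 h⟩
          · have hy : P *ᵥ y.ofLp = 0 := congrArg WithLp.ofLp hy
            have : (P - C) *ᵥ y.ofLp = 0 := by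
              rw [hPC, hy]; ext1 i; simp
            exact congrArg (WithLp.toLp 2) this
          · have : (P - C) *ᵥ x = 0 := by
              rw [hPC, q_real hP, ← hp, ← hv]
              ext1 i
              simp only [Pi.sub_apply, Pi.smul_apply, Pi.zero_apply, Quaternion.mul_coe_eq_smul,
                smul_smul, inv_mul_cancel₀ hp0, one_smul, sub_self]
            exact congrArg (WithLp.toLp 2) this
        have := Submodule.finrank_lt_finrank_of_lt hlt
        omega)
    have := QSep_add hS _ C (a_psd 1 l) (vmv_psd _ _ (inv_nonneg.2 hppos))
    convert this using 1
    ext1 ⟨a, i⟩ ⟨b, j⟩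
    fin_cases a <;> fin_cases b <;>
      simp [blk, Matrix.kroneckerMap_apply, ← Quaternion.coe_mul_eq_smul]

/-- A positive semidefinite quaternionic hermitian `2n × 2n` matrix
in `S(2) ⊗ Q(n)` (four hermitian blocks, equal off-diagonal blocks) is
`S₊(2) ⊗ Q₊(n)`-separable. -/
theorem stmt_9 (n : ℕ) (hn : 0 < n)
    (B : Matrix (Fin 2 × Fin n) (Fin 2 × Fin n) (Quaternion ℝ))
    (B11 B12 B22 : Matrix (Fin n) (Fin n) (Quaternion ℝ))
    (h11 : B11.IsHermitian) (h12 : B12.IsHermitian) (h22 : B22.IsHermitian)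
    (hblock : ∀ (a b : Fin 2) (i j : Fin n),
      B (a, i) (b, j) = ![![B11, B12], ![B12, B22]] a b i j)
    (hpsd : QuatPSD B) :
    ∃ (N : ℕ) (a : Fin N → Matrix (Fin 2) (Fin 2) ℝ)
      (C : Fin N → Matrix (Fin n) (Fin n) (Quaternion ℝ)),
      (∀ l, (a l).PosSemidef) ∧ (∀ l, QuatPSD (C l)) ∧
      B = ∑ l, (a l).map (algebraMap ℝ (Quaternion ℝ)) ⊗ₖ C l := by
  have hB : B = blk B11 B12 B22 := by
    ext1 ⟨a, i⟩ ⟨b, j⟩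
    exact hblock a b i j
  rw [hB] at hpsd ⊢
  exact blk_main _ B11 B12 B22 h11 h12 h22 hpsd (Nat.le_add_left _ _)
end

section
/- Let B be a quaternionic hermitian 4×4 matrix partitioned into four 2×2 blocks B = [[B11, B12], [B̄12, B22]], where B11 and B22 are real symmetric 2×2 matrices and B12 is a symmetric (B12ᵀ = B12, entrywise transpose without conjugation) quaternionic 2×2 matrix (so B lies in the tensor product space Q(2)⊗S(2)). Then B is positive semidefinite if and only if its transpose Bᵀ (equivalently, its entrywise quaternionic conjugate B̄) is positive semidefinite. -/
open Matrix Kronecker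

lemma exists_orth (a b c : Quaternion ℝ) : ∃ q : Quaternion ℝ, q * star q = 1 ∧ star q * q = 1 ∧
    (a * star q).re = 0 ∧ (b * star q).re = 0 ∧ (c * star q).re = 0 := by
  let f : Quaternion ℝ →ₗ[ℝ] (Fin 3 → ℝ) :=
    LinearMap.pi ![innerₗ (Quaternion ℝ) a, innerₗ (Quaternion ℝ) b, innerₗ (Quaternion ℝ) c]
  have hk : LinearMap.ker f ≠ ⊥ := by
    apply LinearMap.ker_ne_bot_of_finrank_lt
    rw [Quaternion.finrank_eq_four]; simp
  obtain ⟨q, hq, hq0⟩ := Submodule.exists_mem_ne_zero_of_ne_bot hk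
  have hf : f q = 0 := hq
  have ha : (a * star q).re = 0 := by
    have := congrFun hf 0
    simpa [f, Quaternion.inner_def] using this
  have hb : (b * star q).re = 0 := by
    have := congrFun hf 1
    simpa [f, Quaternion.inner_def] using this
  have hc : (c * star q).re = 0 := by
    have := congrFun hf 2
    simpa [f, Quaternion.inner_def] using this
  have hn : ‖q‖ ≠ 0 := norm_ne_zero_iff.2 hq0
  have h1 : (‖q‖⁻¹ * (‖q‖⁻¹ * Quaternion.normSq q) : ℝ) = 1 := by
    rw [Quaternion.normSq_eq_norm_mul_self]; field_simp
  refine ⟨‖q‖⁻¹ • q, ?_, ?_, ?_, ?_, ?_⟩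
  · rw [Quaternion.self_mul_star, Quaternion.normSq_smul, pow_two, mul_assoc, h1]; rfl
  · rw [Quaternion.star_mul_self, Quaternion.normSq_smul, pow_two, mul_assoc, h1]; rfl
  · rw [Quaternion.star_smul, mul_smul_comm, Quaternion.re_smul, ha]; simp
  · rw [Quaternion.star_smul, mul_smul_comm, Quaternion.re_smul, hb]; simp
  · rw [Quaternion.star_smul, mul_smul_comm, Quaternion.re_smul, hc]; simp

lemma star_key {a q : Quaternion ℝ} (h1 : star q * q = 1) (h : (a * star q).re = 0) :
    star a = -(star q * a * star q) := by
  have h2 : star (a * star q) = -(a * star q) := Quaternion.star_eq_neg.2 h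
  rw [star_mul, star_star] at h2
  calc star a = star q * (q * star a) := by rw [← mul_assoc, h1, one_mul]
    _ = _ := by rw [h2, mul_neg, mul_assoc]

lemma psd_congr {ι : Type*} [Fintype ι] {A C : Matrix ι ι (Quaternion ℝ)} (d : ι → Quaternion ℝ)
    (h : ∀ s t, C s t = star (d s) * A s t * d t) (hA : QuatPSD A) : QuatPSD C := by
  refine ⟨?_, fun x => ?_⟩
  · ext1 s t
    rw [conjTranspose_apply, h, h, ← hA.1.apply s t]
    simp [mul_assoc]
  · have := hA.2 (fun s => d s * x s)
    convert this using 2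
    simp only [dotProduct, mulVec, Pi.star_apply, h, star_mul, Finset.mul_sum, mul_assoc]

/-- A quaternionic hermitian `4 × 4` matrix in `Q(2) ⊗ S(2)`
(blocks `[[B11, B12], [conj B12, B22]]` with `B11, B22` real symmetric and `B12`
symmetric) is positive semidefinite if and only if its transpose (equivalently,
its entrywise quaternionic conjugate) is positive semidefinite. -/
theorem stmt_10
    (B : Matrix (Fin 2 × Fin 2) (Fin 2 × Fin 2) (Quaternion ℝ))
    (B11 B22 : Matrix (Fin 2) (Fin 2) ℝ)
    (B12 : Matrix (Fin 2) (Fin 2) (Quaternion ℝ))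
    (h11 : B11.IsSymm) (h22 : B22.IsSymm) (h12 : B12.IsSymm)
    (hblock : ∀ (a b : Fin 2) (i j : Fin 2),
      B (a, i) (b, j) =
        ![![B11.map (algebraMap ℝ (Quaternion ℝ)), B12],
          ![B12.map (star : Quaternion ℝ → Quaternion ℝ),
            B22.map (algebraMap ℝ (Quaternion ℝ))]] a b i j) :
    QuatPSD B ↔ QuatPSD Bᵀ := by
  obtain ⟨q, h1, h2, ha, hb, hc⟩ := exists_orth (B12 0 0) (B12 0 1) (B12 1 1)
  have e12 : B12 1 0 = B12 0 1 := h12.apply 0 1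
  have key : ∀ i j, star (B12 i j) = -(star q * B12 i j * star q) := by
    intro i j
    apply star_key h2
    fin_cases i <;> fin_cases j <;> simp only [Fin.zero_eta, Fin.mk_one, e12] <;> assumption
  have key2 : ∀ i j, B12 i j = -(q * star (B12 i j) * q) := by
    intro i j
    have := congrArg star (key i j)
    simpa [mul_assoc] using this
  have hr : ∀ (p u v : Quaternion ℝ) (r : ℝ), u * v = 1 →
      algebraMap ℝ (Quaternion ℝ) r = u * algebraMap ℝ (Quaternion ℝ) r * v := by
    intro p u v r huv
    rw [← Algebra.commutes, mul_assoc, huv, mul_one]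
  let d : Fin 2 × Fin 2 → Quaternion ℝ := fun s => ![-q, star q] s.1
  have hd : ∀ s, d s * star (d s) = 1 := by
    rintro ⟨a, i⟩
    fin_cases a <;> simp [d, h1, h2]
  have hd' : ∀ s, star (d s) * d s = 1 := by
    rintro ⟨a, i⟩
    fin_cases a <;> simp [d, h1, h2]
  have main : ∀ s t, Bᵀ s t = star (d s) * B s t * d t := by
    rintro ⟨a, i⟩ ⟨b, j⟩
    rw [transpose_apply, hblock, hblock]
    have s11 := h11.apply i j
    have s22 := h22.apply i j
    have s12 := h12.apply i j
    fin_cases a <;> fin_cases b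
    · have := hr 0 (star (d (0, i))) (d (0, j)) (B11 i j) (hd' (0, i))
      simpa [s11] using this
    · have := key i j
      simpa [s12, d] using this
    · have := key2 i j
      simpa [s12, d] using this
    · have := hr 0 (star (d (1, i))) (d (1, j)) (B22 i j) (hd' (1, i))
      simpa [s22] using this
  constructor
  · exact psd_congr d main
  · apply psd_congr (fun s => star (d s))
    intro s t
    rw [main, star_star]
    simp only [← mul_assoc]
    rw [hd, one_mul, mul_assoc, hd, mul_one]
end

section
/- Let n be a positive integer. The transpose of every positive semidefinite quaternionic hermitian n×n matrix is again positive semidefinite if and only if n ≤ 2. In particular, for n = 2 one has: a quaternionic hermitian 2×2 matrix A = (a_{αβ}) is positive semidefinite if and only if a_{11} ≥ 0, a_{22} ≥ 0 and a_{11}a_{22} ≥ |a_{12}|², and hence Q_+(2) is invariant under transposition; while for every n ≥ 3 there exists a positive semidefinite quaternionic hermitian n×n matrix whose transpose is not positive semidefinite. -/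
open Matrix

lemma herm_transpose {n : ℕ} {A : Matrix (Fin n) (Fin n) (Quaternion ℝ)} (h : A.IsHermitian) :
    Aᵀ.IsHermitian := by
  ext1 i j
  have := congrFun (congrFun h j) i
  simpa [Matrix.conjTranspose_apply] using this

lemma form2 (A : Matrix (Fin 2) (Fin 2) (Quaternion ℝ)) (h : A.IsHermitian)
    (x : Fin 2 → Quaternion ℝ) :
    (star x ⬝ᵥ A.mulVec x).re = (A 0 0).re * Quaternion.normSq (x 0)
      + (A 1 1).re * Quaternion.normSq (x 1) + 2 * (star (x 0) * A 0 1 * x 1).re := by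
  have h0 : star (A 0 0) = A 0 0 := congrFun (congrFun h 0) 0
  have h1 : star (A 1 1) = A 1 1 := congrFun (congrFun h 1) 1
  have h2 : star (A 0 1) = A 1 0 := congrFun (congrFun h 1) 0
  have h0' := Quaternion.star_eq_self.mp h0
  have h1' := Quaternion.star_eq_self.mp h1
  simp only [dotProduct, Matrix.mulVec, Fin.sum_univ_two, ← h2, Pi.star_apply]
  rw [h0', h1']
  simp [Quaternion.normSq_def']
  ring

lemma re_sq_le (q : Quaternion ℝ) : q.re ^ 2 ≤ Quaternion.normSq q := by
  rw [Quaternion.normSq_def']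
  nlinarith [sq_nonneg q.imI, sq_nonneg q.imJ, sq_nonneg q.imK]

lemma char2 (A : Matrix (Fin 2) (Fin 2) (Quaternion ℝ)) (h : A.IsHermitian) :
    (QuatPSD A ↔
        0 ≤ (A 0 0).re ∧ 0 ≤ (A 1 1).re ∧ ‖A 0 1‖ ^ 2 ≤ (A 0 0).re * (A 1 1).re) := by
  have hN : ‖A 0 1‖ ^ 2 = Quaternion.normSq (A 0 1) := by
    rw [Quaternion.normSq_eq_norm_mul_self, sq]
  rw [hN]
  constructor
  · rintro ⟨-, hx⟩
    have ha : 0 ≤ (A 0 0).re := by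
      have := hx ![1, 0]
      rw [form2 A h] at this
      have z : QuaternionAlgebra.re (0 : Quaternion ℝ) = 0 := rfl
      simpa [z] using this
    have hd : 0 ≤ (A 1 1).re := by
      have := hx ![0, 1]
      rw [form2 A h] at this
      have z : QuaternionAlgebra.re (0 : Quaternion ℝ) = 0 := rfl
      simpa [z] using this
    have key : ∀ s r : ℝ, 0 ≤ (A 0 0).re * (s ^ 2 * Quaternion.normSq (A 0 1))
        + (A 1 1).re * r ^ 2 + 2 * (s * r * Quaternion.normSq (A 0 1)) := by
      intro s r
      have := hx ![s • A 0 1, (r : Quaternion ℝ)]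
      rw [form2 A h] at this
      have e1 : Quaternion.normSq (s • A 0 1) = s ^ 2 * Quaternion.normSq (A 0 1) := by
        simp only [Quaternion.normSq_def', Quaternion.re_smul, Quaternion.imI_smul,
          Quaternion.imJ_smul, Quaternion.imK_smul, smul_eq_mul]
        ring
      have e2 : Quaternion.normSq (r : Quaternion ℝ) = r ^ 2 := Quaternion.normSq_coe r
      have e3 : (star (s • A 0 1) * A 0 1 * (r : Quaternion ℝ)).re
          = s * r * Quaternion.normSq (A 0 1) := by
        simp [Quaternion.normSq_def']
        ring
      simp only [Matrix.cons_val_zero, Matrix.cons_val_one, e1, e2, e3] at this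
      exact this
    refine ⟨ha, hd, ?_⟩
    have hb : 0 ≤ Quaternion.normSq (A 0 1) := Quaternion.normSq_nonneg
    generalize (A 0 0).re = a at *
    generalize (A 1 1).re = d at *
    generalize Quaternion.normSq (A 0 1) = N at *
    rcases ha.eq_or_lt with h0 | h0
    · subst h0
      by_contra hlt
      have hN0 : 0 < N := by linarith
      have := key (-((d + 1) / N)) 1
      have e : -((d + 1) / N) * 1 * N = -(d + 1) := by field_simp
      rw [e] at this
      linarith
    · have := key (-1) a
      by_contra hlt
      push Not at hlt
      nlinarith [mul_pos h0 (sub_pos.mpr hlt)]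
  · rintro ⟨ha, hd, hb⟩
    refine ⟨h, fun x => ?_⟩
    rw [form2 A h]
    have ht := re_sq_le (star (x 0) * A 0 1 * x 1)
    rw [map_mul, map_mul, Quaternion.normSq_star] at ht
    have p0 : 0 ≤ Quaternion.normSq (x 0) := Quaternion.normSq_nonneg
    have p1 : 0 ≤ Quaternion.normSq (x 1) := Quaternion.normSq_nonneg
    have hb' := mul_le_mul_of_nonneg_right hb (mul_nonneg p0 p1)
    generalize (star (x 0) * A 0 1 * x 1).re = t at *
    have q0 := mul_nonneg ha p0
    have q1 := mul_nonneg hd p1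
    have : |2 * t| ≤ (A 0 0).re * Quaternion.normSq (x 0)
        + (A 1 1).re * Quaternion.normSq (x 1) := by
      refine abs_le_of_sq_le_sq ?_ (add_nonneg q0 q1)
      nlinarith [sq_nonneg ((A 0 0).re * Quaternion.normSq (x 0)
        - (A 1 1).re * Quaternion.normSq (x 1))]
    linarith [(abs_le.mp this).1]

lemma rank1 {n : ℕ} (v : Fin n → Quaternion ℝ) :
    QuatPSD (Matrix.vecMulVec v (star v)) := by
  constructor
  · ext1 i j
    simp [Matrix.conjTranspose_apply, Matrix.vecMulVec_apply]
  · intro x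
    have : star x ⬝ᵥ (Matrix.vecMulVec v (star v)).mulVec x
        = star (star v ⬝ᵥ x) * (star v ⬝ᵥ x) := by
      simp only [dotProduct, Matrix.mulVec, Matrix.vecMulVec_apply, star_sum, Finset.sum_mul,
        star_mul, Pi.star_apply, star_star, mul_assoc, ← Finset.mul_sum]
    rw [this, Quaternion.star_mul_self]
    simpa using Quaternion.normSq_nonneg

lemma counter (n : ℕ) (hn : 3 ≤ n) :
    ∃ A : Matrix (Fin n) (Fin n) (Quaternion ℝ), QuatPSD A ∧ ¬ QuatPSD Aᵀ := by
  obtain ⟨m, rfl⟩ := Nat.exists_eq_add_of_le' hn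
  let I : Quaternion ℝ := ⟨0, 1, 0, 0⟩
  let J : Quaternion ℝ := ⟨0, 0, 1, 0⟩
  let v : Fin (m + 3) → Quaternion ℝ := Fin.cons 1 (Fin.cons I (Fin.cons J fun _ => 0))
  refine ⟨Matrix.vecMulVec v (star v), rank1 v, fun h => ?_⟩
  have := h.2 v
  have v0 : v 0 = 1 := rfl
  have v1 : v 1 = I := rfl
  have v2 : v 2 = J := rfl
  have v3 : ∀ k : Fin m, v k.succ.succ.succ = 0 := fun _ => rfl
  clear_value v
  have hs : ∀ f : Fin (m + 3) → Quaternion ℝ, (∀ k : Fin m, f k.succ.succ.succ = 0) →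
      ∑ k, f k = f 0 + f 1 + f 2 := by
    intro f hf
    rw [Fin.sum_univ_succ, Fin.sum_univ_succ, Fin.sum_univ_succ, Finset.sum_eq_zero
      (fun k _ => hf k), add_zero, ← add_assoc]
    rfl
  have e : (star v ⬝ᵥ (Matrix.vecMulVec v (star v))ᵀ.mulVec v).re = -3 := by
    simp only [dotProduct, Matrix.mulVec, Matrix.vecMulVec_apply, Matrix.transpose_apply,
      Pi.star_apply]
    rw [hs _ (fun k => by simp [v3]), hs _ (fun k => by simp [v3]), hs _ (fun k => by simp [v3]),
      hs _ (fun k => by simp [v3]), v0, v1, v2]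
    have i0 : I.re = 0 := rfl
    have i1 : I.imI = 1 := rfl
    have i2 : I.imJ = 0 := rfl
    have i3 : I.imK = 0 := rfl
    have j0 : J.re = 0 := rfl
    have j1 : J.imI = 0 := rfl
    have j2 : J.imJ = 1 := rfl
    have j3 : J.imK = 0 := rfl
    have o0 : (1 : Quaternion ℝ).re = 1 := rfl
    clear_value I J
    simp only [Quaternion.re_add, Quaternion.re_mul, Quaternion.imI_add, Quaternion.imI_mul,
      Quaternion.imJ_add, Quaternion.imJ_mul, Quaternion.imK_add, Quaternion.imK_mul,
      Quaternion.re_star, Quaternion.imI_star, Quaternion.imJ_star, Quaternion.imK_star,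
      star_one, one_mul, mul_one, i0, i1, i2, i3, j0, j1, j2, j3, o0]
    norm_num
  rw [e] at this
  norm_num at this

/-- The transpose of every PSD quaternionic hermitian `n × n` matrix
is PSD iff `n ≤ 2`; a quaternionic hermitian `2 × 2` matrix `A` is PSD iff
`a₁₁ ≥ 0`, `a₂₂ ≥ 0` and `a₁₁ a₂₂ ≥ |a₁₂|²` (so `Q₊(2)` is invariant under
transposition); and for every `n ≥ 3` there is a PSD quaternionic hermitian
`n × n` matrix whose transpose is not PSD. -/
theorem stmt_11 (n : ℕ) (hn : 0 < n) :
    ((∀ A : Matrix (Fin n) (Fin n) (Quaternion ℝ), QuatPSD A → QuatPSD Aᵀ) ↔ n ≤ 2) ∧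
    (∀ A : Matrix (Fin 2) (Fin 2) (Quaternion ℝ), A.IsHermitian →
      (QuatPSD A ↔
        0 ≤ (A 0 0).re ∧ 0 ≤ (A 1 1).re ∧ ‖A 0 1‖ ^ 2 ≤ (A 0 0).re * (A 1 1).re)) ∧
    (3 ≤ n → ∃ A : Matrix (Fin n) (Fin n) (Quaternion ℝ), QuatPSD A ∧ ¬ QuatPSD Aᵀ) := by
  refine ⟨⟨fun h => ?_, fun h A hA => ?_⟩, char2, counter n⟩
  · by_contra hlt
    obtain ⟨A, h1, h2⟩ := counter n (by omega)
    exact h2 (h A h1)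
  · obtain rfl | rfl : n = 1 ∨ n = 2 := by omega
    · have : Aᵀ = A := by
        ext1 i j
        rw [Matrix.transpose_apply, Subsingleton.elim i j]
      rwa [this]
    · have h2 : star (A 0 1) = A 1 0 := congrFun (congrFun hA.1 1) 0
      rw [char2 _ (herm_transpose hA.1)]
      have := (char2 A hA.1).1 hA
      simpa [← h2] using this
end
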